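/- There are no natural numbers n, k with 2 ≤ k ≤ n/2 and 2 ≤ k+2 ≤ (n-1)/2 such that C(n, k) = C(n-1, k+2), where C denotes the binomial coefficient. -/

import Mathlib

/-- Elements `a + b α + c α²` of `ℤ[α]`, where `α³ = α² + 2`. -/
@[ext]
structure CubicInt where
  a : ℤ
  b : ℤ
  c : ℤ

namespace CubicInt

instance : Zero CubicInt := ⟨⟨0, 0, 0⟩⟩
instance : One CubicInt := ⟨⟨1, 0, 0⟩⟩
instance : Add CubicInt := ⟨fun x y => ⟨x.a + y.a, x.b + y.b, x.c + y.c⟩⟩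
instance : Neg CubicInt := ⟨fun x => ⟨-x.a, -x.b, -x.c⟩⟩
instance : Sub CubicInt := ⟨fun x y => ⟨x.a - y.a, x.b - y.b, x.c - y.c⟩⟩
instance : Mul CubicInt := ⟨fun x y =>
  ⟨x.a * y.a + 2 * (x.b * y.c + x.c * y.b) + 2 * x.c * y.c,
   x.a * y.b + x.b * y.a + 2 * x.c * y.c,
   x.a * y.c + x.b * y.b + x.c * y.a + x.b * y.c + x.c * y.b + x.c * y.c⟩⟩

@[simp] lemma zero_a : (0 : CubicInt).a = 0 := rfl
@[simp] lemma zero_b : (0 : CubicInt).b = 0 := rfl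
@[simp] lemma zero_c : (0 : CubicInt).c = 0 := rfl
@[simp] lemma one_a : (1 : CubicInt).a = 1 := rfl
@[simp] lemma one_b : (1 : CubicInt).b = 0 := rfl
@[simp] lemma one_c : (1 : CubicInt).c = 0 := rfl
@[simp] lemma add_a (x y : CubicInt) : (x + y).a = x.a + y.a := rfl
@[simp] lemma add_b (x y : CubicInt) : (x + y).b = x.b + y.b := rfl
@[simp] lemma add_c (x y : CubicInt) : (x + y).c = x.c + y.c := rfl
@[simp] lemma neg_a (x : CubicInt) : (-x).a = -x.a := rfl
@[simp] lemma neg_b (x : CubicInt) : (-x).b = -x.b := rfl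
@[simp] lemma neg_c (x : CubicInt) : (-x).c = -x.c := rfl
@[simp] lemma sub_a (x y : CubicInt) : (x - y).a = x.a - y.a := rfl
@[simp] lemma sub_b (x y : CubicInt) : (x - y).b = x.b - y.b := rfl
@[simp] lemma sub_c (x y : CubicInt) : (x - y).c = x.c - y.c := rfl
@[simp] lemma mul_a (x y : CubicInt) :
    (x * y).a = x.a * y.a + 2 * (x.b * y.c + x.c * y.b) + 2 * x.c * y.c := rfl
@[simp] lemma mul_b (x y : CubicInt) :
    (x * y).b = x.a * y.b + x.b * y.a + 2 * x.c * y.c := rfl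
@[simp] lemma mul_c (x y : CubicInt) :
    (x * y).c = x.a * y.c + x.b * y.b + x.c * y.a + x.b * y.c + x.c * y.b + x.c * y.c := rfl

instance : CommRing CubicInt where
  add_assoc x y z := by ext <;> simp <;> ring
  zero_add x := by ext <;> simp
  add_zero x := by ext <;> simp
  add_comm x y := by ext <;> simp <;> ring
  left_distrib x y z := by ext <;> simp <;> ring
  right_distrib x y z := by ext <;> simp <;> ring
  zero_mul x := by ext <;> simp
  mul_zero x := by ext <;> simp
  mul_assoc x y z := by ext <;> simp <;> ring
  one_mul x := by ext <;> simp
  mul_one x := by ext <;> simp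
  neg_add_cancel x := by ext <;> simp
  sub_eq_add_neg x y := by ext <;> simp <;> ring
  mul_comm x y := by ext <;> simp <;> ring
  nsmul := nsmulRec
  zsmul := zsmulRec

/-- The norm form of `ℤ[α]`. -/
def normForm (a b c : ℤ) : ℤ :=
  a ^ 3 + a ^ 2 * b + a ^ 2 * c - 6 * a * b * c - 4 * a * c ^ 2 + 2 * b ^ 3 + 2 * b ^ 2 * c
    + 4 * c ^ 3

/-- The norm from `ℤ[α]` to `ℤ`. -/
def norm (x : CubicInt) : ℤ := normForm x.a x.b x.c

/-- The product of the two other conjugates. -/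
def adj (x : CubicInt) : CubicInt :=
  ⟨x.a * (x.a + x.b + x.c) - 2 * x.c * (x.b + x.c),
   -(x.b * (x.a + x.b + x.c) - 2 * x.c ^ 2), x.b * (x.b + x.c) - x.a * x.c⟩

/-- The inclusion of `ℤ`. -/
def ofInt (n : ℤ) : CubicInt := ⟨n, 0, 0⟩

lemma mul_adj (x : CubicInt) : x * adj x = ofInt (norm x) := by
  ext <;> simp [adj, ofInt, norm, normForm] <;> ring

lemma norm_mul (x y : CubicInt) : norm (x * y) = norm x * norm y := by
  simp only [norm, normForm, mul_a, mul_b, mul_c]; ring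

@[simp] lemma norm_one : norm 1 = 1 := by simp [norm, normForm]

lemma norm_ofInt (n : ℤ) : norm (ofInt n) = n ^ 3 := by simp [norm, normForm, ofInt]

lemma ofInt_mul (m n : ℤ) : ofInt (m * n) = ofInt m * ofInt n := by
  ext <;> simp [ofInt]

lemma three_dvd_of_normForm {a b c : ℤ} (h : (3 : ℤ) ∣ normForm a b c) : 3 ∣ a ∧ 3 ∣ b ∧ 3 ∣ c := by
  have key : ∀ a b c : ZMod 3, a ^ 3 + a ^ 2 * b + a ^ 2 * c - 6 * a * b * c - 4 * a * c ^ 2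
      + 2 * b ^ 3 + 2 * b ^ 2 * c + 4 * c ^ 3 = 0 → a = 0 ∧ b = 0 ∧ c = 0 := by decide
  have h' := (ZMod.intCast_zmod_eq_zero_iff_dvd _ 3).2 h
  simp only [normForm] at h'
  push_cast at h'
  have := key _ _ _ h'
  exact ⟨(ZMod.intCast_zmod_eq_zero_iff_dvd _ 3).1 this.1,
    (ZMod.intCast_zmod_eq_zero_iff_dvd _ 3).1 this.2.1,
    (ZMod.intCast_zmod_eq_zero_iff_dvd _ 3).1 this.2.2⟩

lemma normForm_eq_zero (n : ℕ) : ∀ a b c : ℤ, a.natAbs + b.natAbs + c.natAbs ≤ n →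
    normForm a b c = 0 → a = 0 ∧ b = 0 ∧ c = 0 := by
  induction n with
  | zero => intro a b c h _; omega
  | succ n ih =>
    intro a b c h h0
    obtain ⟨⟨a', rfl⟩, ⟨b', rfl⟩, ⟨c', rfl⟩⟩ := three_dvd_of_normForm (h0 ▸ dvd_zero _)
    have h1 : normForm a' b' c' = 0 := by
      have : normForm (3 * a') (3 * b') (3 * c') = 27 * normForm a' b' c' := by
        simp only [normForm]; ring
      omega
    by_cases hz : a' = 0 ∧ b' = 0 ∧ c' = 0
    · omega
    · have := ih a' b' c' (by omega) h1
      omega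

lemma norm_eq_zero {x : CubicInt} : norm x = 0 ↔ x = 0 := by
  constructor
  · intro h
    obtain ⟨h1, h2, h3⟩ := normForm_eq_zero _ _ _ _ le_rfl h
    ext <;> assumption
  · rintro rfl; simp [norm, normForm]

instance : Nontrivial CubicInt := ⟨0, 1, fun h => by simpa using congrArg CubicInt.a h⟩

instance : NoZeroDivisors CubicInt where
  eq_zero_or_eq_zero_of_mul_eq_zero {x y} h := by
    rw [← norm_eq_zero, ← norm_eq_zero (x := y), ← mul_eq_zero, ← norm_mul, h]
    simp [norm, normForm]

instance : IsDomain CubicInt := NoZeroDivisors.to_isDomain _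

/-- A bound for `|normForm (a + h₁) (b + h₂) (c + h₃)|` when each `|hᵢ| ≤ 1`. -/
def boxBound (a b c : ℤ) : ℤ :=
  |normForm a b c|
    + (|3 * a ^ 2 + 2 * a * b + 2 * a * c - 6 * b * c - 4 * c ^ 2|
      + |a ^ 2 - 6 * a * c + 6 * b ^ 2 + 4 * b * c|
      + |a ^ 2 - 6 * a * b - 8 * a * c + 2 * b ^ 2 + 12 * c ^ 2|)
    + (|3 * a + b + c| + |2 * a - 6 * c| + |2 * a - 6 * b - 8 * c| + |6 * b + 2 * c|
      + |-(6 * a) + 4 * b| + |-(4 * a) + 12 * c|)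
    + 21

lemma exists_boxBound_lt : ∀ i j k : Fin 8, ∃ p q r : Fin 2,
    boxBound (2 * i + 1 - 16 * p) (2 * j + 1 - 16 * q) (2 * k + 1 - 16 * r) < 4096 := by
  decide +kernel

lemma abs_mul_le {x y a b : ℤ} (hx : |x| ≤ a) (hy : |y| ≤ b) : |x * y| ≤ a * b := by
  rw [abs_mul]; exact mul_le_mul hx hy (abs_nonneg _) ((abs_nonneg _).trans hx)

lemma abs_normForm_le (N a b c h k l : ℤ) (hh : |h| ≤ N) (hk : |k| ≤ N)
    (hl : |l| ≤ N) :
    |normForm (N * a + h) (N * b + k) (N * c + l)| ≤ N ^ 3 * boxBound a b c := by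
  have hN : 0 ≤ N := (abs_nonneg _).trans hh
  have e : normForm (N * a + h) (N * b + k) (N * c + l)
      = N ^ 3 * normForm a b c
      + (N ^ 2 * (3 * a ^ 2 + 2 * a * b + 2 * a * c - 6 * b * c - 4 * c ^ 2)) * h
      + (N ^ 2 * (a ^ 2 - 6 * a * c + 6 * b ^ 2 + 4 * b * c)) * k
      + (N ^ 2 * (a ^ 2 - 6 * a * b - 8 * a * c + 2 * b ^ 2 + 12 * c ^ 2)) * l
      + (N * (3 * a + b + c)) * (h * h) + (N * (2 * a - 6 * c)) * (h * k)
      + (N * (2 * a - 6 * b - 8 * c)) * (h * l) + (N * (6 * b + 2 * c)) * (k * k)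
      + (N * (-(6 * a) + 4 * b)) * (k * l) + (N * (-(4 * a) + 12 * c)) * (l * l)
      + normForm h k l := by
    simp only [normForm]; ring
  have t1 : ∀ z w : ℤ, |w| ≤ N → |N ^ 2 * z * w| ≤ N ^ 3 * |z| := fun z w hw => by
    rw [abs_mul, abs_mul, abs_of_nonneg (pow_nonneg hN 2)]
    calc _ ≤ N ^ 2 * |z| * N := by gcongr
      _ = _ := by ring
  have t2 : ∀ z w : ℤ, |w| ≤ N * N → |N * z * w| ≤ N ^ 3 * |z| := fun z w hw => by
    rw [abs_mul, abs_mul, abs_of_nonneg hN]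
    calc _ ≤ N * |z| * (N * N) := by gcongr
      _ = _ := by ring
  have t3 : ∀ x y z : ℤ, |x| ≤ N → |y| ≤ N → |z| ≤ N → |x * y * z| ≤ N ^ 3 :=
    fun x y z hx hy hz => (abs_mul_le (abs_mul_le hx hy) hz).trans_eq (by ring)
  have t0 : |N ^ 3 * normForm a b c| ≤ N ^ 3 * |normForm a b c| := by
    rw [abs_mul, abs_of_nonneg (pow_nonneg hN 3)]
  have c3 : |normForm h k l| ≤ N ^ 3 * 21 := by
    have e1 := abs_le.1 (t3 h h h hh hh hh)
    have e2 := abs_le.1 (t3 h h k hh hh hk)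
    have e3 := abs_le.1 (t3 h h l hh hh hl)
    have e4 := abs_le.1 (t3 h k l hh hk hl)
    have e5 := abs_le.1 (t3 h l l hh hl hl)
    have e6 := abs_le.1 (t3 k k k hk hk hk)
    have e7 := abs_le.1 (t3 k k l hk hk hl)
    have e8 := abs_le.1 (t3 l l l hl hl hl)
    rw [abs_le]; simp only [normForm]
    constructor <;> linarith [e1.1, e1.2, e2.1, e2.2, e3.1, e3.2, e4.1, e4.2, e5.1, e5.2, e6.1,
        e6.2, e7.1, e7.2, e8.1, e8.2]
  rw [e, boxBound]
  have a1 := abs_le.1 (t1 (3 * a ^ 2 + 2 * a * b + 2 * a * c - 6 * b * c - 4 * c ^ 2) h hh)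
  have a2 := abs_le.1 (t1 (a ^ 2 - 6 * a * c + 6 * b ^ 2 + 4 * b * c) k hk)
  have a3 := abs_le.1 (t1 (a ^ 2 - 6 * a * b - 8 * a * c + 2 * b ^ 2 + 12 * c ^ 2) l hl)
  have b1 := abs_le.1 (t2 (3 * a + b + c) _ (abs_mul_le hh hh))
  have b2 := abs_le.1 (t2 (2 * a - 6 * c) _ (abs_mul_le hh hk))
  have b3 := abs_le.1 (t2 (2 * a - 6 * b - 8 * c) _ (abs_mul_le hh hl))
  have b4 := abs_le.1 (t2 (6 * b + 2 * c) _ (abs_mul_le hk hk))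
  have b5 := abs_le.1 (t2 (-(6 * a) + 4 * b) _ (abs_mul_le hk hl))
  have b6 := abs_le.1 (t2 (-(4 * a) + 12 * c) _ (abs_mul_le hl hl))
  have t0 := abs_le.1 t0
  have c3 := abs_le.1 c3
  simp only [mul_add]
  rw [abs_le]
  constructor <;> linarith [a1.1, a1.2, a2.1, a2.2, a3.1, a3.2, b1.1, b1.2, b2.1, b2.2, b3.1, b3.2,
    b4.1, b4.2, b5.1, b5.2, b6.1, b6.2, t0.1, t0.2, c3.1, c3.2]

lemma exists_box (N t : ℤ) (hN : 0 < N) :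
    ∃ (m : ℤ) (i : Fin 8) (h : ℤ), |h| ≤ N ∧ 16 * t = N * (16 * m + (2 * i + 1)) + h := by
  have h1 := Int.emod_nonneg t hN.ne'
  have h2 := Int.emod_lt_of_pos t hN
  have h3 := Int.mul_ediv_add_emod t N
  set r := t % N
  have g1 : 0 ≤ 8 * r / N := Int.ediv_nonneg (by linarith) hN.le
  have g2 : 8 * r / N < 8 := Int.ediv_lt_of_lt_mul hN (by linarith)
  have g3 := Int.mul_ediv_add_emod (8 * r) N
  have g4 := Int.emod_nonneg (8 * r) hN.ne'
  have g5 := Int.emod_lt_of_pos (8 * r) hN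
  refine ⟨t / N, ⟨(8 * r / N).toNat, by omega⟩, 2 * (8 * r % N) - N, ?_, ?_⟩
  · rw [abs_le]; constructor <;> linarith
  · have : (((8 * r / N).toNat : ℕ) : ℤ) = 8 * r / N := Int.toNat_of_nonneg g1
    simp only [this]
    linarith

lemma exists_norm_sub_lt (x y : CubicInt) (hy : y ≠ 0) : ∃ q : CubicInt,
    |norm (x - y * q)| < |norm y| := by
  have hn : norm y ≠ 0 := fun h => hy (norm_eq_zero.1 h)
  have hN : 0 < |norm y| := abs_pos.2 hn
  obtain ⟨m₁, i, h₁, hh₁, e₁⟩ := exists_box _ (x * adj y).a hN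
  obtain ⟨m₂, j, h₂, hh₂, e₂⟩ := exists_box _ (x * adj y).b hN
  obtain ⟨m₃, k, h₃, hh₃, e₃⟩ := exists_box _ (x * adj y).c hN
  obtain ⟨p, q, r, hb⟩ := exists_boxBound_lt i j k
  obtain ⟨s, hs⟩ : ∃ s : ℤ, |norm y| = norm y * s :=
    ⟨(norm y).sign, by rw [mul_comm, Int.sign_mul_self_eq_abs]⟩
  refine ⟨⟨s * (m₁ + p), s * (m₂ + q), s * (m₃ + r)⟩, ?_⟩
  have key := abs_normForm_le _ (2 * i + 1 - 16 * p) (2 * j + 1 - 16 * q)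
    (2 * k + 1 - 16 * r) h₁ h₂ h₃ hh₁ hh₂ hh₃
  set z := x - y * ⟨s * (m₁ + p), s * (m₂ + q), s * (m₃ + r)⟩ with hz
  have hzy : z * adj y =
      x * adj y - ofInt (norm y) * ⟨s * (m₁ + p), s * (m₂ + q), s * (m₃ + r)⟩ := by
    rw [hz, ← mul_adj]; ring
  have ea : 16 * (z * adj y).a = |norm y| * (2 * i + 1 - 16 * p) + h₁ := by
    rw [hzy]; simp [ofInt] at e₁ ⊢; rw [mul_sub, e₁, hs]; ring
  have eb : 16 * (z * adj y).b = |norm y| * (2 * j + 1 - 16 * q) + h₂ := by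
    rw [hzy]; simp [ofInt] at e₂ ⊢; rw [mul_sub, e₂, hs]; ring
  have ec : 16 * (z * adj y).c = |norm y| * (2 * k + 1 - 16 * r) + h₃ := by
    rw [hzy]; simp [ofInt] at e₃ ⊢; rw [mul_sub, e₃, hs]; ring
  rw [← ea, ← eb, ← ec] at key
  have e16 : normForm (16 * (z * adj y).a) (16 * (z * adj y).b) (16 * (z * adj y).c)
      = 4096 * (norm z * norm (adj y)) := by
    rw [← norm_mul]; simp only [norm, normForm]; ring
  have hadj : norm (adj y) = norm y ^ 2 := by
    have := congrArg norm (mul_adj y)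
    rw [norm_mul, norm_ofInt] at this
    apply mul_left_cancel₀ hn; rw [this]; ring
  rw [e16, hadj, abs_mul, abs_mul, abs_pow] at key
  have h4 : |norm z| * |norm y| ^ 2 < |norm y| * |norm y| ^ 2 := by
    have := mul_lt_mul_of_pos_left hb (pow_pos hN 3)
    have e' : |(4096 : ℤ)| = 4096 := rfl
    rw [e'] at key
    nlinarith
  exact lt_of_mul_lt_mul_right h4 (by positivity)

noncomputable instance : EuclideanDomain CubicInt where
  quotient x y := open Classical in
    if h : y = 0 then 0 else Classical.choose (exists_norm_sub_lt x y h)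
  quotient_zero x := by simp
  remainder x y := open Classical in
    x - y * if h : y = 0 then 0 else Classical.choose (exists_norm_sub_lt x y h)
  quotient_mul_add_remainder_eq x y := by simp
  r x y := (norm x).natAbs < (norm y).natAbs
  r_wellFounded := (measure fun x => (norm x).natAbs).wf
  remainder_lt x y h := by
    have := Classical.choose_spec (exists_norm_sub_lt x y h)
    simp only [h, dif_neg, not_false_eq_true]
    zify; exact this
  mul_left_not_lt x y h := by
    rw [norm_mul, Int.natAbs_mul, not_lt]
    exact Nat.le_mul_of_pos_right _ (Int.natAbs_pos.2 fun h' => h (norm_eq_zero.1 h'))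

end CubicInt

namespace CubicInt

/-- The fundamental unit `1 + α + α²`. -/
def eta : CubicInt := ⟨1, 1, 1⟩

/-- The unit `1 + α + α²` together with its inverse. -/
def etaUnit : CubicIntˣ where
  val := eta
  inv := ⟨-1, -1, 1⟩
  val_inv := by ext <;> simp [eta]
  inv_val := by ext <;> simp [eta]

lemma exists_real_root : ∃ t : ℝ, t ^ 3 = t ^ 2 + 2 ∧ 1.695 < t ∧ t < 1.696 := by
  have hc : ContinuousOn (fun t : ℝ => t ^ 3 - t ^ 2) (Set.Icc 1.695 1.696) := by fun_prop
  have := intermediate_value_Ioo (by norm_num) hc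
  obtain ⟨t, ht, h⟩ := this (show (2 : ℝ) ∈ _ by constructor <;> norm_num)
  exact ⟨t, by simp only at h; linarith, ht.1, ht.2⟩

/-- The embedding `ℤ[α] → ℝ` given by a real root of `t³ = t² + 2`. -/
def realHom (t : ℝ) (ht : t ^ 3 = t ^ 2 + 2) : CubicInt →+* ℝ where
  toFun x := x.a + x.b * t + x.c * t ^ 2
  map_one' := by simp
  map_zero' := by simp
  map_add' x y := by simp; ring
  map_mul' x y := by
    simp only [mul_a, mul_b, mul_c]
    push_cast
    linear_combination (-(x.c * y.c * t) - (x.b * y.c + x.c * y.b + x.c * y.c)) * ht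

lemma eq_one_of_mem_Ico {t : ℝ} (ht : t ^ 3 = t ^ 2 + 2) (h₁ : 1.695 < t) (h₂ : t < 1.696)
    (x : CubicInt) (hx : norm x = 1) (hl : 1 ≤ realHom t ht x)
    (hu : realHom t ht x < realHom t ht eta) : x = 1 := by
  obtain ⟨a, b, c⟩ := x
  simp only [realHom, eta, RingHom.coe_mk, MonoidHom.coe_mk, OneHom.coe_mk, Int.cast_one] at hl hu
  set r : ℝ := a + b * t + c * t ^ 2 with hr
  set s : ℝ := a - c * (t ^ 2 - t) with hs
  set w : ℝ := b - c * (t - 1) with hw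
  have hsq1 : (2.873 : ℝ) < t ^ 2 := by nlinarith
  have hsq2 : t ^ 2 < (2.8765 : ℝ) := by nlinarith
  have hN : r * (s ^ 2 - (t - 1) * s * w + (t ^ 2 - t) * w ^ 2) = 1 := by
    have : (norm ⟨a, b, c⟩ : ℝ) = 1 := by exact_mod_cast hx
    simp only [norm, normForm] at this
    push_cast at this
    refine Eq.trans ?_ this
    rw [hr, hs, hw]
    have h4 : t ^ 4 = t ^ 2 + 2 * t + 2 := by linear_combination (t + 1) * ht
    have h5 : t ^ 5 = 3 * t ^ 2 + 2 * t + 2 := by linear_combination (t ^ 2 + t + 1) * ht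
    have h6 : t ^ 6 = 5 * t ^ 2 + 2 * t + 6 := by linear_combination (t ^ 3 + t ^ 2 + t + 3) * ht
    ring_nf
    rw [h6, h5, h4, ht]
    ring
  have hQ0 : 0 < s ^ 2 - (t - 1) * s * w + (t ^ 2 - t) * w ^ 2 := by
    by_contra h; nlinarith
  have hQ : s ^ 2 - (t - 1) * s * w + (t ^ 2 - t) * w ^ 2 ≤ 1 := by
    nlinarith
  have hw1 : w ^ 2 < 1 := by nlinarith [sq_nonneg (2 * s - (t - 1) * w), sq_nonneg w]
  have hs1 : s ^ 2 < 1.2 := by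
    nlinarith [sq_nonneg (2 * (t ^ 2 - t) * w - (t - 1) * s), sq_nonneg s]
  have hw2 : -1 < w ∧ w < 1 := ⟨by nlinarith, by nlinarith⟩
  have hs2 : -1.1 < s ∧ s < 1.1 := ⟨by nlinarith, by nlinarith⟩
  have hrc : r = s + w * t + c * (3 * t ^ 2 - 2 * t) := by
    rw [hr, hs, hw]; ring
  have hc0 : (-1 : ℝ) < c := by
    by_contra h
    push Not at h
    nlinarith [hw2.2, hs2.2]
  have hc1 : (c : ℝ) < 2 := by
    by_contra h
    push Not at h
    nlinarith [hw2.1, hs2.1]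
  have hc0' : -1 < c := by exact_mod_cast hc0
  have hc1' : c < 2 := by exact_mod_cast hc1
  have hc : c = 0 ∨ c = 1 := by omega
  rcases hc with rfl | rfl
  · simp only [Int.cast_zero, zero_mul, sub_zero] at hs hw
    rw [hs] at hs2
    rw [hw] at hw2
    have e1 : -1 < b := by exact_mod_cast hw2.1
    have e2 : b < 1 := by exact_mod_cast hw2.2
    have hb : b = 0 := by omega
    subst hb
    simp [norm, normForm] at hx
    have : a = 1 := by nlinarith [sq_nonneg (a + 1), sq_nonneg a]
    subst this; rfl
  · simp only [Int.cast_one, one_mul] at hs hw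
    have e1 : (0 : ℝ) < a := by linarith [hs2.1]
    have e2 : (a : ℝ) < 3 := by linarith [hs2.2]
    have e3 : (-1 : ℝ) < b := by linarith [hw2.1]
    have e4 : (b : ℝ) < 2 := by linarith [hw2.2]
    clear_value r s w
    clear hN hQ0 hQ hw1 hs1 hw2 hs2 hrc hs hw
    have e1 : 0 < a := by exact_mod_cast e1
    have e2 : a < 3 := by exact_mod_cast e2
    have e3 : -1 < b := by exact_mod_cast e3
    have e4 : b < 2 := by exact_mod_cast e4
    have ha : a = 1 ∨ a = 2 := by omega
    have hb : b = 0 ∨ b = 1 := by omega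
    exfalso
    rcases ha with rfl | rfl <;> rcases hb with rfl | rfl <;> norm_num [norm, normForm] at hx
    rw [hr] at hu
    norm_num at hu

lemma unit_eq_sq_or (u : CubicIntˣ) (hu : norm u = 1) :
    ∃ v : CubicInt, (u : CubicInt) = v ^ 2 ∨ (u : CubicInt) = eta * v ^ 2 := by
  obtain ⟨t, ht, h₁, h₂⟩ := exists_real_root
  set φ := realHom t ht with hφ
  have hev : φ eta = 1 + t + t ^ 2 := by simp [hφ, realHom, eta]
  have he : 1 < φ eta := by rw [hev]; nlinarith
  have hpos : 0 < φ u := by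
    have : φ (u : CubicInt) * φ (adj u) = 1 := by
      rw [← map_mul, mul_adj, hu]; exact map_one φ
    have h3 : 0 ≤ φ (adj u) := by
      obtain ⟨a, b, c⟩ := (u : CubicInt)
      simp only [hφ, realHom, adj, RingHom.coe_mk, MonoidHom.coe_mk, OneHom.coe_mk]
      push_cast
      set s : ℝ := a - c * (t ^ 2 - t) with hs
      set w : ℝ := b - c * (t - 1) with hw
      have e : (a * (a + b + c) - 2 * c * (b + c) + -(b * (a + b + c) - 2 * c ^ 2) * t
          + (b * (b + c) - a * c) * t ^ 2 : ℝ)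
          = s ^ 2 - (t - 1) * s * w + (t ^ 2 - t) * w ^ 2 := by
        rw [hs, hw]
        have h4 : t ^ 4 = t ^ 2 + 2 * t + 2 := by linear_combination (t + 1) * ht
        ring_nf
        rw [h4, ht]
        ring
      rw [e]
      nlinarith [sq_nonneg (2 * s - (t - 1) * w), sq_nonneg w]
    by_contra h
    push Not at h
    nlinarith
  obtain ⟨n, hn1, hn2⟩ := exists_mem_Ico_zpow hpos he
  have hzp : ∀ k : ℤ, φ ((etaUnit ^ k : CubicIntˣ) : CubicInt) = φ eta ^ k := fun k => by
    have := map_zpow (Units.map (φ : CubicInt →* ℝ)) etaUnit k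
    have h2 := congrArg Units.val this
    rw [Units.val_zpow_eq_zpow_val] at h2
    exact h2
  have hnorm : ∀ k : ℤ, norm ((etaUnit ^ k : CubicIntˣ) : CubicInt) = 1 := by
    let N : CubicInt →* ℤ := ⟨⟨norm, norm_one⟩, norm_mul⟩
    intro k
    have := map_zpow (Units.map N) etaUnit k
    have e1 : Units.map N etaUnit = 1 := by
      ext; simp [N, etaUnit, norm, normForm, eta]
    rw [e1, one_zpow] at this
    exact congrArg Units.val this
  have h1 : (u : CubicInt) * ((etaUnit ^ (-n) : CubicIntˣ) : CubicInt) = 1 := by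
    apply eq_one_of_mem_Ico ht h₁ h₂
    · rw [norm_mul, hu, hnorm, one_mul]
    · rw [map_mul, ← hφ, hzp, zpow_neg, ← div_eq_mul_inv, le_div_iff₀ (zpow_pos (by linarith) _)]
      linarith
    · rw [map_mul, ← hφ, hzp, zpow_neg, ← div_eq_mul_inv, div_lt_iff₀ (zpow_pos (by linarith) _),
        ← zpow_one_add₀ (by linarith), add_comm]
      exact hn2
  have h2 : u = etaUnit ^ n := by
    rw [← Units.val_mul] at h1
    have := Units.ext (show ((u * etaUnit ^ (-n) : CubicIntˣ) : CubicInt) = (1 : CubicIntˣ) from h1)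
    rwa [zpow_neg, mul_inv_eq_one] at this
  obtain ⟨k, hk | hk⟩ := Int.even_or_odd' n
  · refine ⟨((etaUnit ^ k : CubicIntˣ) : CubicInt), Or.inl ?_⟩
    rw [h2, hk, mul_comm, zpow_mul]; rfl
  · refine ⟨((etaUnit ^ k : CubicIntˣ) : CubicInt), Or.inr ?_⟩
    rw [h2, hk, add_comm, zpow_add, mul_comm 2, zpow_mul]; rfl

lemma isUnit_norm {u : CubicInt} (h : IsUnit u) : norm u = 1 ∨ norm u = -1 := by
  let N : CubicInt →* ℤ := ⟨⟨norm, norm_one⟩, norm_mul⟩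
  exact Int.isUnit_iff.1 (h.map N)

lemma eta_mul_sq_ne_sq {x y : CubicInt} (hx : x ≠ 0) : eta * x ^ 2 ≠ y ^ 2 := by
  intro h
  have : x ∣ y := (IsIntegrallyClosed.pow_dvd_pow_iff two_ne_zero).1 (Dvd.intro_left _ h)
  obtain ⟨z, rfl⟩ := this
  have h2 : eta = z ^ 2 := by
    apply mul_right_cancel₀ (pow_ne_zero 2 hx); rw [h]; ring
  have := congrArg CubicInt.b h2
  simp [eta, pow_two] at this
  have e : (1 : ℤ) = 2 * (z.a * z.b + z.c * z.c) := by linarith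
  omega

end CubicInt

namespace CubicInt

lemma adj_mul (x y : CubicInt) : adj (x * y) = adj x * adj y := by
  ext <;> simp [adj] <;> ring

lemma adj_pow (x : CubicInt) (n : ℕ) : adj (x ^ n) = adj x ^ n := by
  induction n with
  | zero => ext <;> simp [adj]
  | succ n ih => rw [pow_succ, adj_mul, ih, pow_succ]

lemma norm_pow (x : CubicInt) (n : ℕ) : norm (x ^ n) = norm x ^ n := by
  induction n with
  | zero => simp
  | succ n ih => rw [pow_succ, norm_mul, ih, pow_succ]

/-- The element `α`. -/
def alpha : CubicInt := ⟨0, 1, 0⟩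

/-- The element `α - 1`. -/
def piElt : CubicInt := ⟨-1, 1, 0⟩

lemma norm_alpha : norm alpha = 2 := by norm_num [norm, normForm, alpha]

lemma norm_piElt : norm piElt = 2 := by norm_num [norm, normForm, piElt]

lemma alpha_dvd {x : CubicInt} (h : Even x.a) : alpha ∣ x := by
  obtain ⟨k, hk⟩ := h
  refine ⟨⟨x.b, x.c - k, k⟩, ?_⟩
  ext
  · simp [alpha, hk]; ring
  · simp [alpha]
  · simp [alpha]

lemma piElt_dvd {x : CubicInt} (h : Even (x.a + x.b + x.c)) : piElt ∣ x := by
  obtain ⟨k, hk⟩ := h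
  refine ⟨⟨x.b + x.c, x.c, k⟩, ?_⟩
  ext <;> simp [piElt] <;> linarith

lemma even_of_even_norm {x : CubicInt} (h : Even (norm x)) : Even x.a ∨ Even (x.a + x.b + x.c) := by
  by_contra hc
  push Not at hc
  obtain ⟨h1, h2⟩ := hc
  rw [Int.not_even_iff_odd] at h1 h2
  have h3 : Even (x.b + x.c) := by
    have := h2.sub_odd h1
    rwa [add_assoc, add_sub_cancel_left] at this
  have : norm x = x.a ^ 2 * (x.a + (x.b + x.c)) + 2 * (-3 * x.a * x.b * x.c - 2 * x.a * x.c ^ 2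
      + x.b ^ 3 + x.b ^ 2 * x.c + 2 * x.c ^ 3) := by
    simp only [norm, normForm]; ring
  rw [this] at h
  have h5 : Odd (x.a ^ 2 * (x.a + (x.b + x.c))) := by
    exact h1.pow.mul (h1.add_even h3)
  have h6 := h5.add_even (even_two_mul (-3 * x.a * x.b * x.c - 2 * x.a * x.c ^ 2
      + x.b ^ 3 + x.b ^ 2 * x.c + 2 * x.c ^ 3))
  exact (Int.not_even_iff_odd.2 h6) h

lemma exists_odd_cofactor (g g' : CubicInt) (hg : norm g = 2)
    (hgg : ∀ x : CubicInt, Even (norm x) → g ∣ x ∨ g' ∣ x) (n : ℕ) :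
    ∀ x : CubicInt, (norm x).natAbs ≤ n → x ≠ 0 → ¬ g' ∣ x → ∃ (t : ℕ) (y : CubicInt),
      x = g ^ t * y ∧ Odd (norm y) := by
  induction n with
  | zero => intro x h hx; exact absurd (norm_eq_zero.1 (by omega)) hx
  | succ n ih =>
    intro x h hx hd
    rcases Int.even_or_odd (norm x) with he | ho
    · rcases hgg x he with ⟨z, rfl⟩ | h'
      · have hn := norm_mul g z
        rw [hg] at hn
        have hz : z ≠ 0 := right_ne_zero_of_mul hx
        have hz' : norm z ≠ 0 := fun h => hz (norm_eq_zero.1 h)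
        obtain ⟨t, y, rfl, hy⟩ := ih z (by omega) hz (fun h => hd (h.mul_left _))
        exact ⟨t + 1, y, by ring, hy⟩
      · exact absurd h' hd
    · exact ⟨0, x, by simp, ho⟩

lemma even_exponent {t : ℕ} {m B : ℤ} (hm : Odd m) (h : 2 ^ t * m = B ^ 2) :
    ∃ j n, t = 2 * j ∧ m = n ^ 2 := by
  induction t using Nat.strong_induction_on generalizing B with
  | _ t ih =>
    match t with
    | 0 => exact ⟨0, B, rfl, by simpa using h⟩
    | 1 =>
      exfalso
      have hB : Even B := by
        rw [← Int.even_pow' two_ne_zero, ← h]; exact ⟨m, by rw [pow_one, two_mul]⟩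
      obtain ⟨c, rfl⟩ := hB
      obtain ⟨d, rfl⟩ := hm
      have : 2 * d + 1 = 2 * c ^ 2 := by nlinarith
      omega
    | t + 2 =>
      have hB : Even B := by
        rw [← Int.even_pow' two_ne_zero, ← h]; exact ⟨2 ^ t * 2 * m, by rw [pow_add]; ring⟩
      obtain ⟨c, rfl⟩ := hB
      obtain ⟨j, n, hj, hn⟩ := ih t (by omega) (B := c) (by
        have : 4 * (2 ^ t * m) = 4 * c ^ 2 := by rw [pow_add] at h; linarith
        linarith)
      exact ⟨j + 1, n, by omega, hn⟩

/-- The element of `ℤ[α]` attached to a point with `x`-coordinate `A / E`. -/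
def descentElt (A E : ℤ) : CubicInt := ⟨A, A, E⟩

lemma norm_descentElt (A E : ℤ) :
    norm (descentElt A E) = 4 * A ^ 3 - 3 * A ^ 2 * E - 4 * A * E ^ 2 + 4 * E ^ 3 := by
  simp only [norm, normForm, descentElt]; ring

lemma no_common_prime {A E B : ℤ} (hAE : IsCoprime A E)
    (h : 4 * A ^ 3 - 3 * A ^ 2 * E - 4 * A * E ^ 2 + 4 * E ^ 3 = B ^ 2) {p : ℤ} (hp : Prime p)
    (h2 : ¬ p ∣ 2) (hB : p ∣ B ^ 2) (hA : p ∣ 12 * A ^ 2 - 6 * A * E - 4 * E ^ 2)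
    (hE : p ∣ -3 * A ^ 2 - 8 * A * E + 12 * E ^ 2) : False := by
  have h1 : p ∣ 348 * A ^ 3 := by
    have := dvd_add (hA.mul_left (47 * A + 78 * E)) (hE.mul_left (72 * A + 26 * E))
    exact Eq.mp (congrArg (p ∣ ·) (by ring)) this
  have h3 : p ∣ 928 * E ^ 3 := by
    have := dvd_add (hA.mul_left (57 * A + 218 * E)) (hE.mul_left (228 * A + 150 * E))
    exact Eq.mp (congrArg (p ∣ ·) (by ring)) this
  obtain ⟨u, v, huv⟩ := (hAE.pow (m := 3) (n := 3))
  have h4 : p ∣ 2 ^ 5 * 3 * 29 := by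
    have := dvd_add (h1.mul_left (8 * u)) (h3.mul_left (3 * v))
    have e : 8 * u * (348 * A ^ 3) + 3 * v * (928 * E ^ 3) = 2784 * (u * A ^ 3 + v * E ^ 3) := by
      ring
    rw [e, huv] at this
    simpa using this
  have h29 : p ∣ 3 * 29 := by
    rw [mul_assoc] at h4
    exact (hp.dvd_or_dvd h4).resolve_left fun h => h2 (hp.dvd_of_dvd_pow h)
  have hcop : ¬ (p ∣ A ∧ p ∣ E) := fun ⟨ha, he⟩ => hp.not_isUnit (hAE.isUnit_of_dvd' ha he)
  have hB' : p ∣ B := hp.dvd_of_dvd_pow hB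
  rcases hp.dvd_or_dvd h29 with h3 | h29
  · have hE2 : p ∣ 4 * E ^ 2 := by
      have := dvd_sub (h3.mul_left (4 * A ^ 2 - 2 * A * E)) hA
      exact Eq.mp (congrArg (p ∣ ·) (by ring)) this
    have hE' : p ∣ E := by
      rcases hp.dvd_or_dvd hE2 with h | h
      · exact absurd (hp.dvd_of_dvd_pow (n := 2) (by norm_num; exact h)) h2
      · exact hp.dvd_of_dvd_pow h
    have hA3 : p ∣ 4 * A ^ 3 := by
      have := dvd_add hB (hE'.mul_left (3 * A ^ 2 + 4 * A * E - 4 * E ^ 2))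
      rw [← h] at this
      exact Eq.mp (congrArg (p ∣ ·) (by ring)) this
    rcases hp.dvd_or_dvd hA3 with h | h
    · exact h2 (hp.dvd_of_dvd_pow (n := 2) (by norm_num; exact h))
    · exact hcop ⟨hp.dvd_of_dvd_pow h, hE'⟩
  · have hassoc : (29 : ℤ) ∣ p :=
      ((hp.irreducible.associated_of_dvd (Nat.prime_iff_prime_int.1
        (show Nat.Prime 29 by norm_num)).irreducible h29).symm.dvd)
    have key : ∀ a e : ZMod 29, 12 * a ^ 2 - 6 * a * e - 4 * e ^ 2 = 0 →
        -3 * a ^ 2 - 8 * a * e + 12 * e ^ 2 = 0 → a - 21 * e = 0 := by decide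
    have hA' := (ZMod.intCast_zmod_eq_zero_iff_dvd _ 29).2 (hassoc.trans hA)
    have hE' := (ZMod.intCast_zmod_eq_zero_iff_dvd _ 29).2 (hassoc.trans hE)
    push_cast at hA' hE'
    have hk := key _ _ hA' hE'
    obtain ⟨k, hk⟩ := (ZMod.intCast_zmod_eq_zero_iff_dvd (A - 21 * E) 29).1 (by push_cast; exact hk)
    obtain ⟨b, rfl⟩ := hassoc.trans hB'
    have hAk : A = 21 * E + 29 * k := by push_cast at hk; linarith
    have hE3 : (29 : ℤ) ∣ 11 * E ^ 3 := by
      subst hAk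
      refine ⟨b ^ 2 - 42 * E ^ 3 - 178 * E ^ 2 * k - 249 * E * k ^ 2 - 116 * k ^ 3, ?_⟩
      nlinarith
    have hp29 : Prime (29 : ℤ) := Nat.prime_iff_prime_int.1 (by norm_num)
    have hE4 : (29 : ℤ) ∣ E := by
      rcases hp29.dvd_or_dvd hE3 with h | h
      · norm_num at h
      · exact hp29.dvd_of_dvd_pow h
    have hp29' : p ∣ E := h29.trans hE4
    exact hcop ⟨hAk ▸ dvd_add (hp29'.mul_left 21) (h29.mul_right k), hp29'⟩

lemma exists_bezout_three {l m n : ℤ}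
    (H : ∀ p : ℤ, Prime p → p ∣ l → p ∣ m → p ∣ n → False) :
    ∃ u v w : ℤ, u * l + v * m + w * n = 1 := by
  have h1 : IsCoprime ((Int.gcd l m : ℕ) : ℤ) n := by
    rw [Int.isCoprime_iff_gcd_eq_one]
    by_contra hg
    obtain ⟨p, hp, hd⟩ := Nat.exists_prime_and_dvd hg
    have hd : (p : ℤ) ∣ (Int.gcd ((Int.gcd l m : ℕ) : ℤ) n : ℕ) := by exact_mod_cast hd
    have ha := hd.trans (Int.gcd_dvd_left _ _)
    exact H p (Nat.prime_iff_prime_int.1 hp) (ha.trans (Int.gcd_dvd_left _ _))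
      (ha.trans (Int.gcd_dvd_right _ _)) (hd.trans (Int.gcd_dvd_right _ _))
  obtain ⟨u, v, huv⟩ := h1
  rw [Int.gcd_eq_gcd_ab] at huv
  exact ⟨u * l.gcdA m, u * l.gcdB m, v, by linarith⟩

lemma ofInt_add (m n : ℤ) : ofInt (m + n) = ofInt m + ofInt n := by ext <;> simp [ofInt]

lemma descentElt_eq {A E B : ℤ} (hAE : IsCoprime A E) (hE : E ≠ 0)
    (hpar : Even A → Odd E)
    (h : 4 * A ^ 3 - 3 * A ^ 2 * E - 4 * A * E ^ 2 + 4 * E ^ 3 = B ^ 2) :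
    ∃ β : CubicInt, descentElt A E = β ^ 2 ∨ descentElt A E = eta * β ^ 2 := by
  have hξ : descentElt A E ≠ 0 := fun h => hE (congrArg CubicInt.c h)
  have hnorm : norm (descentElt A E) = B ^ 2 := by rw [norm_descentElt, h]
  obtain ⟨g, t, y, hg, hy, hodd⟩ : ∃ (g : CubicInt) (t : ℕ) (y : CubicInt), norm g = 2 ∧
      descentElt A E = g ^ t * y ∧ Odd (norm y) := by
    rcases Int.even_or_odd A with hA | hA
    · obtain ⟨t, y, hy⟩ := exists_odd_cofactor alpha piElt norm_alpha
        (fun x hx => (even_of_even_norm hx).imp alpha_dvd piElt_dvd) _ _ le_rfl hξ (by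
          rintro ⟨z, hz⟩
          have e1 := congrArg CubicInt.a hz
          have e2 := congrArg CubicInt.b hz
          have e3 := congrArg CubicInt.c hz
          simp [descentElt, piElt] at e1 e2 e3
          have h1 := hpar hA
          obtain ⟨r, hr⟩ := h1
          omega)
      exact ⟨alpha, t, y, norm_alpha, hy⟩
    · obtain ⟨t, y, hy⟩ := exists_odd_cofactor piElt alpha norm_piElt
        (fun x hx => (even_of_even_norm hx).symm.imp piElt_dvd alpha_dvd) _ _ le_rfl hξ (by
          rintro ⟨z, hz⟩
          have e1 := congrArg CubicInt.a hz
          simp [descentElt, alpha] at e1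
          obtain ⟨r, hr⟩ := hA
          omega)
      exact ⟨piElt, t, y, norm_piElt, hy⟩
  have hB : B ^ 2 = 2 ^ t * norm y := by rw [← hnorm, hy, norm_mul, norm_pow, hg]
  obtain ⟨j, n, rfl, hn⟩ := even_exponent hodd hB.symm
  have hadj : adj (descentElt A E) = adj g ^ (2 * j) * adj y := by rw [hy, adj_mul, adj_pow]
  have hfA : ofInt (12 * A ^ 2 - 6 * A * E - 4 * E ^ 2)
      = ⟨1, 1, 0⟩ * adj (descentElt A E)
        + descentElt A E * ⟨4 * A - E, -4 * A - E, 2 * A⟩ := by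
    ext <;> simp [ofInt, descentElt, adj] <;> ring
  have hfE : ofInt (-3 * A ^ 2 - 8 * A * E + 12 * E ^ 2)
      = ⟨0, 0, 1⟩ * adj (descentElt A E)
        + descentElt A E * ⟨-A - 4 * E, -A + 4 * E, 0⟩ := by
    ext <;> simp [ofInt, descentElt, adj] <;> ring
  obtain ⟨u, v, w, huvw⟩ := exists_bezout_three (l := norm y)
    (m := 12 * A ^ 2 - 6 * A * E - 4 * E ^ 2) (n := -3 * A ^ 2 - 8 * A * E + 12 * E ^ 2)
    (fun p hp h1 h2 h3 => no_common_prime hAE h hp (fun h' => by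
      have h4 : (2 : ℤ) ∣ p :=
        (hp.irreducible.associated_of_dvd Int.prime_two.irreducible h').symm.dvd
      exact (Int.not_even_iff_odd.2 hodd) (even_iff_two_dvd.2 (h4.trans h1)))
      (hB ▸ h1.mul_left _) h2 h3)
  have hcop : IsCoprime y (adj y) := by
    have e := congrArg ofInt huvw
    rw [ofInt_add, ofInt_add, ofInt_mul, ofInt_mul, ofInt_mul, hfA, hfE, ← mul_adj, hadj, hy] at e
    refine ⟨ofInt u * adj y + ofInt v * (g ^ (2 * j) * ⟨4 * A - E, -4 * A - E, 2 * A⟩)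
      + ofInt w * (g ^ (2 * j) * ⟨-A - 4 * E, -A + 4 * E, 0⟩),
      ofInt v * (⟨1, 1, 0⟩ * adj g ^ (2 * j)) + ofInt w * (⟨0, 0, 1⟩ * adj g ^ (2 * j)), ?_⟩
    refine Eq.trans ?_ (e.trans rfl)
    ring
  obtain ⟨d, x, hx⟩ := exists_associated_pow_of_mul_eq_pow' hcop (k := 2) (c := ofInt n) (by
    rw [mul_adj, hn, pow_two, pow_two, ofInt_mul])
  have hxn : norm x = 1 := by
    refine (isUnit_norm x.isUnit).resolve_right fun h' => ?_
    have := congrArg norm hx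
    rw [norm_mul, norm_pow, h', hn] at this
    have hn0 : n ≠ 0 := by
      rintro rfl
      rw [hn] at hodd; simp at hodd
    nlinarith [sq_nonneg (norm d), sq_pos_of_ne_zero hn0]
  obtain ⟨v, hv | hv⟩ := unit_eq_sq_or x hxn
  · exact ⟨g ^ j * d * v, Or.inl (by rw [hy, ← hx, hv]; ring)⟩
  · exact ⟨g ^ j * d * v, Or.inr (by rw [hy, ← hx, hv]; ring)⟩

end CubicInt

/-- The elliptic curve `Y² + XY = X³ - X² - X + 1`. -/
def curve : WeierstrassCurve.Affine ℚ := ⟨1, -1, 0, -1, 1⟩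

namespace curve
open WeierstrassCurve.Affine

@[simp] lemma a₁_eq : curve.a₁ = 1 := rfl
@[simp] lemma a₂_eq : curve.a₂ = -1 := rfl
@[simp] lemma a₃_eq : curve.a₃ = 0 := rfl
@[simp] lemma a₄_eq : curve.a₄ = -1 := rfl
@[simp] lemma a₆_eq : curve.a₆ = 1 := rfl

/-- The affine equation of the curve. -/
def On (x y : ℚ) : Prop := y ^ 2 + x * y = x ^ 3 - x ^ 2 - x + 1

lemma equation_iff_on {x y : ℚ} : curve.Equation x y ↔ On x y := by
  rw [equation_iff, On]; simp; constructor <;> intro h <;> linarith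

lemma Δ_ne_zero : curve.Δ ≠ 0 := by
  norm_num [WeierstrassCurve.Δ, WeierstrassCurve.b₂, WeierstrassCurve.b₄, WeierstrassCurve.b₆,
    WeierstrassCurve.b₈]

lemma nonsingular_of_on {x y : ℚ} (h : On x y) : curve.Nonsingular x y :=
  (equation_iff_nonsingular_of_Δ_ne_zero Δ_ne_zero).1 (equation_iff_on.2 h)

/-- The affine point with given coordinates. -/
def pt (x y : ℚ) (h : On x y) : curve.Point := .some x y (nonsingular_of_on h)

lemma eq_zero_or_pt (Q : curve.Point) : Q = 0 ∨ ∃ x y h, Q = pt x y h := by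
  cases Q with
  | zero => exact Or.inl rfl
  | some x y h => exact Or.inr ⟨x, y, equation_iff_on.1 h.1, rfl⟩

lemma pt_ne_zero {x y : ℚ} (h : On x y) : pt x y h ≠ 0 := by
  intro h'; cases h'

lemma pt_congr {x y x' y' : ℚ} (h : On x y) (hx : x = x') (hy : y = y') :
    pt x y h = pt x' y' (hx ▸ hy ▸ h) := by subst hx hy; rfl

lemma pt_inj {x y x' y' : ℚ} {h : On x y} {h' : On x' y'} (e : pt x y h = pt x' y' h') :
    x = x' ∧ y = y' := by
  simpa [pt] using e

lemma on_neg {x y : ℚ} (h : On x y) : On x (-y - x) := by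
  unfold On at *; linarith

lemma neg_pt {x y : ℚ} (h : On x y) : -pt x y h = pt x (-y - x) (on_neg h) := by
  simp [pt, negY]

lemma pt_eq_or_neg {x y y' : ℚ} (h : On x y) (h' : On x y') :
    pt x y h = pt x y' h' ∨ pt x y h = -pt x y' h' := by
  rw [neg_pt]
  have : (y - y') * (y + y' + x) = 0 := by unfold On at *; linarith
  rcases mul_eq_zero.1 this with e | e
  · exact Or.inl (pt_congr h rfl (by linarith))
  · exact Or.inr (pt_congr h rfl (by linarith))

lemma on_gen : On 0 1 := by norm_num [On]

/-- The generator `(0, 1)`. -/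
def gen : curve.Point := pt 0 1 on_gen

lemma pt_zero {y : ℚ} (h : On 0 y) : pt 0 y h = gen ∨ pt 0 y h = -gen := pt_eq_or_neg h on_gen

/-- The `y`-coordinate of the sum with the generator. -/
def addGenY (x y : ℚ) : ℚ :=
  -((y - 1) / x * (2 * (1 - x - y) / x ^ 2 - x) + y) - 2 * (1 - x - y) / x ^ 2

lemma pt_add_gen {x y : ℚ} (h : On x y) (hx : x ≠ 0) :
    ∃ h', pt x y h + gen = pt (2 * (1 - x - y) / x ^ 2) (addGenY x y) h' := by
  have hs : curve.slope x 0 y 1 = (y - 1) / x := by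
    rw [slope_of_X_ne hx]; simp
  have hX : curve.addX x 0 ((y - 1) / x) = 2 * (1 - x - y) / x ^ 2 := by
    unfold On at h
    simp only [addX, a₁_eq, a₂_eq]
    field_simp
    linear_combination h
  have hns := nonsingular_add (nonsingular_of_on h) (nonsingular_of_on on_gen) (fun h => hx h.1)
  have e : pt x y h + gen = _ := Point.add_some (fun h => hx h.1) (h₁ := nonsingular_of_on h)
    (h₂ := nonsingular_of_on on_gen)
  have hy : curve.addY x 0 y (curve.slope x 0 y 1) = addGenY x y := by
    rw [hs]
    simp only [addY, negAddY, negY, a₁_eq, a₃_eq, hX, addGenY]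
    ring
  have hx' : curve.addX x 0 (curve.slope x 0 y 1) = 2 * (1 - x - y) / x ^ 2 := by rw [hs, hX]
  refine ⟨?_, ?_⟩
  · rw [← hx', ← hy]; exact equation_iff_on.1 hns.1
  · rw [e]; exact pt_congr (equation_iff_on.1 hns.1) hx' hy

lemma pt_sub_gen {x y : ℚ} (h : On x y) (hx : x ≠ 0) :
    ∃ y' h', pt x y h - gen = pt (2 * (1 + y) / x ^ 2) y' h' := by
  have e : pt x y h - gen = -(pt x (-y - x) (on_neg h) + gen) := by
    rw [← neg_pt h]; abel
  obtain ⟨h', e'⟩ := pt_add_gen (on_neg h) hx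
  rw [e, e', neg_pt]
  exact ⟨_, _, pt_congr _ (by ring) rfl⟩

lemma two_mul_add_ne_zero {x y : ℚ} (h : On x y) (hf : 4 * x ^ 3 - 3 * x ^ 2 - 4 * x + 4 ≠ 0) :
    2 * y + x ≠ 0 := by
  intro h0
  apply hf
  unfold On at h
  linear_combination (2 * y + x) * h0 - 4 * h

lemma pt_add_self {x y : ℚ} (h : On x y) (hf : 4 * x ^ 3 - 3 * x ^ 2 - 4 * x + 4 ≠ 0) :
    ∃ y' h', pt x y h + pt x y h =
      pt ((x ^ 4 + 2 * x ^ 2 - 8 * x + 4) / (4 * x ^ 3 - 3 * x ^ 2 - 4 * x + 4)) y' h' := by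
  have h0 := two_mul_add_ne_zero h hf
  have hne : y ≠ curve.negY x y := by
    simp only [negY, a₁_eq, a₃_eq]; intro e; apply h0; linarith
  have hs : curve.slope x x y y = (3 * x ^ 2 - 2 * x - 1 - y) / (2 * y + x) := by
    rw [slope_of_Y_ne rfl hne]
    simp only [negY, a₁_eq, a₂_eq, a₃_eq, a₄_eq]
    congr 1 <;> ring
  have hX : curve.addX x x ((3 * x ^ 2 - 2 * x - 1 - y) / (2 * y + x)) =
      (x ^ 4 + 2 * x ^ 2 - 8 * x + 4) / (4 * x ^ 3 - 3 * x ^ 2 - 4 * x + 4) := by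
    have hsq : 4 * x ^ 3 - 3 * x ^ 2 - 4 * x + 4 = (2 * y + x) ^ 2 := by
      unfold On at h; linear_combination -4 * h
    rw [hsq]
    unfold On at h
    simp only [addX, a₁_eq, a₂_eq]
    field_simp
    linear_combination (-(8 * x) + 3) * h
  have hns := nonsingular_add (nonsingular_of_on h) (nonsingular_of_on h) (fun h => hne h.2)
  have e : pt x y h + pt x y h = _ := Point.add_some (fun h => hne h.2) (h₁ := nonsingular_of_on h)
    (h₂ := nonsingular_of_on h)
  rw [e]
  exact ⟨_, _, pt_congr (equation_iff_on.1 hns.1) (by rw [hs, hX]) rfl⟩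

end curve

namespace curve
open CubicInt

lemma exists_int_of_sq_eq {w : ℚ} {n : ℤ} (h : w ^ 2 = n) : ∃ m : ℤ, w = m := by
  have h1 : IsSquare ((n : ℤ) : ℚ) := ⟨w, by rw [← h]; ring⟩
  obtain ⟨m, hm⟩ := Rat.isSquare_intCast_iff.1 h1
  have h2 : (w - m) * (w + m) = 0 := by
    rw [hm] at h; push_cast at h; linear_combination h
  rcases mul_eq_zero.1 h2 with h | h
  · exact ⟨m, by linarith⟩
  · exact ⟨-m, by push_cast; linarith⟩

lemma exists_coords {x y : ℚ} (h : On x y) : ∃ A D C : ℤ, 0 < D ∧ IsCoprime A D ∧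
    x = A / D ^ 2 ∧ y = C / D ^ 3 ∧
    4 * A ^ 3 - 3 * A ^ 2 * D ^ 2 - 4 * A * (D ^ 2) ^ 2 + 4 * (D ^ 2) ^ 3 =
      (2 * C + A * D) ^ 2 := by
  obtain ⟨a, d, hd, hc, hx⟩ : ∃ a d : ℤ, 0 < d ∧ IsCoprime a d ∧ x = a / d :=
    ⟨x.num, x.den, by exact_mod_cast x.pos, by
      rw [Int.isCoprime_iff_gcd_eq_one]; exact x.reduced, (Rat.num_div_den x).symm⟩
  have hd' : (d : ℚ) ≠ 0 := by exact_mod_cast hd.ne'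
  set k : ℤ := a ^ 3 - a ^ 2 * d - a * d ^ 2 + d ^ 3 with hk
  have hz : (d ^ 2 * y) ^ 2 + a * d * (d ^ 2 * y) = d * k := by
    unfold On at h
    rw [hx] at h
    rw [hk]
    push_cast
    field_simp at h
    linear_combination (d : ℚ) ^ 1 * h
  obtain ⟨m, hm⟩ := exists_int_of_sq_eq (w := 2 * (d ^ 2 * y) + a * d)
    (n := (a * d) ^ 2 + 4 * (d * k)) (by push_cast; linear_combination 4 * hz)
  have hm2 : m ^ 2 = (a * d) ^ 2 + 4 * (d * k) := by
    have : (m : ℚ) ^ 2 = (a * d) ^ 2 + 4 * (d * k) := by rw [← hm]; linear_combination 4 * hz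
    exact_mod_cast this
  obtain ⟨z, hzm⟩ : ∃ z, m = 2 * z + a * d := by
    have : Even (m - a * d) := by
      have e : Even (m ^ 2 - (a * d) ^ 2) := ⟨2 * (d * k), by rw [hm2]; ring⟩
      rw [Int.even_sub, Int.even_pow' two_ne_zero, Int.even_pow' two_ne_zero] at e
      rwa [Int.even_sub]
    obtain ⟨z, hz⟩ := this
    exact ⟨z, by linarith⟩
  have hzy : (z : ℚ) = d ^ 2 * y := by
    rw [hzm] at hm; push_cast at hm; linarith
  have hzz : d * (k - a * z) = z ^ 2 := by
    rw [← hzy] at hz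
    have hz : z ^ 2 + a * d * z = d * k := by exact_mod_cast hz
    linarith
  have hcop : IsCoprime d (k - a * z) := by
    refine isCoprime_of_prime_dvd (by rintro ⟨h, _⟩; exact hd.ne' h) fun p hp h1 h2 => ?_
    have h3 : p ∣ z := hp.dvd_of_dvd_pow (n := 2) (hzz ▸ h1.mul_right _)
    have h4 : p ∣ a ^ 3 := by
      have := dvd_add (dvd_add h2 (h3.mul_left a)) (h1.mul_left (a ^ 2 + a * d - d ^ 2))
      exact Eq.mp (congrArg (p ∣ ·) (by rw [hk]; ring)) this
    exact hp.not_isUnit (hc.isUnit_of_dvd' (hp.dvd_of_dvd_pow h4) h1)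
  obtain ⟨D, hD⟩ : ∃ D : ℤ, d = D ^ 2 := by
    obtain ⟨D, h | h⟩ := Int.sq_of_isCoprime hcop hzz
    · exact ⟨D, h⟩
    · nlinarith [sq_nonneg D]
  obtain ⟨D, hDpos, hD⟩ : ∃ D : ℤ, 0 < D ∧ d = D ^ 2 :=
    ⟨|D|, abs_pos.2 (by rintro rfl; simp [hD] at hd), by rw [sq_abs, hD]⟩
  have hDz : D ∣ z := by
    rw [← Int.pow_dvd_pow_iff two_ne_zero, ← hzz, hD]; exact dvd_mul_right _ _
  obtain ⟨C, rfl⟩ := hDz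
  have hD0 : (D : ℚ) ≠ 0 := by exact_mod_cast hDpos.ne'
  have hCy : y = C / D ^ 3 := by
    rw [hD] at hzy; push_cast at hzy
    field_simp
    apply mul_left_cancel₀ hD0
    linear_combination -hzy
  have hxA : x = a / D ^ 2 := by rw [hx, hD]; push_cast; rfl
  refine ⟨a, D, C, hDpos, ?_, hxA, hCy, ?_⟩
  · rw [hD] at hc; exact (IsCoprime.pow_right_iff two_pos).1 hc
  · have : (4 * a ^ 3 - 3 * a ^ 2 * D ^ 2 - 4 * a * (D ^ 2) ^ 2 + 4 * (D ^ 2) ^ 3 : ℚ)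
        = (2 * C + a * D) ^ 2 := by
      unfold On at h
      rw [hxA, hCy] at h
      field_simp at h
      linear_combination -4 * h
    exact_mod_cast this

lemma descent_dichotomy {A D B : ℤ} (hD : 0 < D) (hAD : IsCoprime A D)
    (h : 4 * A ^ 3 - 3 * A ^ 2 * D ^ 2 - 4 * A * (D ^ 2) ^ 2 + 4 * (D ^ 2) ^ 3 = B ^ 2) :
    ∃ β : CubicInt, descentElt A (D ^ 2) = β ^ 2 ∨ descentElt A (D ^ 2) = eta * β ^ 2 := by
  refine descentElt_eq hAD.pow_right (by positivity) (fun hA => ?_) h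
  have : ¬ Even D := fun hD' => by
    have := hAD.isUnit_of_dvd' (even_iff_two_dvd.1 hA) (even_iff_two_dvd.1 hD')
    exact Int.prime_two.not_isUnit this
  exact (Int.not_even_iff_odd.1 this).pow

lemma quartic_ne_zero_of_pos {A D : ℤ} (hD : 0 < D) :
    4 * A ^ 3 - 3 * A ^ 2 * D ^ 2 - 4 * A * (D ^ 2) ^ 2 + 4 * (D ^ 2) ^ 3 ≠ 0 := by
  intro h
  rw [← norm_descentElt, norm_eq_zero] at h
  have := congrArg CubicInt.c h
  simp [descentElt] at this
  omega

lemma cubic_ne_zero {x y : ℚ} (h : On x y) : 4 * x ^ 3 - 3 * x ^ 2 - 4 * x + 4 ≠ 0 := by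
  obtain ⟨A, D, C, hD, hAD, rfl, -, -⟩ := exists_coords h
  intro h0
  apply quartic_ne_zero_of_pos (A := A) hD
  have hD0 : (D : ℚ) ≠ 0 := by exact_mod_cast hD.ne'
  field_simp at h0
  have : (4 * A ^ 3 - 3 * A ^ 2 * D ^ 2 - 4 * A * (D ^ 2) ^ 2 + 4 * (D ^ 2) ^ 3 : ℚ) = 0 := by
    linear_combination h0
  exact_mod_cast this

lemma exists_half {x y : ℚ} (h : On x y) {A D : ℤ} (hD : 0 < D) (hx : x = A / D ^ 2)
    {β : CubicInt} (hβ : descentElt A (D ^ 2) = eta * β ^ 2) :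
    ∃ R : curve.Point, pt x y h = R + R := by
  obtain ⟨a, b, c⟩ := β
  have e1 := congrArg CubicInt.a hβ
  have e2 := congrArg CubicInt.b hβ
  have e3 := congrArg CubicInt.c hβ
  simp [descentElt, eta, pow_two] at e1 e2 e3
  have h1 : b * (a + b) + 2 * c * (a + b) + 2 * c ^ 2 = 0 := by linarith
  have hA : A = a ^ 2 + 4 * b * c + 2 * c ^ 2 := by linarith
  have hE : D ^ 2 = a ^ 2 + 2 * b * c + c ^ 2 - 2 * a * c - b ^ 2 := by linarith
  have hs : a + b ≠ 0 := by
    intro hs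
    rw [hs] at h1
    have hc : c = 0 := by nlinarith
    have ha : a = -b := by linarith
    subst hc ha
    nlinarith
  have hs' : (a + b : ℚ) ≠ 0 := by exact_mod_cast hs
  have hD0 : (D : ℚ) ≠ 0 := by exact_mod_cast hD.ne'
  have h1' : (b * (a + b) + 2 * c * (a + b) + 2 * c ^ 2 : ℚ) = 0 := by exact_mod_cast h1
  have hA' : (A : ℚ) = a ^ 2 + 4 * b * c + 2 * c ^ 2 := by exact_mod_cast hA
  have hE' : (D ^ 2 : ℚ) = a ^ 2 + 2 * b * c + c ^ 2 - 2 * a * c - b ^ 2 := by exact_mod_cast hE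
  set s : ℚ := a + b with hsdef
  set X : ℚ := -2 * c / s with hX
  have hc : (c : ℚ) = -X / 2 * s := by rw [hX]; field_simp
  have hb : (b : ℚ) = (X - X ^ 2 / 2) * s := by
    apply mul_right_cancel₀ hs'
    rw [hc] at h1'
    linear_combination h1'
  have ha : (a : ℚ) = (1 - X + X ^ 2 / 2) * s := by
    have : (a : ℚ) = s - b := by rw [hsdef]; ring
    rw [this, hb]; ring
  clear_value s X
  have hf : 4 * (D ^ 2 : ℚ) = s ^ 2 * (4 * X ^ 3 - 3 * X ^ 2 - 4 * X + 4) := by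
    rw [hE', ha, hb, hc]; ring
  have hF : 4 * (A : ℚ) = s ^ 2 * (X ^ 4 + 2 * X ^ 2 - 8 * X + 4) := by
    rw [hA', ha, hb, hc]; ring
  have hon : On X ((D + c) / s) := by
    unfold On
    rw [hc]
    field_simp
    linear_combination hf
  have hfne := cubic_ne_zero hon
  obtain ⟨y', h', e⟩ := pt_add_self hon hfne
  have hxx : x = (X ^ 4 + 2 * X ^ 2 - 8 * X + 4) / (4 * X ^ 3 - 3 * X ^ 2 - 4 * X + 4) := by
    rw [hx, div_eq_div_iff (pow_ne_zero 2 hD0) hfne]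
    have h2 : s ^ 2 ≠ 0 := pow_ne_zero 2 hs'
    apply mul_left_cancel₀ h2
    linear_combination (D : ℚ) ^ 2 * hF - (A : ℚ) * hf
  rcases pt_eq_or_neg (hxx ▸ h) h' with e' | e'
  · refine ⟨_, (pt_congr h hxx rfl).trans (e'.trans e.symm)⟩
  · refine ⟨-pt X _ hon, ((pt_congr h hxx rfl).trans e').trans ?_⟩
    rw [← e]; abel

lemma not_both_squares {A D C A' D' : ℤ} (hA : A ≠ 0) (hD : 0 < D) (hD' : 0 < D')
    (h : 4 * A ^ 3 - 3 * A ^ 2 * D ^ 2 - 4 * A * (D ^ 2) ^ 2 + 4 * (D ^ 2) ^ 3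
      = (2 * C + A * D) ^ 2)
    (hx : A' * A ^ 2 = 2 * (D ^ 3 - A * D - C) * D * D' ^ 2) {β β' : CubicInt}
    (hβ : descentElt A (D ^ 2) = β ^ 2) (hβ' : descentElt A' (D' ^ 2) = β' ^ 2) : False := by
  set W : CubicInt := ⟨2 * A * D, 2 * A * D, 2 * D ^ 3 - (2 * C + A * D)⟩ with hW
  have key : eta * (ofInt D' * piElt * W) ^ 2 = (ofInt 2 * alpha * β * β' * ofInt A) ^ 2 := by
    have e1 : ofInt A ^ 2 * descentElt A' (D' ^ 2)
        = ofInt D' ^ 2 * ⟨2 * (D ^ 3 - A * D - C) * D, 2 * (D ^ 3 - A * D - C) * D, A ^ 2⟩ := by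
      ext <;> simp [ofInt, descentElt, pow_two] <;> linarith
    have e2 : eta * piElt ^ 2 * W ^ 2 = ofInt 2 ^ 2 * alpha ^ 2 * descentElt A (D ^ 2) *
        ⟨2 * (D ^ 3 - A * D - C) * D, 2 * (D ^ 3 - A * D - C) * D, A ^ 2⟩ := by
      ext
      · simp [ofInt, descentElt, pow_two, eta, piElt, alpha, hW]
        linear_combination (-4) * h
      · simp [ofInt, descentElt, pow_two, eta, piElt, alpha, hW]
        linear_combination (-4) * h
      · simp [ofInt, descentElt, pow_two, eta, piElt, alpha, hW]
        linear_combination (-4) * h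
    calc eta * (ofInt D' * piElt * W) ^ 2 = ofInt D' ^ 2 * (eta * piElt ^ 2 * W ^ 2) := by ring
      _ = ofInt 2 ^ 2 * alpha ^ 2 * descentElt A (D ^ 2) *
          (ofInt A ^ 2 * descentElt A' (D' ^ 2)) := by rw [e2, e1]; ring
      _ = _ := by rw [hβ, hβ']; ring
  have hne : ∀ {x : CubicInt}, x.c ≠ 0 → x ≠ 0 := fun h h' => h (by rw [h']; rfl)
  have hβ0 : β ≠ 0 := by
    rintro rfl
    have := congrArg CubicInt.c hβ
    simp [descentElt] at this; omega
  have hβ0' : β' ≠ 0 := by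
    rintro rfl
    have := congrArg CubicInt.c hβ'
    simp [descentElt] at this; omega
  have hr : ofInt 2 * alpha * β * β' * ofInt A ≠ 0 := by
    refine mul_ne_zero (mul_ne_zero (mul_ne_zero (mul_ne_zero ?_ ?_) hβ0) hβ0') ?_
    · intro h; have := congrArg CubicInt.a h; simp [ofInt] at this
    · intro h; have := congrArg CubicInt.b h; simp [alpha] at this
    · intro h; have := congrArg CubicInt.a h; simp [ofInt] at this; exact hA this
  refine eta_mul_sq_ne_sq ?_ key
  intro h0
  rw [h0] at key
  apply pow_ne_zero 2 hr
  rw [← key]; ring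

theorem two_descent (Q : curve.Point) : ∃ R : curve.Point, Q = R + R ∨ Q + gen = R + R := by
  rcases eq_zero_or_pt Q with rfl | ⟨x, y, h, rfl⟩
  · exact ⟨0, Or.inl (by simp)⟩
  by_cases hx0 : x = 0
  · subst hx0
    rcases pt_zero h with e | e
    · exact ⟨gen, Or.inr (by rw [e])⟩
    · exact ⟨0, Or.inr (by rw [e]; simp)⟩
  obtain ⟨A, D, C, hD, hAD, hx, hy, hB⟩ := exists_coords h
  obtain ⟨β, hβ | hβ⟩ := descent_dichotomy hD hAD hB
  swap
  · obtain ⟨R, hR⟩ := exists_half h hD hx hβ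
    exact ⟨R, Or.inl hR⟩
  obtain ⟨h', e⟩ := pt_add_gen h hx0
  obtain ⟨A', D', C', hD', hAD', hx', hy', hB'⟩ := exists_coords h'
  obtain ⟨β', hβ' | hβ'⟩ := descent_dichotomy hD' hAD' hB'
  swap
  · obtain ⟨R, hR⟩ := exists_half h' hD' hx' hβ'
    exact ⟨R, Or.inr (e.trans hR)⟩
  exfalso
  have hA : A ≠ 0 := by rintro rfl; exact hx0 (by rw [hx]; simp)
  refine not_both_squares hA hD hD' hB ?_ hβ hβ'
  have hD0 : (D : ℚ) ≠ 0 := by exact_mod_cast hD.ne'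
  have hD0' : (D' : ℚ) ≠ 0 := by exact_mod_cast hD'.ne'
  have hA0 : (A : ℚ) ≠ 0 := by exact_mod_cast hA
  rw [hx, hy] at hx'
  field_simp at hx'
  have : (A' * A ^ 2 : ℚ) = 2 * (D ^ 3 - A * D - C) * D * D' ^ 2 := by linear_combination -hx'
  exact_mod_cast this

end curve

namespace curve

/-- Numerator of the duplication map. -/
def dupNum (a e : ℤ) : ℤ := a ^ 4 + 2 * a ^ 2 * e ^ 2 - 8 * a * e ^ 3 + 4 * e ^ 4

/-- Denominator of the duplication map. -/
def dupDen (a e : ℤ) : ℤ := e * (4 * a ^ 3 - 3 * a ^ 2 * e - 4 * a * e ^ 2 + 4 * e ^ 3)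

lemma abs_combo_le {c₀ c₁ c₂ c₃ a e H : ℤ} (ha : |a| ≤ H) (he : |e| ≤ H) :
    |c₀ * a ^ 3 + c₁ * a ^ 2 * e + c₂ * a * e ^ 2 + c₃ * e ^ 3| ≤
      (|c₀| + |c₁| + |c₂| + |c₃|) * H ^ 3 := by
  have h0 : |c₀ * a ^ 3| ≤ |c₀| * H ^ 3 := by
    rw [abs_mul, abs_pow]; gcongr
  have h1 : |c₁ * a ^ 2 * e| ≤ |c₁| * H ^ 3 := by
    rw [abs_mul, abs_mul, abs_pow, pow_succ H 2, ← mul_assoc]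
    have := (abs_nonneg a).trans ha
    gcongr
  have h2 : |c₂ * a * e ^ 2| ≤ |c₂| * H ^ 3 := by
    rw [abs_mul, abs_mul, abs_pow, pow_succ' H 2, ← mul_assoc]
    have := (abs_nonneg a).trans ha
    gcongr
  have h3 : |c₃ * e ^ 3| ≤ |c₃| * H ^ 3 := by
    rw [abs_mul, abs_pow]; gcongr
  calc _ ≤ |c₀ * a ^ 3| + |c₁ * a ^ 2 * e| + |c₂ * a * e ^ 2| + |c₃ * e ^ 3| := by
        refine (abs_add_le _ _).trans (add_le_add_left ?_ _)
        exact abs_add_three _ _ _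
    _ ≤ _ := by linarith

lemma gcd_dup_dvd {a e : ℤ} (hco : IsCoprime a e) :
    (Int.gcd (dupNum a e) (dupDen a e) : ℤ) ∣ 116 := by
  set g : ℤ := (Int.gcd (dupNum a e) (dupDen a e) : ℤ)
  have hF : g ∣ dupNum a e := Int.gcd_dvd_left ..
  have hG : g ∣ dupDen a e := Int.gcd_dvd_right ..
  have h1 : g ∣ 116 * a ^ 7 := by
    have := (hF.mul_left (4 * (29*a^3-40*a^2*e-28*a*e^2+48*e^3))).add
      (hG.mul_left (4 * (10*a^3+76*a*e^2-48*e^3)))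
    exact Eq.mp (congrArg (g ∣ ·) (by unfold dupNum dupDen; ring)) this
  have h2 : g ∣ 116 * e ^ 7 := by
    have := (hF.mul_left (48*a^2*e-24*a*e^2-73*e^3)).add
      (hG.mul_left (-12*a^3-3*a^2*e-20*a*e^2+102*e^3))
    exact Eq.mp (congrArg (g ∣ ·) (by unfold dupNum dupDen; ring)) this
  obtain ⟨u, v, huv⟩ := hco.pow (m := 7) (n := 7)
  have := (h1.mul_left u).add (h2.mul_left v)
  exact Eq.mp (congrArg (g ∣ ·) (by linear_combination 116 * huv)) this

lemma pow_le_of_dup {a e A E B H : ℤ} (he : 0 < e) (hco : IsCoprime a e) (hE : E ≠ 0)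
    (hA : |A| ≤ B) (hEB : |E| ≤ B) (h : dupNum a e * E = dupDen a e * A)
    (hH : H = max |a| e) : H ^ 4 ≤ 1116 * B := by
  have haH : |a| ≤ H := hH ▸ le_max_left _ _
  have heH : |e| ≤ H := by rw [abs_of_pos he, hH]; exact le_max_right _ _
  have hH0 : 0 < H := lt_of_lt_of_le he (hH ▸ le_max_right _ _)
  have hg := gcd_dup_dvd hco
  have hne : dupNum a e ≠ 0 ∨ dupDen a e ≠ 0 := by
    by_contra! hc
    have h2 : (116 : ℤ) * e ^ 7 = 0 := by
      have h1 := hc.1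
      have h2 := hc.2
      unfold dupNum at h1
      unfold dupDen at h2
      linear_combination (48*a^2*e-24*a*e^2-73*e^3) * h1 +
        (-12*a^3-3*a^2*e-20*a*e^2+102*e^3) * h2
    have := pow_pos he 7
    omega
  have hg0 : Int.gcd (dupNum a e) (dupDen a e) ≠ 0 := by
    rw [Ne, Int.gcd_eq_zero_iff]; tauto
  obtain ⟨F, G, hFG, hF, hG⟩ := Int.exists_gcd_one (Nat.pos_of_ne_zero hg0)
  set g : ℤ := (Int.gcd (dupNum a e) (dupDen a e) : ℤ) with hgdef
  have hgpos : 0 < g := by positivity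
  have hgle : g ≤ 116 := Int.le_of_dvd (by norm_num) hg
  have hFGc : IsCoprime F G := Int.isCoprime_iff_gcd_eq_one.2 hFG
  have hrel : F * E = G * A := by
    rw [hF, hG] at h
    apply mul_right_cancel₀ hgpos.ne'
    linear_combination h
  have hB0 : 0 ≤ B := (abs_nonneg A).trans hA
  have hGB : |G| ≤ B := by
    have : G ∣ E := hFGc.symm.dvd_of_dvd_mul_left ⟨A, hrel⟩
    exact (Int.le_of_dvd (abs_pos.2 hE) ((abs_dvd_abs _ _).2 this)).trans hEB
  have hFB : |F| ≤ B := by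
    have : F ∣ A := hFGc.dvd_of_dvd_mul_left ⟨E, hrel.symm⟩
    rcases eq_or_ne A 0 with rfl | hA0
    · have : F = 0 := by simpa [hE] using hrel
      simpa [this] using hB0
    · exact (Int.le_of_dvd (abs_pos.2 hA0) ((abs_dvd_abs _ _).2 this)).trans hA
  have bound : ∀ {c : ℤ} {p q : ℤ} {s t : ℤ}, |p| ≤ s * H ^ 3 → |q| ≤ t * H ^ 3 → 0 ≤ s → 0 ≤ t →
      c * H ^ 7 = |p * (F * g) + q * (G * g)| → c * H ^ 4 ≤ (s + t) * (116 * B) := by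
    intro c p q s t hp hq hs ht hc
    have h1 : |p * (F * g)| ≤ s * H ^ 3 * (B * 116) := by
      rw [abs_mul, abs_mul, abs_of_pos hgpos]; gcongr
    have h2 : |q * (G * g)| ≤ t * H ^ 3 * (B * 116) := by
      rw [abs_mul, abs_mul, abs_of_pos hgpos]; gcongr
    have h3 := abs_add_le (p * (F * g)) (q * (G * g))
    rw [← hc] at h3
    have : H ^ 3 * (c * H ^ 4) ≤ H ^ 3 * ((s + t) * (116 * B)) := by nlinarith
    exact le_of_mul_le_mul_left this (by positivity)
  rcases max_choice |a| e with hm | hm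
  · have hHa : H = |a| := hH.trans hm
    have h7 : 29 * H ^ 7 = |(29*a^3+(-40)*a^2*e+(-28)*a*e^2+48*e^3) * (F * g) +
        (10*a^3+0*a^2*e+76*a*e^2+(-48)*e^3) * (G * g)| := by
      rw [← hF, ← hG, hHa, ← abs_pow, show (29 : ℤ) * |a ^ 7| = |29 * a ^ 7| by rw [abs_mul]; rfl]
      congr 1; unfold dupNum dupDen; ring
    have := bound (abs_combo_le haH heH) (abs_combo_le haH heH) (by positivity) (by positivity) h7
    norm_num at this
    linarith
  · have hHa : H = e := hH.trans hm
    have h7 : 116 * H ^ 7 = |(0*a^3+48*a^2*e+(-24)*a*e^2+(-73)*e^3) * (F * g) +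
        ((-12)*a^3+(-3)*a^2*e+(-20)*a*e^2+102*e^3) * (G * g)| := by
      rw [← hF, ← hG, hHa, ← abs_of_pos (show 0 < 116 * e ^ 7 by positivity)]
      congr 1; unfold dupNum dupDen; ring
    have := bound (abs_combo_le haH heH) (abs_combo_le haH heH) (by positivity) (by positivity) h7
    norm_num at this
    linarith

lemma abs_sq_root_le {A D H s : ℤ} (hA : |A| ≤ H) (hD : D ^ 2 ≤ H)
    (h : 4*A^3-3*A^2*D^2-4*A*(D^2)^2+4*(D^2)^3 = s ^ 2) : |D * s| ≤ 4 * H ^ 2 := by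
  have hD' : |D ^ 2| ≤ H := by rwa [abs_of_nonneg (sq_nonneg D)]
  have h0 : 0 ≤ H := (abs_nonneg A).trans hA
  have := abs_combo_le (c₀ := 4) (c₁ := -3) (c₂ := -4) (c₃ := 4) hA hD'
  norm_num at this
  have h1 := (le_abs_self _).trans this
  have h2 : (D * s) ^ 2 ≤ 15 * H ^ 4 := by
    have : D ^ 2 * s ^ 2 ≤ H * (15 * H ^ 3) := by
      apply mul_le_mul hD _ (sq_nonneg s) h0
      rw [← h]; linarith
    linarith [this]
  apply abs_le_of_sq_le_sq _ (by positivity)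
  nlinarith [pow_nonneg h0 4]

end curve

namespace curve

/-- Whether `v` is a square modulo `m`. -/
def isSqMod (m : ℕ) (v : ℤ) : Bool := (List.range m).any fun i => ((i * i : ℤ) - v) % m == 0

lemma isSqMod_sq {m : ℕ} (hm : 0 < m) (s : ℤ) : isSqMod m (s ^ 2) = true := by
  rw [isSqMod, List.any_eq_true]
  have hm' : (0 : ℤ) < m := by exact_mod_cast hm
  refine ⟨(s % m).toNat, ?_, ?_⟩
  · rw [List.mem_range]
    have := Int.emod_lt_of_pos s hm'
    omega
  · have h0 := Int.emod_nonneg s hm'.ne'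
    have : ((s % m).toNat : ℤ) = s % m := Int.toNat_of_nonneg h0
    rw [this, beq_iff_eq]
    apply Int.emod_eq_zero_of_dvd
    have h1 : (m : ℤ) ∣ s % m - s := by
      rw [Int.emod_def]; exact ⟨-(s / m), by ring⟩
    exact Eq.mp (congrArg ((m : ℤ) ∣ ·) (by ring)) (h1.mul_right (s % m + s))

/-- The right-hand side of the completed-square equation of the curve. -/
def disc (a e : ℤ) : ℤ := 4*a^3-3*a^2*e-4*a*e^2+4*e^3

lemma small_search : ∀ i < 177, ∀ d < 10, d = 0 ∨
    disc ((i : ℕ) - 88) ((d : ℕ) ^ 2) < 0 ∨ Nat.gcd (Int.natAbs ((i : ℤ) - 88)) d ≠ 1 ∨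
    (i, d) ∈ [(87, 1), (88, 1), (89, 1), (90, 1), (92, 1), (103, 1), (91, 2), (92, 3), (74, 5),
      (153, 7)] ∨
    ¬ ([11, 17, 19, 23, 31, 65, 63, 64, 29, 37, 41].all
      fun m => isSqMod m (disc ((i : ℕ) - 88) ((d : ℕ) ^ 2))) := by
  decide +kernel

lemma small_x {A D s : ℤ} (hD : 0 < D) (hco : IsCoprime A D) (hA : |A| ≤ 88) (hD9 : D ^ 2 ≤ 88)
    (h : disc A (D ^ 2) = s ^ 2) : (A, D) ∈ [((-1 : ℤ), (1 : ℤ)), (0, 1), (1, 1), (2, 1), (4, 1),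
      (15, 1), (3, 2), (4, 3), (-14, 5), (65, 7)] := by
  obtain ⟨h1, h2⟩ := abs_le.1 hA
  have hD10 : D < 10 := by nlinarith
  obtain ⟨d, rfl⟩ := Int.eq_ofNat_of_zero_le hD.le
  obtain ⟨i, hi⟩ := Int.eq_ofNat_of_zero_le (show 0 ≤ A + 88 by linarith)
  obtain rfl : A = i - 88 := by linarith
  rcases small_search i (by omega) d (by omega) with h0 | h0 | h0 | h0 | h0
  · subst h0; simp at hD
  · rw [h] at h0; nlinarith [sq_nonneg s]
  · rw [Int.isCoprime_iff_gcd_eq_one] at hco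
    exact absurd hco h0
  · fin_cases h0 <;> norm_num
  · exfalso
    apply h0
    rw [List.all_eq_true]
    intro m hm
    rw [h]
    apply isSqMod_sq
    fin_cases hm <;> norm_num

lemma exists_multiple_of_small_x {x y : ℚ} (h : On x y)
    (hx : x ∈ [(-1 : ℚ), 0, 1, 2, 4, 15, 3 / 4, 4 / 9, -14 / 25, 65 / 49]) :
    ∃ m : ℤ, pt x y h = m • gen := by
  have key : ∀ {x' y' : ℚ} (h' : On x' y') (m : ℤ), x = x' → pt x' y' h' = m • gen →
      ∃ m : ℤ, pt x y h = m • gen := by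
    rintro x' y' h' m rfl e
    rcases pt_eq_or_neg h h' with e' | e'
    · exact ⟨m, e'.trans e⟩
    · exact ⟨-m, by rw [e', e, neg_zsmul]⟩
  have step : ∀ {x' y' x'' y'' : ℚ} {m : ℤ} (h' : ∃ h, pt x' y' h = m • gen), x' ≠ 0 →
      x'' = 2*(1-x'-y')/x'^2 → y'' = addGenY x' y' → ∃ h, pt x'' y'' h = (m + 1) • gen := by
    rintro x' y' x'' y'' m ⟨h', e⟩ hx' rfl rfl
    obtain ⟨h'', e''⟩ := pt_add_gen h' hx'
    exact ⟨h'', by rw [← e'', e, add_zsmul, one_zsmul]⟩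
  have h1 : ∃ h, pt 0 1 h = (1 : ℤ) • gen := ⟨on_gen, by rw [one_zsmul]; rfl⟩
  have h2 : ∃ h, pt 1 (-1) h = (2 : ℤ) • gen := by
    have h : On 1 (-1) := by norm_num [On]
    obtain ⟨y', h', e⟩ := pt_sub_gen h (by norm_num)
    rw [sub_eq_iff_eq_add, pt_congr h' (x' := 0) (by norm_num) rfl] at e
    refine ⟨h, ?_⟩
    rw [two_zsmul]
    rcases pt_zero (y := y') (by convert h'; norm_num) with e' | e'
    · rw [e, e']
    · rw [e', neg_add_cancel] at e
      exact absurd e (pt_ne_zero h)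
  have h3 : ∃ h, pt 2 1 h = (3 : ℤ) • gen := by
    simpa using step h2 (by norm_num) (by norm_num) (by norm_num [addGenY])
  have h4 : ∃ h, pt (-1) 0 h = (4 : ℤ) • gen := by
    simpa using step h3 (by norm_num) (by norm_num) (by norm_num [addGenY])
  have h5 : ∃ h, pt 4 (-9) h = (5 : ℤ) • gen := by
    simpa using step h4 (by norm_num) (by norm_num) (by norm_num [addGenY])
  have h6 : ∃ h, pt (3/4) (1/8) h = (6 : ℤ) • gen := by
    simpa using step h5 (by norm_num) (by norm_num) (by norm_num [addGenY])
  have h7 : ∃ h, pt (4/9) (-25/27) h = (7 : ℤ) • gen := by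
    simpa using step h6 (by norm_num) (by norm_num) (by norm_num [addGenY])
  have h8 : ∃ h, pt 15 49 h = (8 : ℤ) • gen := by
    simpa using step h7 (by norm_num) (by norm_num) (by norm_num [addGenY])
  have h9 : ∃ h, pt (-14/25) (169/125) h = (9 : ℤ) • gen := by
    simpa using step h8 (by norm_num) (by norm_num) (by norm_num [addGenY])
  have h10 : ∃ h, pt (65/49) (-512/343) h = (10 : ℤ) • gen := by
    simpa using step h9 (by norm_num) (by norm_num) (by norm_num [addGenY])
  simp only [List.mem_cons, List.not_mem_nil, or_false] at hx
  rcases hx with e | e | e | e | e | e | e | e | e | e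
  · exact key _ 4 e h4.2
  · exact key _ 1 e h1.2
  · exact key _ 2 e h2.2
  · exact key _ 3 e h3.2
  · exact key _ 5 e h5.2
  · exact key _ 8 e h8.2
  · exact key _ 6 e h6.2
  · exact key _ 7 e h7.2
  · exact key _ 9 e h9.2
  · exact key _ 10 e h10.2

end curve

namespace curve

lemma halving_height {A D C A' D' : ℤ} {x y x' : ℚ} (hD' : 0 < D')
    (hco' : IsCoprime A' D') (hx : x = A / D ^ 2) (hy : y = C / D ^ 3) (hD : 0 < D)
    (hd : disc A (D ^ 2) = (2 * C + A * D) ^ 2) (hx' : x' = A' / D' ^ 2)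
    (hne : 4 * x' ^ 3 - 3 * x' ^ 2 - 4 * x' + 4 ≠ 0)
    (h : x = (x' ^ 4 + 2 * x' ^ 2 - 8 * x' + 4) / (4 * x' ^ 3 - 3 * x' ^ 2 - 4 * x' + 4) ∨
      x ≠ 0 ∧ 2 * (1 - x - y) / x ^ 2 =
        (x' ^ 4 + 2 * x' ^ 2 - 8 * x' + 4) / (4 * x' ^ 3 - 3 * x' ^ 2 - 4 * x' + 4))
    (hbig : 88 < max |A| (D ^ 2)) : max |A'| (D' ^ 2) < max |A| (D ^ 2) := by
  set H := max |A| (D ^ 2) with hH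
  set H' := max |A'| (D' ^ 2) with hH'
  have hAH : |A| ≤ H := le_max_left _ _
  have hDH : D ^ 2 ≤ H := le_max_right _ _
  have hDq : (D : ℚ) ≠ 0 := by exact_mod_cast hD.ne'
  have hDq' : (D' : ℚ) ≠ 0 := by exact_mod_cast hD'.ne'
  have hden : (dupDen A' (D' ^ 2) : ℚ) = D' ^ 8 * (4 * x' ^ 3 - 3 * x' ^ 2 - 4 * x' + 4) := by
    rw [hx', dupDen]; push_cast; field_simp
  have hnum : (dupNum A' (D' ^ 2) : ℚ) = D' ^ 8 * (x' ^ 4 + 2 * x' ^ 2 - 8 * x' + 4) := by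
    rw [hx', dupNum]; push_cast; field_simp
  have hdup : ∀ {N E : ℤ}, (E : ℚ) ≠ 0 → (N / E : ℚ) =
      (x' ^ 4 + 2 * x' ^ 2 - 8 * x' + 4) / (4 * x' ^ 3 - 3 * x' ^ 2 - 4 * x' + 4) →
      dupNum A' (D' ^ 2) * E = dupDen A' (D' ^ 2) * N := by
    intro N E hE e
    rw [div_eq_div_iff hE hne] at e
    have : (dupNum A' (D' ^ 2) * E : ℚ) = dupDen A' (D' ^ 2) * N := by
      rw [hden, hnum]; linear_combination -(D' : ℚ) ^ 8 * e
    exact_mod_cast this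
  have hco2 : IsCoprime A' (D' ^ 2) := hco'.pow_right
  have main : ∀ B : ℤ, H' ^ 4 ≤ 1116 * B → B ≤ 7 * H ^ 2 → H' < H := by
    intro B h1 h2
    by_contra! h3
    have h4 : H ^ 4 ≤ H' ^ 4 := by gcongr
    have h5 : H ^ 2 * H ^ 2 ≤ 7812 * H ^ 2 := by linarith
    have h6 := le_of_mul_le_mul_right h5 (by positivity)
    nlinarith
  rcases h with h | ⟨hx0, h⟩
  · refine main H (pow_le_of_dup (by positivity) hco2 (A := A) (E := D ^ 2) (by positivity)
      hAH ?_ ?_ hH') ?_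
    · rwa [abs_of_pos (by positivity)]
    · apply hdup (by push_cast; positivity)
      rw [← h, hx]; push_cast; rfl
    · nlinarith
  · have hA0 : A ≠ 0 := by rintro rfl; exact hx0 (by rw [hx]; simp)
    have hAq : (A : ℚ) ≠ 0 := by exact_mod_cast hA0
    refine main (7 * H ^ 2) (pow_le_of_dup (by positivity) hco2
      (A := 2 * D * (D ^ 3 - A * D - C)) (E := A ^ 2) (by positivity) ?_ ?_ ?_ hH') le_rfl
    · have h1 := abs_sq_root_le hAH hDH hd
      have h2 : |2 * (D ^ 2) ^ 2| ≤ 2 * H ^ 2 := by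
        rw [abs_of_nonneg (by positivity)]; gcongr
      have h3 : |A * D ^ 2| ≤ H ^ 2 := by
        rw [abs_mul, abs_of_pos (show 0 < D ^ 2 by positivity), pow_two H]; gcongr
      have : 2 * D * (D ^ 3 - A * D - C) = 2 * (D ^ 2) ^ 2 - A * D ^ 2 - D * (2 * C + A * D) := by
        ring
      rw [this]
      have := abs_sub (2 * (D ^ 2) ^ 2 - A * D ^ 2) (D * (2 * C + A * D))
      have := abs_sub (2 * (D ^ 2) ^ 2) (A * D ^ 2)
      linarith
    · rw [abs_pow]
      have : |A| ^ 2 ≤ H ^ 2 := by gcongr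
      nlinarith
    · apply hdup (by push_cast; positivity)
      rw [← h, hx, hy]; push_cast; field_simp

theorem exists_zsmul_gen (Q : curve.Point) : ∃ m : ℤ, Q = m • gen := by
  rcases eq_zero_or_pt Q with rfl | ⟨x, y, h, rfl⟩
  · exact ⟨0, by simp⟩
  obtain ⟨A, D, C, hD, hAD, hx, hy, hB⟩ := exists_coords h
  generalize hn : (max |A| (D ^ 2)).toNat = n
  induction n using Nat.strong_induction_on generalizing x y A D C with
  | _ n ih =>
  by_cases hsmall : max |A| (D ^ 2) ≤ 88
  · apply exists_multiple_of_small_x h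
    have := small_x hD hAD ((le_max_left _ _).trans hsmall) ((le_max_right _ _).trans hsmall) hB
    simp only [List.mem_cons, List.not_mem_nil, or_false, Prod.mk.injEq] at this
    rw [hx]
    rcases this with ⟨rfl, rfl⟩ | ⟨rfl, rfl⟩ | ⟨rfl, rfl⟩ | ⟨rfl, rfl⟩ | ⟨rfl, rfl⟩ | ⟨rfl, rfl⟩ |
      ⟨rfl, rfl⟩ | ⟨rfl, rfl⟩ | ⟨rfl, rfl⟩ | ⟨rfl, rfl⟩ <;> norm_num
  push Not at hsmall
  by_cases hx0 : x = 0
  · subst hx0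
    rcases pt_zero h with e | e
    · exact ⟨1, by rw [e, one_zsmul]⟩
    · exact ⟨-1, by rw [e, neg_zsmul, one_zsmul]⟩
  obtain ⟨R, hR⟩ := two_descent (pt x y h)
  obtain ⟨m, hm⟩ : ∃ m : ℤ, R = m • gen := by
    rcases eq_zero_or_pt R with rfl | ⟨x', y', h', rfl⟩
    · exact ⟨0, by simp⟩
    obtain ⟨A', D', C', hD', hAD', hx', hy', hB'⟩ := exists_coords h'
    have hne := cubic_ne_zero h'
    obtain ⟨y'', h'', e⟩ := pt_add_self h' hne
    refine ih _ ?_ x' y' h' A' D' C' hD' hAD' hx' hy' hB' rfl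
    rw [← hn]
    have h0 : 0 < max |A| (D ^ 2) := by linarith
    suffices max |A'| (D' ^ 2) < max |A| (D ^ 2) by omega
    refine halving_height hD' hAD' hx hy hD hB hx' hne ?_ hsmall
    rcases hR with hR | hR
    · exact Or.inl (pt_inj (hR.trans e)).1
    · obtain ⟨hg, eg⟩ := pt_add_gen h hx0
      exact Or.inr ⟨hx0, (pt_inj (eg.symm.trans (hR.trans e))).1⟩
  rcases hR with hR | hR
  · exact ⟨m + m, by rw [hR, hm, add_zsmul]⟩
  · refine ⟨m + m - 1, ?_⟩
    rw [sub_zsmul, one_zsmul, add_zsmul, ← hm, ← hR, add_neg_cancel_right]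

end curve

namespace curve

lemma add_self_ne_zero {R : curve.Point} (hR : R ≠ 0) : R + R ≠ 0 := by
  rcases eq_zero_or_pt R with rfl | ⟨x, y, h, rfl⟩
  · exact absurd rfl hR
  · obtain ⟨y', h', e⟩ := pt_add_self h (cubic_ne_zero h)
    rw [e]; exact pt_ne_zero h'

lemma gen_ne_add_self (R : curve.Point) : gen ≠ R + R := by
  intro hg
  rcases eq_zero_or_pt R with rfl | ⟨x, y, h, rfl⟩
  · rw [add_zero] at hg; exact pt_ne_zero on_gen hg
  obtain ⟨y', h', e⟩ := pt_add_self h (cubic_ne_zero h)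
  rw [e] at hg
  have hx := (pt_inj hg).1
  rw [eq_comm, div_eq_zero_iff, or_iff_left (cubic_ne_zero h)] at hx
  obtain ⟨A, D, C, hD, hAD, hxA, -, -⟩ := exists_coords h
  have hD0 : (D : ℚ) ≠ 0 := by exact_mod_cast hD.ne'
  rw [hxA] at hx
  field_simp at hx
  have hx' : A ^ 4 + 2 * A ^ 2 * D ^ 4 - 8 * A * D ^ 6 + 4 * D ^ 8 = 0 := by
    have : (A ^ 4 + 2 * A ^ 2 * D ^ 4 - 8 * A * D ^ 6 + 4 * D ^ 8 : ℚ) = 0 := by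
      linear_combination hx
    exact_mod_cast this
  have h1 : D ∣ A ^ 4 := ⟨-(2 * A ^ 2 * D ^ 3 - 8 * A * D ^ 5 + 4 * D ^ 7), by
    linear_combination hx'⟩
  have h2 : IsUnit D := (hAD.pow_left (m := 4)).symm.isUnit_of_dvd' dvd_rfl h1
  obtain rfl : D = 1 := by
    rcases Int.isUnit_iff.1 h2 with h | h <;> omega
  have h3 : A ∣ 4 := ⟨-(A ^ 3 + 2 * A - 8), by linear_combination hx'⟩
  have h4 : A ≤ 4 := Int.le_of_dvd (by norm_num) h3
  have h5 : -A ≤ 4 := Int.le_of_dvd (by norm_num) (neg_dvd.2 h3)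
  have h6 : -4 ≤ A := by linarith
  interval_cases A <;> norm_num at hx'

lemma zsmul_gen_ne_zero {m : ℤ} (hm : m ≠ 0) : m • gen ≠ 0 := by
  generalize hn : m.natAbs = n
  induction n using Nat.strong_induction_on generalizing m with
  | _ n ih =>
  rcases Int.even_or_odd' m with ⟨j, rfl | rfl⟩
  · rw [two_mul, add_zsmul]
    exact add_self_ne_zero (ih j.natAbs (by omega) (by omega) rfl)
  · intro h0
    apply gen_ne_add_self (-(j • gen))
    rw [two_mul, add_zsmul, add_zsmul, one_zsmul] at h0
    rw [eq_comm, ← sub_eq_zero, ← neg_eq_zero, ← h0]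
    abel

/-- The `x`-coordinate of a point, with value `0` at infinity. -/
def xCoord : curve.Point → ℚ
  | .zero => 0
  | .some x _ _ => x

/-- The `y`-coordinate of a point, with value `0` at infinity. -/
def yCoord : curve.Point → ℚ
  | .zero => 0
  | .some _ y _ => y

/-- The `x`-coordinate of the `m`-th multiple of the generator. -/
def mulX (m : ℤ) : ℚ := xCoord (m • gen)

/-- The `y`-coordinate of the `m`-th multiple of the generator. -/
def mulY (m : ℤ) : ℚ := yCoord (m • gen)

lemma exists_zsmul_eq_pt {m : ℤ} (hm : m ≠ 0) : ∃ h, m • gen = pt (mulX m) (mulY m) h := by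
  rcases eq_zero_or_pt (m • gen) with h | ⟨x, y, h, e⟩
  · exact absurd h (zsmul_gen_ne_zero hm)
  · have hx : mulX m = x := by rw [mulX, e]; rfl
    have hy : mulY m = y := by rw [mulY, e]; rfl
    subst hx hy
    exact ⟨h, e⟩

lemma mulX_eq_of_pt {m : ℤ} {x y : ℚ} {h : On x y} (e : m • gen = pt x y h) :
    mulX m = x ∧ mulY m = y := by
  rw [mulX, mulY, e]; exact ⟨rfl, rfl⟩

lemma on_mul {m : ℤ} (hm : m ≠ 0) : On (mulX m) (mulY m) := (exists_zsmul_eq_pt hm).1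

lemma mulX_one : mulX 1 = 0 := by rw [mulX, one_zsmul]; rfl

lemma mulX_neg (m : ℤ) : mulX (-m) = mulX m := by
  rcases eq_or_ne m 0 with rfl | hm
  · simp
  · obtain ⟨h, e⟩ := exists_zsmul_eq_pt hm
    have : (-m) • gen = pt (mulX m) (-mulY m - mulX m) (on_neg h) := by
      rw [neg_zsmul, e, neg_pt]
    exact (mulX_eq_of_pt this).1

lemma zsmul_gen_injective : Function.Injective fun m : ℤ => m • gen := by
  intro a b h
  by_contra hab
  apply zsmul_gen_ne_zero (sub_ne_zero.2 hab)
  simp only at h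
  rw [sub_zsmul, h, add_neg_cancel]

lemma mulX_ne_zero {m : ℤ} (h0 : m ≠ 0) (h1 : m ≠ 1) (h2 : m ≠ -1) : mulX m ≠ 0 := by
  intro hx
  obtain ⟨h, e⟩ := exists_zsmul_eq_pt h0
  have h' : On 0 (mulY m) := hx ▸ h
  rw [pt_congr h hx rfl] at e
  rcases pt_zero h' with e' | e'
  · apply h1; apply zsmul_gen_injective; simp only; rw [e, e', one_zsmul]
  · apply h2; apply zsmul_gen_injective; simp only; rw [e, e', neg_zsmul, one_zsmul]

lemma mulX_add_one {m : ℤ} (h0 : m ≠ 0) (hx : mulX m ≠ 0) :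
    mulX (m + 1) = 2 * (1 - mulX m - mulY m) / mulX m ^ 2 := by
  obtain ⟨h, e⟩ := exists_zsmul_eq_pt h0
  obtain ⟨h', e'⟩ := pt_add_gen h hx
  exact (mulX_eq_of_pt (h := h') (by rw [add_zsmul, one_zsmul, e, e'])).1

lemma mulX_sub_one {m : ℤ} (h0 : m ≠ 0) (hx : mulX m ≠ 0) :
    mulX (m - 1) = 2 * (1 + mulY m) / mulX m ^ 2 := by
  obtain ⟨h, e⟩ := exists_zsmul_eq_pt h0
  obtain ⟨y', h', e'⟩ := pt_sub_gen h hx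
  refine (mulX_eq_of_pt (h := h') ?_).1
  rw [← e', ← e, sub_zsmul, one_zsmul, sub_eq_add_neg]

lemma mulX_two : mulX 2 = 1 := by
  have h : mulX (2 - 1) = _ := mulX_sub_one (by norm_num) (mulX_ne_zero (m := 2) (by norm_num)
    (by norm_num) (by norm_num))
  have hx := mulX_ne_zero (m := 2) (by norm_num) (by norm_num) (by norm_num)
  rw [show (2 - 1 : ℤ) = 1 by norm_num, mulX_one, eq_comm, div_eq_zero_iff,
    or_iff_left (pow_ne_zero 2 hx)] at h
  have hy : mulY 2 = -1 := by linarith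
  have := on_mul (m := 2) (by norm_num)
  rw [hy, On] at this
  have : mulX 2 ^ 2 * (mulX 2 - 1) = 0 := by linarith
  rcases mul_eq_zero.1 this with h | h
  · exact absurd h (pow_ne_zero 2 hx)
  · linarith

end curve

namespace curve

/-- The factor `2` at odd indices and `1` at even ones. -/
def eps (n : ℤ) : ℤ := 1 + n % 2

lemma eps_even {n : ℤ} (h : n % 2 = 0) : eps n = 1 := by simp [eps, h]

lemma eps_odd {n : ℤ} (h : n % 2 = 1) : eps n = 2 := by simp [eps, h]

lemma eps_neg (n : ℤ) : eps (-n) = eps n := by unfold eps; omega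

lemma eps_add_two (n : ℤ) : eps (n + 2) = eps n := by unfold eps; omega

lemma eps_sub_one (n : ℤ) : eps (n - 1) = eps (n + 1) := by unfold eps; omega

lemma eps_mul_eps_add_one (n : ℤ) : eps n * eps (n + 1) = 2 := by
  rcases Int.emod_two_eq_zero_or_one n with h | h
  · rw [eps_even h, eps_odd (by omega)]; rfl
  · rw [eps_odd h, eps_even (by omega)]; rfl

lemma eps_pos (n : ℤ) : 0 < eps n := by unfold eps; omega

lemma eps_ne_zero (n : ℤ) : (eps n : ℚ) ≠ 0 := by exact_mod_cast (eps_pos n).ne'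

/-- Rational division sequence attached to the multiples of `gen`, on the natural numbers. -/
def divSeqNat : ℕ → ℚ
  | 0 => 0
  | 1 => 1
  | 2 => 1
  | (n + 3) => -mulX (n + 2 : ℕ) * divSeqNat (n + 2) ^ 2 / (eps (n + 2 : ℕ) * divSeqNat (n + 1))

lemma divSeqNat_ne_zero : ∀ n : ℕ, divSeqNat (n + 1) ≠ 0
  | 0 => by simp [divSeqNat]
  | 1 => by simp [divSeqNat]
  | (n + 2) => by
    rw [divSeqNat]
    have h1 := divSeqNat_ne_zero (n + 1)
    have h0 := divSeqNat_ne_zero n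
    exact div_ne_zero (mul_ne_zero (neg_ne_zero.2 (mulX_ne_zero (by omega) (by omega) (by omega)))
      (pow_ne_zero 2 h1)) (mul_ne_zero (eps_ne_zero _) h0)

/-- Rational division sequence attached to the multiples of `gen`. -/
def divSeq (n : ℤ) : ℚ := n.sign * divSeqNat n.natAbs

lemma divSeq_neg (n : ℤ) : divSeq (-n) = -divSeq n := by simp [divSeq]

lemma divSeq_natCast (n : ℕ) : divSeq n = divSeqNat n := by
  rcases n with _ | n
  · simp [divSeq, divSeqNat]
  · rw [divSeq, Int.sign_natCast_of_ne_zero (by omega), Int.natAbs_natCast]; simp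

@[simp] lemma divSeq_zero : divSeq 0 = 0 := by simp [divSeq]
@[simp] lemma divSeq_one : divSeq 1 = 1 := by simp [divSeq, divSeqNat]
@[simp] lemma divSeq_two : divSeq 2 = 1 := by
  rw [show (2 : ℤ) = (2 : ℕ) from rfl, divSeq_natCast]; simp [divSeqNat]
@[simp] lemma divSeq_neg_one : divSeq (-1) = -1 := by simp [divSeq_neg]
@[simp] lemma divSeq_neg_two : divSeq (-2) = -1 := by simp [divSeq_neg]

lemma divSeq_ne_zero {n : ℤ} (h : n ≠ 0) : divSeq n ≠ 0 := by
  rw [divSeq]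
  refine mul_ne_zero (by simpa using h) ?_
  obtain ⟨k, hk⟩ := Nat.exists_eq_succ_of_ne_zero (Int.natAbs_ne_zero.2 h)
  rw [hk]; exact divSeqNat_ne_zero k

lemma divSeq_succ_mul_pred {n : ℤ} (hn : n ≠ 0) :
    eps n * divSeq (n + 1) * divSeq (n - 1) = -mulX n * divSeq n ^ 2 := by
  have key : ∀ n : ℕ, n ≠ 0 →
      eps n * divSeq (n + 1) * divSeq (n - 1) = -mulX n * divSeq n ^ 2 := by
    intro n hn
    match n, hn with
    | 1, _ => simp [mulX_one]
    | (n + 2), _ =>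
      rw [show ((n + 2 : ℕ) : ℤ) + 1 = ((n + 3 : ℕ) : ℤ) by push_cast; ring,
        show ((n + 2 : ℕ) : ℤ) - 1 = ((n + 1 : ℕ) : ℤ) by push_cast; ring]
      simp only [divSeq_natCast]
      rw [divSeqNat]
      have h0 := divSeqNat_ne_zero n
      have he := eps_ne_zero ((n + 2 : ℕ) : ℤ)
      field_simp
  rcases Int.natAbs_eq n with h | h
  · rw [h]; exact key _ (by omega)
  · have := key n.natAbs (by omega)
    rw [h, eps_neg, mulX_neg, divSeq_neg,
      show -(n.natAbs : ℤ) + 1 = -((n.natAbs : ℤ) - 1) by ring,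
      show -(n.natAbs : ℤ) - 1 = -((n.natAbs : ℤ) + 1) by ring, divSeq_neg, divSeq_neg]
    linear_combination this

@[simp] lemma divSeq_three : divSeq 3 = -1 := by
  have := divSeq_succ_mul_pred (n := 2) (by norm_num)
  norm_num [mulX_two, eps] at this
  exact this

@[simp] lemma divSeq_neg_three : divSeq (-3) = 1 := by simp [divSeq_neg]

lemma trichotomy_index (n : ℤ) :
    n = 0 ∨ n = 1 ∨ n = -1 ∨ (n ≠ 0 ∧ n ≠ 1 ∧ n ≠ -1) := by omega

lemma epsQ (n : ℤ) : (eps n : ℚ) * eps (n + 1) = 2 := by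
  exact_mod_cast eps_mul_eps_add_one n

lemma divSeq_mul_two_apart (n : ℤ) : divSeq (n + 2) * divSeq (n - 2) =
    eps n * divSeq (n + 1) * divSeq (n - 1) + divSeq n ^ 2 := by
  rcases trichotomy_index n with rfl | rfl | rfl | ⟨h0, h1, h2⟩
  · norm_num [eps]
  · norm_num [eps]
  · norm_num [eps]
  have hx := mulX_ne_zero h0 h1 h2
  have R := divSeq_succ_mul_pred h0
  have R1 := divSeq_succ_mul_pred (n := n + 1) (by omega)
  have R2 := divSeq_succ_mul_pred (n := n - 1) (by omega)
  have hw := divSeq_ne_zero h0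
  have he := epsQ n
  have hon := on_mul h0
  rw [On] at hon
  rw [mulX_add_one h0 hx] at R1
  rw [mulX_sub_one h0 hx, eps_sub_one] at R2
  rw [show n + 1 + 1 = n + 2 by ring, show n + 1 - 1 = n by ring] at R1
  rw [show n - 1 + 1 = n by ring, show n - 1 - 1 = n - 2 by ring] at R2
  set w := divSeq n
  set x := mulX n
  set y := mulY n
  set e : ℚ := ((eps n : ℤ) : ℚ)
  set f : ℚ := ((eps (n + 1) : ℤ) : ℚ)
  set p := divSeq (n + 1)
  set q := divSeq (n - 1)
  have he0 : e ≠ 0 := eps_ne_zero n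
  have hf0 : f ≠ 0 := eps_ne_zero _
  have hf : f = 2 / e := by field_simp; linarith
  have hq : p * q = -x * w ^ 2 / e := by field_simp; linarith
  have S : (f * divSeq (n + 2) * w) * (f * w * divSeq (n - 2)) =
      (2 * (1 - x - y)) * (2 * (1 + y)) / x ^ 4 * (p * q) ^ 2 := by
    rw [R1, R2]; field_simp
  have hy : (2 * (1 - x - y)) * (2 * (1 + y)) = (4 - 4 * x) * x ^ 2 := by
    linear_combination -4 * hon
  rw [hy, hq, hf] at S
  have T : divSeq (n + 2) * divSeq (n - 2) = (1 - x) * w ^ 2 := by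
    have h : 4 * w ^ 2 / e ^ 2 ≠ 0 := by positivity
    refine mul_left_cancel₀ h ?_
    have : (4 - 4 * x) * x ^ 2 / x ^ 4 * (-x * w ^ 2 / e) ^ 2 =
      4 * w ^ 2 / e ^ 2 * ((1 - x) * w ^ 2) := by field_simp
    rw [← this, ← S]; field_simp; ring
  rw [T, R]; ring

lemma divSeq_add_two_apart (n : ℤ) :
    divSeq (n + 2) * divSeq (n - 1) ^ 2 + divSeq (n - 2) * divSeq (n + 1) ^ 2 =
    -eps (n + 1) * divSeq n ^ 3 - divSeq (n + 1) * divSeq (n - 1) * divSeq n := by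
  rcases trichotomy_index n with rfl | rfl | rfl | ⟨h0, h1, h2⟩
  · norm_num
  · norm_num [eps]
  · norm_num [eps]
  have hx := mulX_ne_zero h0 h1 h2
  have R := divSeq_succ_mul_pred h0
  have R1 := divSeq_succ_mul_pred (n := n + 1) (by omega)
  have R2 := divSeq_succ_mul_pred (n := n - 1) (by omega)
  have hw := divSeq_ne_zero h0
  have he := epsQ n
  rw [mulX_add_one h0 hx] at R1
  rw [mulX_sub_one h0 hx, eps_sub_one] at R2
  rw [show n + 1 + 1 = n + 2 by ring, show n + 1 - 1 = n by ring] at R1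
  rw [show n - 1 + 1 = n by ring, show n - 1 - 1 = n - 2 by ring] at R2
  set w := divSeq n
  set x := mulX n
  set y := mulY n
  set e : ℚ := ((eps n : ℤ) : ℚ)
  set f : ℚ := ((eps (n + 1) : ℤ) : ℚ)
  set p := divSeq (n + 1)
  set q := divSeq (n - 1)
  have he0 : e ≠ 0 := eps_ne_zero n
  have hf0 : f ≠ 0 := eps_ne_zero _
  have hf : f = 2 / e := by field_simp; linarith
  have hq : p * q = -x * w ^ 2 / e := by field_simp; linarith
  have S : f * w * (divSeq (n + 2) * q ^ 2 + divSeq (n - 2) * p ^ 2) =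
      -(4 - 2 * x) / x ^ 2 * (p * q) ^ 2 := by
    have : f * w * (divSeq (n + 2) * q ^ 2 + divSeq (n - 2) * p ^ 2) =
      (f * divSeq (n + 2) * w) * q ^ 2 + (f * w * divSeq (n - 2)) * p ^ 2 := by ring
    rw [this, R1, R2]; field_simp; ring
  rw [hq, hf] at S
  have h : 2 / e * w ≠ 0 := by positivity
  refine mul_left_cancel₀ h ?_
  rw [S, hq, hf]; field_simp; ring

/-- The factor appearing in the addition formula of `divSeq`. -/
def parityFactor (m n : ℤ) : ℤ := if m % 2 = 1 ∧ n % 2 = 1 then 2 else 1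

lemma parityFactor_ne_zero (m n : ℤ) : (parityFactor m n : ℚ) ≠ 0 := by
  unfold parityFactor; split_ifs <;> norm_num

/-- The left side of the addition formula of `divSeq`. -/
def addForm (m n : ℤ) : ℚ := eps m * divSeq (m + 1) * divSeq (m - 1) * divSeq n ^ 2 -
  eps n * divSeq (n + 1) * divSeq (n - 1) * divSeq m ^ 2

lemma addForm_symm (m n : ℤ) : addForm m n = -addForm n m := by unfold addForm; ring

lemma addForm_neg (m n : ℤ) : addForm (-m) n = addForm m n := by
  unfold addForm
  rw [show -m + 1 = -(m - 1) by ring, show -m - 1 = -(m + 1) by ring, eps_neg]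
  simp only [divSeq_neg]; ring

lemma addForm_step (m n : ℤ) : (eps n : ℚ) ^ 2 * (addForm m (n + 1) * addForm m (n - 1)) =
    eps m ^ 2 * (addForm (m + 1) n * addForm (m - 1) n) := by
  have key : ∀ m n : ℤ, (eps n : ℚ) ^ 2 * (addForm m (n + 1) * addForm m (n - 1)) =
    (eps m * divSeq (m + 1) * divSeq (m - 1)) ^ 2 * (eps n * divSeq (n + 1) * divSeq (n - 1)) ^ 2
    + 4 * (eps m * divSeq (m + 1) * divSeq (m - 1)) * divSeq m ^ 2 * divSeq n ^ 4
    + 2 * (eps m * divSeq (m + 1) * divSeq (m - 1)) * divSeq m ^ 2 *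
      ((eps n * divSeq (n + 1) * divSeq (n - 1)) * divSeq n ^ 2)
    + 4 * divSeq m ^ 4 * divSeq n ^ 4
    + 4 * divSeq m ^ 4 * divSeq n ^ 2 * (eps n * divSeq (n + 1) * divSeq (n - 1)) := by
    intro m n
    unfold addForm
    rw [eps_sub_one n, show n + 1 + 1 = n + 2 by ring, show n + 1 - 1 = n by ring,
      show n - 1 + 1 = n by ring, show n - 1 - 1 = n - 2 by ring]
    have he := epsQ n
    have r2 := divSeq_mul_two_apart n
    have r3 := divSeq_add_two_apart n
    generalize divSeq (n + 2) = w2 at *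
    generalize divSeq (n - 2) = v2 at *
    generalize divSeq (n + 1) = w1 at *
    generalize divSeq (n - 1) = v1 at *
    generalize divSeq n = w at *
    generalize divSeq m = M at *
    generalize eps m * divSeq (m + 1) * divSeq (m - 1) = B
    generalize (eps n : ℚ) = e at *
    generalize (eps (n + 1) : ℚ) = f at *
    linear_combination (-e ^ 2 * f * B * M ^ 2 * w) * r3 + 4 * w ^ 2 * M ^ 4 * r2 +
      ((e * f + 2) * w ^ 2 * M ^ 4 * (w2 * v2) + (e * f + 2) * B * M ^ 2 * w ^ 4 +
        e * B * M ^ 2 * w ^ 2 * w1 * v1) * he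
  rw [key]
  have := key n m
  rw [addForm_symm (m + 1), addForm_symm (m - 1), neg_mul_neg, this]
  ring
end curve

namespace curve

lemma parityFactor_comm (m n : ℤ) : parityFactor m n = parityFactor n m := by
  unfold parityFactor; simp only [and_comm]

lemma parityFactor_step (m n : ℤ) :
    eps n ^ 2 * (parityFactor m (n + 1) * parityFactor m (n - 1)) =
      eps m ^ 2 * (parityFactor (m + 1) n * parityFactor (m - 1) n) := by
  unfold parityFactor eps
  rcases Int.emod_two_eq_zero_or_one n with h | h <;>
  rcases Int.emod_two_eq_zero_or_one m with h' | h' <;>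
  simp [h, h', show (n + 1) % 2 = 1 - n % 2 by omega, show (n - 1) % 2 = 1 - n % 2 by omega,
    show (m + 1) % 2 = 1 - m % 2 by omega, show (m - 1) % 2 = 1 - m % 2 by omega]

lemma parityFactor_neg (m n : ℤ) : parityFactor (-m) n = parityFactor m n := by
  unfold parityFactor; simp only [Int.neg_emod_two]

lemma addForm_eq_natCast : ∀ (n : ℕ) (m : ℤ),
    addForm m n = parityFactor m n * (divSeq (m + n) * divSeq (m - n))
  | 0, m => by simp [addForm, parityFactor, eps]; ring
  | 1, m => by
    have : (parityFactor m 1 : ℚ) = eps m := by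
      unfold parityFactor eps
      rcases Int.emod_two_eq_zero_or_one m with h | h <;> norm_num [h]
    simp [addForm, this]; ring
  | (n + 2), m => by
    have ih := addForm_eq_natCast n
    have ih1 := addForm_eq_natCast (n + 1)
    have st := addForm_step m (n + 1)
    have sp : (eps (n + 1) : ℚ) ^ 2 * (parityFactor m (n + 1 + 1) * parityFactor m (n + 1 - 1)) =
      eps m ^ 2 * (parityFactor (m + 1) (n + 1) * parityFactor (m - 1) (n + 1)) := by
      exact_mod_cast parityFactor_step m (n + 1)
    push_cast at ih1 ⊢
    rw [add_sub_cancel_right, add_assoc (n : ℤ) 1 1, one_add_one_eq_two] at st sp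
    rw [ih m, ih1, ih1] at st
    by_cases h1 : m = n
    · subst h1
      rw [addForm_symm, ih, parityFactor_comm, show (n : ℤ) + 2 - n = 2 by ring,
        show (n : ℤ) - (n + 2) = -2 by ring, add_comm ((n : ℤ) + 2)]
      simp
    by_cases h2 : m = -n
    · subst h2
      rw [addForm_neg, addForm_symm, ih, parityFactor_comm, show (n : ℤ) + 2 - n = 2 by ring,
        show -(n : ℤ) + (n + 2) = 2 by ring, show -(n : ℤ) - (n + 2) = -(n + 2 + n) by ring,
        divSeq_neg, parityFactor_neg]
      simp
    have hne : (eps (n + 1) : ℚ) ^ 2 * (parityFactor m n * (divSeq (m + n) * divSeq (m - n))) ≠ 0 :=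
      mul_ne_zero (pow_ne_zero 2 (eps_ne_zero _)) (mul_ne_zero (parityFactor_ne_zero _ _)
        (mul_ne_zero (divSeq_ne_zero (by omega)) (divSeq_ne_zero (by omega))))
    refine mul_left_cancel₀ hne ?_
    rw [show m + 1 + (n + 1 : ℤ) = m + (n + 2) by ring, show m + 1 - (n + 1 : ℤ) = m - n by ring,
      show m - 1 + (n + 1 : ℤ) = m + n by ring,
      show m - 1 - (n + 1 : ℤ) = m - (n + 2) by ring] at st
    generalize addForm m (n + 2) = X at *
    linear_combination st - (divSeq (m + n) * divSeq (m - n) * divSeq (m + (n + 2)) *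
      divSeq (m - (n + 2))) * sp

lemma addForm_eq (m n : ℤ) :
    addForm m n = parityFactor m n * (divSeq (m + n) * divSeq (m - n)) := by
  rcases Int.natAbs_eq n with h | h
  · rw [h]; exact addForm_eq_natCast _ _
  · rw [h, addForm_symm, addForm_neg, ← addForm_symm, addForm_eq_natCast, sub_neg_eq_add,
      ← sub_eq_add_neg, mul_comm (divSeq (m - _)), parityFactor_comm m, parityFactor_comm m,
      parityFactor_neg]

lemma divSeq_odd (n : ℤ) : divSeq (2 * n + 1) =
    eps (n + 1) * divSeq (n + 2) * divSeq n ^ 3 - eps n * divSeq (n - 1) * divSeq (n + 1) ^ 3 := by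
  have h := addForm_eq (n + 1) n
  have : parityFactor (n + 1) n = 1 := by unfold parityFactor; rw [if_neg]; omega
  rw [this, addForm, show n + 1 + n = 2 * n + 1 by ring, show n + 1 - n = 1 by ring,
    show n + 1 + 1 = n + 2 by ring, show n + 1 - 1 = n by ring] at h
  simp only [divSeq_one, Int.cast_one] at h
  linear_combination -h

lemma divSeq_even (n : ℤ) : divSeq (2 * n) =
    divSeq n * (divSeq (n + 2) * divSeq (n - 1) ^ 2 - divSeq (n - 2) * divSeq (n + 1) ^ 2) := by
  have h := addForm_eq (n + 1) (n - 1)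
  have : parityFactor (n + 1) (n - 1) = eps (n + 1) := by
    unfold parityFactor eps; split_ifs <;> omega
  rw [this, addForm, eps_sub_one, show n + 1 + (n - 1) = 2 * n by ring,
    show n + 1 - (n - 1) = 2 by ring, show n + 1 + 1 = n + 2 by ring, show n + 1 - 1 = n by ring,
    show n - 1 + 1 = n by ring, show n - 1 - 1 = n - 2 by ring] at h
  simp only [divSeq_two] at h
  refine mul_left_cancel₀ (eps_ne_zero (n + 1)) ?_
  linear_combination -h

lemma divSeq_integral_nat (n : ℕ) : ∃ z : ℤ, divSeq n = z := by
  induction n using Nat.strong_induction_on with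
  | _ n ih =>
    by_cases hn : n < 5
    · interval_cases n
      · exact ⟨0, by simp⟩
      · exact ⟨1, by simp⟩
      · exact ⟨1, by simp⟩
      · exact ⟨-1, by simp⟩
      · have := divSeq_add_two_apart 2
        norm_num [eps] at this
        exact ⟨-1, by push_cast; linarith⟩
    · obtain ⟨k, h⟩ := Nat.even_or_odd' n
      obtain ⟨a, ha⟩ := ih (k + 2) (by omega)
      obtain ⟨b, hb⟩ := ih (k + 1) (by omega)
      obtain ⟨c, hc⟩ := ih k (by omega)
      obtain ⟨d, hd⟩ := ih (k - 1) (by omega)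
      obtain ⟨e, he⟩ := ih (k - 2) (by omega)
      rw [Nat.cast_sub (by omega)] at hd he
      push_cast at ha hb hd he
      rcases h with h | h
      · rw [h]; push_cast
        rw [divSeq_even, ha, hb, hc, hd, he]
        exact ⟨c * (a * d ^ 2 - e * b ^ 2), by push_cast; rfl⟩
      · rw [h]; push_cast
        rw [divSeq_odd, ha, hb, hc, hd]
        exact ⟨eps (k + 1) * a * c ^ 3 - eps k * d * b ^ 3, by push_cast; rfl⟩

lemma divSeq_integral (n : ℤ) : ∃ z : ℤ, divSeq n = z := by
  obtain ⟨z, hz⟩ := divSeq_integral_nat n.natAbs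
  rcases Int.natAbs_eq n with h | h
  · exact ⟨z, by rw [h, hz]⟩
  · exact ⟨-z, by rw [h, divSeq_neg, hz]; simp⟩

/-- The integral division sequence. -/
noncomputable def W (n : ℤ) : ℤ := (divSeq_integral n).choose

lemma cast_W (n : ℤ) : (W n : ℚ) = divSeq n := (divSeq_integral n).choose_spec.symm

lemma W_zero : W 0 = 0 := by have := cast_W 0; rw [divSeq_zero] at this; exact_mod_cast this
lemma W_one : W 1 = 1 := by have := cast_W 1; rw [divSeq_one] at this; exact_mod_cast this
lemma W_two : W 2 = 1 := by have := cast_W 2; rw [divSeq_two] at this; exact_mod_cast this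
lemma W_three : W 3 = -1 := by have := cast_W 3; rw [divSeq_three] at this; exact_mod_cast this

lemma W_neg (n : ℤ) : W (-n) = -W n := by
  have := divSeq_neg n
  simp only [← cast_W] at this
  exact_mod_cast this

lemma W_ne_zero {n : ℤ} (h : n ≠ 0) : W n ≠ 0 := by
  have := divSeq_ne_zero h
  rw [← cast_W] at this
  exact_mod_cast this

lemma W_mul_two_apart (n : ℤ) : W (n + 2) * W (n - 2) =
    eps n * W (n + 1) * W (n - 1) + W n ^ 2 := by
  have := divSeq_mul_two_apart n
  simp only [← cast_W] at this
  exact_mod_cast this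

lemma W_add_two_apart (n : ℤ) : W (n + 2) * W (n - 1) ^ 2 + W (n - 2) * W (n + 1) ^ 2 =
    -eps (n + 1) * W n ^ 3 - W (n + 1) * W (n - 1) * W n := by
  have := divSeq_add_two_apart n
  simp only [← cast_W] at this
  exact_mod_cast this

lemma W_odd (n : ℤ) : W (2 * n + 1) =
    eps (n + 1) * W (n + 2) * W n ^ 3 - eps n * W (n - 1) * W (n + 1) ^ 3 := by
  have := divSeq_odd n
  simp only [← cast_W] at this
  exact_mod_cast this

lemma W_even (n : ℤ) : W (2 * n) =
    W n * (W (n + 2) * W (n - 1) ^ 2 - W (n - 2) * W (n + 1) ^ 2) := by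
  have := divSeq_even n
  simp only [← cast_W] at this
  exact_mod_cast this

lemma W_addForm (m n : ℤ) : eps m * W (m + 1) * W (m - 1) * W n ^ 2 -
    eps n * W (n + 1) * W (n - 1) * W m ^ 2 = parityFactor m n * (W (m + n) * W (m - n)) := by
  have := addForm_eq m n
  unfold addForm at this
  simp only [← cast_W] at this
  exact_mod_cast this

end curve

namespace curve

lemma W_odd_of_odd (k : ℤ) : W (2 * k + 1) % 2 = 1 := by
  have step : ∀ n : ℤ, n % 2 = 1 → W n % 2 = 1 → W (n + 2) % 2 = 1 ∧ W (n - 2) % 2 = 1 := by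
    intro n hn h
    have := W_mul_two_apart n
    rw [eps_odd hn] at this
    have h1 : W (n + 2) * W (n - 2) % 2 = 1 := by
      have h2 : W n ^ 2 % 2 = 1 := by
        rw [← Int.odd_iff] at h ⊢; exact h.pow
      rw [this, mul_assoc]; omega
    rw [← Int.odd_iff] at h1 ⊢
    rw [← Int.odd_iff]
    exact Int.odd_mul.1 h1
  induction k using Int.induction_on with
  | zero => simp [W_one]
  | succ k ih => exact (by convert (step _ (by omega) ih).1 using 3; ring)
  | pred k ih => exact (by convert (step _ (by omega) ih).2 using 3; ring)

lemma not_two_dvd_W {n : ℤ} (h : n % 2 = 1) : ¬ (2 : ℤ) ∣ W n := by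
  have := W_odd_of_odd (n / 2)
  rw [show 2 * (n / 2) + 1 = n by omega] at this
  omega

lemma not_prime_dvd_consecutive {p : ℤ} (hp : Prime p) (n : ℤ) : ¬ (p ∣ W n ∧ p ∣ W (n + 1)) := by
  have step : ∀ n : ℤ, (p ∣ W n ∧ p ∣ W (n + 1)) ↔ (p ∣ W (n + 1) ∧ p ∣ W (n + 1 + 1)) := by
    intro n
    constructor
    · rintro ⟨h1, h2⟩
      refine ⟨h2, hp.dvd_of_dvd_pow (n := 2) ?_⟩
      have h := W_mul_two_apart (n + 1 + 1)
      rw [show n + 1 + 1 - 2 = n by ring, show n + 1 + 1 - 1 = n + 1 by ring] at h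
      have := (h1.mul_left (W (n + 1 + 1 + 2))).sub
        (h2.mul_left (eps (n + 1 + 1) * W (n + 1 + 1 + 1)))
      exact Eq.mp (congrArg (p ∣ ·) (by linear_combination h)) this
    · rintro ⟨h1, h2⟩
      refine ⟨hp.dvd_of_dvd_pow (n := 2) ?_, h1⟩
      have h := W_mul_two_apart n
      rw [show n + 2 = n + 1 + 1 by ring] at h
      have := (h2.mul_left (W (n - 2))).sub (h1.mul_left (eps n * W (n - 1)))
      exact Eq.mp (congrArg (p ∣ ·) (by linear_combination h)) this
  have h0 : ¬ (p ∣ W 0 ∧ p ∣ W (0 + 1)) := by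
    rintro ⟨-, h⟩
    rw [zero_add, W_one] at h
    exact hp.not_dvd_one h
  induction n using Int.induction_on with
  | zero => exact h0
  | succ k ih => rwa [← step]
  | pred k ih => rw [step]; convert ih using 4 <;> ring

lemma not_prime_dvd_two_apart {p : ℤ} (hp : Prime p) (n : ℤ) :
    ¬ (p ∣ W (n - 1) ∧ p ∣ W (n + 1)) := by
  rintro ⟨h1, h2⟩
  have h := W_add_two_apart n
  have hf : p ∣ eps (n + 1) * W n ^ 3 := by
    have := (((h1.mul_left (-(W (n + 2) * W (n - 1)))).sub
      (h2.mul_left (W (n - 2) * W (n + 1)))).sub (h1.mul_left (W (n + 1) * W n)))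
    exact Eq.mp (congrArg (p ∣ ·) (by linear_combination -h)) this
  rcases hp.dvd_or_dvd hf with hf | hf
  · rcases Int.emod_two_eq_zero_or_one (n + 1) with ho | ho
    · rw [eps_even ho] at hf; exact hp.not_dvd_one hf
    · rw [eps_odd ho] at hf
      have : (2 : ℤ) ∣ p := (hp.associated_of_dvd Int.prime_two hf).symm.dvd
      exact not_two_dvd_W ho (this.trans h2)
  · exact not_prime_dvd_consecutive hp n ⟨hp.dvd_of_dvd_pow hf, h2⟩

/-- First coordinate of the `n`-th multiple on the plane cubic model. -/
noncomputable def coordA (n : ℤ) : ℤ := W (n - 1) * W (n + 1) ^ 2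

/-- Second coordinate of the `n`-th multiple on the plane cubic model. -/
noncomputable def coordB (n : ℤ) : ℤ := eps (n + 1) * W n ^ 2 * W (n + 1)

/-- Third coordinate of the `n`-th multiple on the plane cubic model. -/
noncomputable def coordC (n : ℤ) : ℤ := eps (n + 1) * W (n + 2) * W (n - 1) * W n

/-- The coordinate on the plane cubic model vanishing at infinity. -/
noncomputable def coordZ (n : ℤ) : ℤ := coordC n - coordB n - coordA n

lemma coord_cubic (n : ℤ) : coordB n ^ 2 * coordC n + coordA n * coordC n ^ 2 +
    2 * coordA n ^ 2 * coordB n + coordA n * coordB n ^ 2 +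
    coordA n * coordB n * coordC n = 0 := by
  have r3 := W_add_two_apart n
  have r2 := W_mul_two_apart n
  have he := eps_mul_eps_add_one n
  unfold coordA coordB coordC
  generalize W (n + 2) = w2 at *
  generalize W (n - 2) = v2 at *
  generalize W (n + 1) = p at *
  generalize W (n - 1) = q at *
  generalize W n = w at *
  generalize eps n = e at *
  generalize eps (n + 1) = f at *
  linear_combination f * q * p ^ 2 * w ^ 2 * (f * w2 * r3 - f * p ^ 2 * r2 - q * p ^ 3 * he)

lemma not_two_dvd_eps_succ_mul {p : ℤ} (hp : Prime p) {n : ℤ} (h : p ∣ eps (n + 1)) :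
    ¬ p ∣ W (n - 1) ∧ ¬ p ∣ W (n + 1) := by
  rcases Int.emod_two_eq_zero_or_one (n + 1) with ho | ho
  · rw [eps_even ho] at h; exact absurd h hp.not_dvd_one
  · rw [eps_odd ho] at h
    have : (2 : ℤ) ∣ p := (hp.associated_of_dvd Int.prime_two h).symm.dvd
    exact ⟨fun h' => not_two_dvd_W (by omega) (this.trans h'),
      fun h' => not_two_dvd_W ho (this.trans h')⟩

lemma not_prime_dvd_coords {p : ℤ} (hp : Prime p) (n : ℤ) :
    ¬ (p ∣ coordA n ∧ p ∣ coordB n ∧ p ∣ coordC n) := by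
  rintro ⟨ha, hb, hc⟩
  have hcons := not_prime_dvd_consecutive hp
  have hap := not_prime_dvd_two_apart hp n
  unfold coordA at ha
  by_cases h1 : p ∣ W (n + 1)
  · unfold coordC at hc
    rcases hp.dvd_or_dvd hc with hc | hc
    · rcases hp.dvd_or_dvd hc with hc | hc
      · rcases hp.dvd_or_dvd hc with hc | hc
        · exact (not_two_dvd_eps_succ_mul hp hc).2 h1
        · exact hcons (n + 1) ⟨h1, by rwa [add_assoc]⟩
      · exact hap ⟨hc, h1⟩
    · exact hcons n ⟨hc, h1⟩
  · have h2 : p ∣ W (n - 1) := by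
      rcases hp.dvd_or_dvd ha with h | h
      · exact h
      · exact absurd (hp.dvd_of_dvd_pow h) h1
    unfold coordB at hb
    rcases hp.dvd_or_dvd hb with hb | hb
    · rcases hp.dvd_or_dvd hb with hb | hb
      · exact (not_two_dvd_eps_succ_mul hp hb).1 h2
      · exact hcons (n - 1) ⟨h2, by rw [sub_add_cancel]; exact hp.dvd_of_dvd_pow hb⟩
    · exact h1 hb

lemma isUnit_of_dvd_coords {d n : ℤ} (ha : d ∣ coordA n) (hb : d ∣ coordB n)
    (hc : d ∣ coordC n) : IsUnit d := by
  by_contra hd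
  by_cases h0 : d = 0
  · subst h0
    exact not_prime_dvd_coords Int.prime_two n ⟨(dvd_zero 2).trans ha, (dvd_zero 2).trans hb,
      (dvd_zero 2).trans hc⟩
  · obtain ⟨p, hp, hpd⟩ := WfDvdMonoid.exists_irreducible_factor hd h0
    exact not_prime_dvd_coords hp.prime n ⟨hpd.trans ha, hpd.trans hb, hpd.trans hc⟩

lemma coordZ_ne_zero (n : ℤ) : coordZ n ≠ 0 := by
  intro h
  have hc : coordC n = coordA n + coordB n := by unfold coordZ at h; linarith
  have h3 := coord_cubic n
  rw [hc] at h3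
  set a := coordA n with ha
  set b := coordB n with hb
  have key : a ^ 3 + 5 * a ^ 2 * b + 4 * a * b ^ 2 + b ^ 3 = 0 := by linear_combination h3
  have hpar : (2 : ℤ) ∣ a ∧ (2 : ℤ) ∣ b := by
    have : (a ^ 3 + 5 * a ^ 2 * b + 4 * a * b ^ 2 + b ^ 3) % 2 = 0 := by rw [key]; rfl
    rcases Int.even_or_odd' a with ⟨s, h | h⟩ <;> rcases Int.even_or_odd' b with ⟨t, h' | h'⟩
    · exact ⟨⟨s, h⟩, ⟨t, h'⟩⟩
    all_goals
      exfalso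
      rw [h, h'] at this
      ring_nf at this
      omega
  refine not_prime_dvd_coords Int.prime_two n ⟨hpar.1, hpar.2, ?_⟩
  rw [hc]; exact hpar.1.add hpar.2

/-- An integral point of the plane cubic comes from a multiple of `gen` whose last coordinate
is a unit. -/
lemma exists_multiple_of_integral {x y : ℤ} (hy : 0 < y) (hxy : y < x)
    (h : y * (y + 1) * (x + y) = x ^ 3 - x) :
    ∃ m : ℤ, m ≠ 0 ∧ m ≠ 1 ∧ m ≠ -1 ∧ coordZ m ^ 2 = 1 ∧ coordA m + coordB m = y * coordZ m := by
  have hx0 : (x : ℚ) ≠ 0 := by exact_mod_cast (by omega : x ≠ 0)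
  have hd0 : (x : ℚ) - y ≠ 0 := by exact_mod_cast (by omega : x - y ≠ 0)
  have hq : (y : ℚ) * (y + 1) * (x + y) = x ^ 3 - x := by exact_mod_cast h
  set ξ : ℚ := 2 * x / (x - y) with hξ
  set η : ℚ := (ξ ^ 2 - 4 * ξ + 2 + ξ ^ 2 / x) / 2 with hη
  have hon : On ξ η := by
    rw [On, hη, hξ]
    field_simp
    linear_combination 4 * (x : ℚ) * hq
  have hξ0 : ξ ≠ 0 := by positivity
  obtain ⟨m, hm⟩ := exists_zsmul_gen (pt ξ η hon)
  obtain ⟨hX, hY⟩ := mulX_eq_of_pt hm.symm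
  have m0 : m ≠ 0 := by
    rintro rfl
    rw [zero_zsmul] at hm
    exact pt_ne_zero hon hm
  have m1 : m ≠ 1 := by
    rintro rfl
    rw [mulX_one] at hX; exact hξ0 hX.symm
  have m2 : m ≠ -1 := by
    rintro rfl
    rw [mulX_neg, mulX_one] at hX; exact hξ0 hX.symm
  have R := divSeq_succ_mul_pred m0
  have R1 := divSeq_succ_mul_pred (n := m + 1) (by omega)
  rw [mulX_add_one m0 (hX ▸ hξ0), hX, hY] at R1
  rw [hX] at R
  rw [show m + 1 + 1 = m + 2 by ring, show m + 1 - 1 = m by ring] at R1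
  have he := epsQ m
  have hw : (W m : ℚ) ≠ 0 := by exact_mod_cast W_ne_zero m0
  have hp : (W (m + 1) : ℚ) ≠ 0 := by exact_mod_cast W_ne_zero (n := m + 1) (by omega)
  have he0 := eps_ne_zero m
  have hf0 := eps_ne_zero (m + 1)
  simp only [← cast_W] at R R1
  have hA : (coordA m : ℚ) = -ξ / 2 * coordB m := by
    unfold coordA coordB
    push_cast
    generalize (W (m + 1) : ℚ) = p at *
    generalize (W (m - 1) : ℚ) = q at *
    generalize (W m : ℚ) = w at *
    generalize (eps m : ℚ) = e at *
    generalize (eps (m + 1) : ℚ) = f at *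
    linear_combination f * p / 2 * R - q * p ^ 2 / 2 * he
  have hC : (coordC m : ℚ) = (1 - ξ - η) / ξ * coordB m := by
    unfold coordC coordB
    push_cast
    generalize (W (m + 1) : ℚ) = p at *
    generalize (W (m - 1) : ℚ) = q at *
    generalize (W (m + 2) : ℚ) = w2 at *
    generalize (W m : ℚ) = w at *
    generalize (eps m : ℚ) = e at *
    generalize (eps (m + 1) : ℚ) = f at *
    have : f * w2 * q * w = (-(2 * (1 - ξ - η) / ξ ^ 2) * p ^ 2) * q := by rw [← R1]; ring
    rw [this]
    have hpq : p * q = -ξ * w ^ 2 * f / 2 := by linear_combination f / 2 * R - p * q / 2 * he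
    calc _ = (-(2 * (1 - ξ - η) / ξ ^ 2) * p) * (p * q) := by ring
      _ = _ := by rw [hpq]; field_simp
  have hZ : (coordZ m : ℚ) = -ξ / (2 * x) * coordB m := by
    unfold coordZ
    push_cast
    rw [hA, hC, hη]
    field_simp
    ring
  have eA : coordA m = x * coordZ m := by
    have : (coordA m : ℚ) = x * coordZ m := by rw [hZ, hA]; field_simp
    exact_mod_cast this
  have eB : coordB m = (y - x) * coordZ m := by
    have : (coordB m : ℚ) = (y - x) * coordZ m := by rw [hZ, hξ]; field_simp; ring
    exact_mod_cast this
  have eC : coordC m = (y + 1) * coordZ m := by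
    have : coordC m = coordZ m + coordB m + coordA m := by unfold coordZ; ring
    rw [this, eA, eB]; ring
  refine ⟨m, m0, m1, m2, ?_, by rw [eA, eB]; ring⟩
  have hu := isUnit_of_dvd_coords (Dvd.intro_left _ eA.symm) (Dvd.intro_left _ eB.symm)
    (Dvd.intro_left _ eC.symm)
  rcases Int.isUnit_iff.1 hu with h | h <;> rw [h] <;> norm_num

end curve

namespace curve

/-- The relation between a point of the cubic model and two points differing from it by opposite
translations: the symmetric products of the latter are quadratic forms in the former. -/
def Neighbours (a b c a1 b1 c1 a2 b2 c2 t : ℤ) : Prop :=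
  8 * (a1 * a2) = t * (-2 * a * b - b ^ 2 + b * c - c ^ 2) ∧
  8 * (a1 * b2 + b1 * a2) = t * (4 * a * b + 2 * b ^ 2 + 2 * c ^ 2) ∧
  8 * (a1 * c2 + c1 * a2) = t * (4 * a * c + 2 * b ^ 2) ∧
  8 * (b1 * b2) = t * (4 * a * c) ∧
  8 * (b1 * c2 + c1 * b2) = t * (8 * a ^ 2 + 8 * a * b + 4 * b * c) ∧
  8 * (c1 * c2) = t * (4 * a * b - 4 * a * c)

lemma coord_neighbours (n : ℤ) : Neighbours (coordA n) (coordB n) (coordC n)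
    (coordA (n + 1)) (coordB (n + 1)) (coordC (n + 1))
    (coordA (n - 1)) (coordB (n - 1)) (coordC (n - 1)) (eps n ^ 3) := by
  have r2 := W_mul_two_apart n
  have r3 := W_add_two_apart n
  have s2 := W_mul_two_apart (n + 1)
  have s3 := W_add_two_apart (n + 1)
  unfold Neighbours coordA coordB coordC
  rw [show n + 1 + 1 = n + 2 by ring, show n + 1 - 1 = n by ring, show n - 1 - 1 = n - 2 by ring,
    show n - 1 + 1 = n by ring, show n - 1 + 2 = n + 1 by ring, eps_add_two]
  rw [show n + 1 + 1 = n + 2 by ring, show n + 1 - 1 = n by ring,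
    show n + 1 - 2 = n - 1 by ring] at s2
  rw [show n + 1 + 1 = n + 2 by ring, show n + 1 - 1 = n by ring,
    show n + 1 - 2 = n - 1 by ring, eps_add_two] at s3
  generalize W (n + 1 + 2) = w3 at *
  generalize W (n + 2) = w2 at *
  generalize W (n - 2) = v2 at *
  generalize W (n + 1) = p at *
  generalize W (n - 1) = q at *
  generalize W n = w at *
  rcases Int.emod_two_eq_zero_or_one n with ho | ho
  · rw [eps_even ho] at *; rw [eps_odd (by omega : (n + 1) % 2 = 1)] at *
    refine ⟨?_, ?_, ?_, ?_, ?_, ?_⟩ <;> grind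
  · rw [eps_odd ho] at *; rw [eps_even (by omega : (n + 1) % 2 = 0)] at *
    refine ⟨?_, ?_, ?_, ?_, ?_, ?_⟩ <;> grind
end curve

namespace curve

/-- Coefficient form number 0 of the addition formula for `coordZ`. -/
def coeffForm₀ (a b c : ℤ) : ℤ :=
  (c - b - a) ^ 2

/-- Coefficient form number 1 of the addition formula for `coordZ`. -/
def coeffForm₁ (a b c : ℤ) : ℤ :=
  - 10 * a ^ 2 - 8 * a * b - 2 * a * c - b ^ 2 + b * c - c ^ 2

/-- Coefficient form number 2 of the addition formula for `coordZ`. -/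
def coeffForm₂ (a b c : ℤ) : ℤ :=
  16 * a ^ 2 + 12 * a * b + 8 * a * c + 2 * b ^ 2 + 6 * b * c

/-- Coefficient form number 3 of the addition formula for `coordZ`. -/
def coeffForm₃ (a b c : ℤ) : ℤ :=
  - 8 * a ^ 2 - 2 * a * b - 4 * a * c - b ^ 2 - 3 * b * c + c ^ 2

lemma coeffForm_neighbours_zero {a b c a1 b1 c1 a2 b2 c2 t : ℤ}
    (h : Neighbours a b c a1 b1 c1 a2 b2 c2 t) :
    64 * (coeffForm₀ a1 b1 c1 * coeffForm₀ a2 b2 c2) =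
      t ^ 2 * (coeffForm₃ a b c ^ 2) := by
  obtain ⟨haa, hab, hac, hbb, hbc, hcc⟩ := h
  simp only [coeffForm₀, coeffForm₃]
  have : 64 * (((c1 - b1 - a1) ^ 2) * ((c2 - b2 - a2) ^ 2)) =
      (8 * (a1 * a2)) * (8 * (a1 * a2)) + 2 * (8 * (a1 * a2)) * (8 * (a1 * b2 + b1 * a2)) - 2 *
          (8 * (a1 * a2)) * (8 * (a1 * c2 + c1 * a2)) + 2 * (8 * (a1 * a2)) * (8 * (b1 * b2)) -
          2 * (8 * (a1 * a2)) * (8 * (b1 * c2 + c1 * b2)) + 2 * (8 * (a1 * a2)) * (8 * (c1 * c2))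
          + (8 * (a1 * b2 + b1 * a2)) * (8 * (a1 * b2 + b1 * a2)) - 2 * (8 * (a1 * b2 + b1 * a2))
          * (8 * (a1 * c2 + c1 * a2)) + 2 * (8 * (a1 * b2 + b1 * a2)) * (8 * (b1 * b2)) - 2 * (8 *
          (a1 * b2 + b1 * a2)) * (8 * (b1 * c2 + c1 * b2)) + 2 * (8 * (a1 * b2 + b1 * a2)) * (8 *
          (c1 * c2)) + (8 * (a1 * c2 + c1 * a2)) * (8 * (a1 * c2 + c1 * a2)) - 2 * (8 * (a1 * c2 +
          c1 * a2)) * (8 * (b1 * b2)) + 2 * (8 * (a1 * c2 + c1 * a2)) * (8 * (b1 * c2 + c1 * b2))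
          - 2 * (8 * (a1 * c2 + c1 * a2)) * (8 * (c1 * c2)) + (8 * (b1 * b2)) * (8 * (b1 * b2)) -
          2 * (8 * (b1 * b2)) * (8 * (b1 * c2 + c1 * b2)) + 2 * (8 * (b1 * b2)) * (8 * (c1 * c2))
          + (8 * (b1 * c2 + c1 * b2)) * (8 * (b1 * c2 + c1 * b2)) - 2 * (8 * (b1 * c2 + c1 * b2))
          * (8 * (c1 * c2)) + (8 * (c1 * c2)) * (8 * (c1 * c2)) := by
    ring
  rw [this, haa, hab, hac, hbb, hbc, hcc]
  ring

lemma coeffForm_neighbours_one {a b c a1 b1 c1 a2 b2 c2 t : ℤ}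
    (hcub : b ^ 2 * c + a * c ^ 2 + 2 * a ^ 2 * b + a * b ^ 2 + a * b * c = 0)
    (h : Neighbours a b c a1 b1 c1 a2 b2 c2 t) :
    64 * (coeffForm₀ a1 b1 c1 * coeffForm₁ a2 b2 c2 + coeffForm₁ a1 b1 c1 * coeffForm₀ a2 b2 c2) =
      t ^ 2 * (8 * coeffForm₁ a b c * coeffForm₃ a b c - 4 * coeffForm₂ a b c ^ 2 - 2 *
          coeffForm₂ a b c * coeffForm₃ a b c) := by
  obtain ⟨haa, hab, hac, hbb, hbc, hcc⟩ := h
  simp only [coeffForm₀, coeffForm₁, coeffForm₂, coeffForm₃]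
  have : 64 * (((c1 - b1 - a1) ^ 2) * (- 10 * a2 ^ 2 - 8 * a2 * b2 - 2 * a2 * c2 - b2 ^ 2 + b2 *
      c2 - c2 ^ 2) + (- 10 * a1 ^ 2 - 8 * a1 * b1 - 2 * a1 * c1 - b1 ^ 2 + b1 * c1 - c1 ^ 2) *
      ((c2 - b2 - a2) ^ 2)) =
       - 20 * (8 * (a1 * a2)) * (8 * (a1 * a2)) - 28 * (8 * (a1 * a2)) * (8 * (a1 * b2 + b1 * a2))
           + 18 * (8 * (a1 * a2)) * (8 * (a1 * c2 + c1 * a2)) - 10 * (8 * (a1 * a2)) * (8 * (b1 *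
           b2)) - 9 * (8 * (a1 * a2)) * (8 * (b1 * c2 + c1 * b2)) + 30 * (8 * (a1 * a2)) * (8 *
           (c1 * c2)) - 11 * (8 * (a1 * b2 + b1 * a2)) * (8 * (a1 * b2 + b1 * a2)) + 21 * (8 *
           (a1 * b2 + b1 * a2)) * (8 * (a1 * c2 + c1 * a2)) - 10 * (8 * (a1 * b2 + b1 * a2)) *
           (8 * (b1 * b2)) + 12 * (8 * (a1 * b2 + b1 * a2)) * (8 * (c1 * c2)) - 11 * (8 * (a1 *
           c2 + c1 * a2)) * (8 * (a1 * c2 + c1 * a2)) + 18 * (8 * (a1 * c2 + c1 * a2)) * (8 *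
           (b1 * b2)) - 10 * (8 * (a1 * c2 + c1 * a2)) * (8 * (b1 * c2 + c1 * b2)) - 2 * (8 *
           (b1 * b2)) * (8 * (b1 * b2)) + 3 * (8 * (b1 * b2)) * (8 * (b1 * c2 + c1 * b2)) - 2 *
           (8 * (b1 * c2 + c1 * b2)) * (8 * (b1 * c2 + c1 * b2)) + 3 * (8 * (b1 * c2 + c1 * b2)) *
           (8 * (c1 * c2)) - 2 * (8 * (c1 * c2)) * (8 * (c1 * c2)) := by
    ring
  rw [this, haa, hab, hac, hbb, hbc, hcc]
  linear_combination t ^ 2 * (296 * a + 32 * b + 80 * c) * hcub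

lemma coeffForm_neighbours_two {a b c a1 b1 c1 a2 b2 c2 t : ℤ}
    (hcub : b ^ 2 * c + a * c ^ 2 + 2 * a ^ 2 * b + a * b ^ 2 + a * b * c = 0)
    (h : Neighbours a b c a1 b1 c1 a2 b2 c2 t) :
    64 * (coeffForm₀ a1 b1 c1 * coeffForm₂ a2 b2 c2 + coeffForm₁ a1 b1 c1 * coeffForm₁ a2 b2 c2 +
        coeffForm₂ a1 b1 c1 * coeffForm₀ a2 b2 c2) =
      t ^ 2 * (- 32 * coeffForm₀ a b c * coeffForm₂ a b c - 24 * coeffForm₀ a b c *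
          coeffForm₃ a b c + 16 * coeffForm₁ a b c ^ 2 + 8 * coeffForm₁ a b c * coeffForm₂ a b c -
          4 * coeffForm₁ a b c * coeffForm₃ a b c + 4 * coeffForm₂ a b c ^ 2 + 4 *
          coeffForm₂ a b c * coeffForm₃ a b c) := by
  obtain ⟨haa, hab, hac, hbb, hbc, hcc⟩ := h
  simp only [coeffForm₀, coeffForm₁, coeffForm₂, coeffForm₃]
  have : 64 * (((c1 - b1 - a1) ^ 2) * (16 * a2 ^ 2 + 12 * a2 * b2 + 8 * a2 * c2 + 2 * b2 ^ 2 + 6 *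
      b2 * c2) + (- 10 * a1 ^ 2 - 8 * a1 * b1 - 2 * a1 * c1 - b1 ^ 2 + b1 * c1 - c1 ^ 2) * (- 10 *
      a2 ^ 2 - 8 * a2 * b2 - 2 * a2 * c2 - b2 ^ 2 + b2 * c2 - c2 ^ 2) + (16 * a1 ^ 2 + 12 * a1 *
      b1 + 8 * a1 * c1 + 2 * b1 ^ 2 + 6 * b1 * c1) * ((c2 - b2 - a2) ^ 2)) =
      132 * (8 * (a1 * a2)) * (8 * (a1 * a2)) + 124 * (8 * (a1 * a2)) * (8 * (a1 * b2 + b1 * a2))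
          - 4 * (8 * (a1 * a2)) * (8 * (a1 * c2 + c1 * a2)) + 56 * (8 * (a1 * a2)) * (8 * (b1 *
          b2)) + 44 * (8 * (a1 * a2)) * (8 * (b1 * c2 + c1 * b2)) - 80 * (8 * (a1 * a2)) * (8 *
          (c1 * c2)) + 28 * (8 * (a1 * b2 + b1 * a2)) * (8 * (a1 * b2 + b1 * a2)) - 36 * (8 *
          (a1 * b2 + b1 * a2)) * (8 * (a1 * c2 + c1 * a2)) + 24 * (8 * (a1 * b2 + b1 * a2)) * (8 *
          (b1 * b2)) + 6 * (8 * (a1 * b2 + b1 * a2)) * (8 * (b1 * c2 + c1 * b2)) - 50 * (8 * (a1 *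
          b2 + b1 * a2)) * (8 * (c1 * c2)) + 26 * (8 * (a1 * c2 + c1 * a2)) * (8 * (a1 * c2 + c1 *
          a2)) - 26 * (8 * (a1 * c2 + c1 * a2)) * (8 * (b1 * b2)) + 20 * (8 * (a1 * c2 + c1 * a2))
          * (8 * (b1 * c2 + c1 * b2)) + 10 * (8 * (a1 * c2 + c1 * a2)) * (8 * (c1 * c2)) + 5 *
          (8 * (b1 * b2)) * (8 * (b1 * b2)) + (8 * (b1 * b2)) * (8 * (b1 * c2 + c1 * b2)) - 29 *
          (8 * (b1 * b2)) * (8 * (c1 * c2)) + 3 * (8 * (b1 * c2 + c1 * b2)) * (8 * (b1 * c2 + c1 *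
          b2)) + 5 * (8 * (b1 * c2 + c1 * b2)) * (8 * (c1 * c2)) + (8 * (c1 * c2)) * (8 * (c1 *
          c2)) := by
    ring
  rw [this, haa, hab, hac, hbb, hbc, hcc]
  linear_combination t ^ 2 * (- 128 * a + 72 * b - 136 * c) * hcub

lemma coeffForm_neighbours_three {a b c a1 b1 c1 a2 b2 c2 t : ℤ}
    (hcub : b ^ 2 * c + a * c ^ 2 + 2 * a ^ 2 * b + a * b ^ 2 + a * b * c = 0)
    (h : Neighbours a b c a1 b1 c1 a2 b2 c2 t) :
    64 * (coeffForm₀ a1 b1 c1 * coeffForm₃ a2 b2 c2 + coeffForm₁ a1 b1 c1 * coeffForm₂ a2 b2 c2 +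
        coeffForm₂ a1 b1 c1 * coeffForm₁ a2 b2 c2 + coeffForm₃ a1 b1 c1 * coeffForm₀ a2 b2 c2) =
      t ^ 2 * (- 64 * coeffForm₀ a b c ^ 2 - 32 * coeffForm₀ a b c * coeffForm₁ a b c + 48 *
          coeffForm₀ a b c * coeffForm₂ a b c + 64 * coeffForm₀ a b c * coeffForm₃ a b c - 32 *
          coeffForm₁ a b c ^ 2 - 24 * coeffForm₁ a b c * coeffForm₂ a b c - 16 *
          coeffForm₁ a b c * coeffForm₃ a b c) := by
  obtain ⟨haa, hab, hac, hbb, hbc, hcc⟩ := h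
  simp only [coeffForm₀, coeffForm₁, coeffForm₂, coeffForm₃]
  have : 64 * (((c1 - b1 - a1) ^ 2) * (- 8 * a2 ^ 2 - 2 * a2 * b2 - 4 * a2 * c2 - b2 ^ 2 - 3 *
      b2 * c2 + c2 ^ 2) + (- 10 * a1 ^ 2 - 8 * a1 * b1 - 2 * a1 * c1 - b1 ^ 2 + b1 * c1 - c1 ^ 2)
      * (16 * a2 ^ 2 + 12 * a2 * b2 + 8 * a2 * c2 + 2 * b2 ^ 2 + 6 * b2 * c2) + (16 * a1 ^ 2 +
      12 * a1 * b1 + 8 * a1 * c1 + 2 * b1 ^ 2 + 6 * b1 * c1) * (- 10 * a2 ^ 2 - 8 * a2 * b2 - 2 *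
      a2 * c2 - b2 ^ 2 + b2 * c2 - c2 ^ 2) + (- 8 * a1 ^ 2 - 2 * a1 * b1 - 4 * a1 * c1 - b1 ^ 2 -
      3 * b1 * c1 + c1 ^ 2) * ((c2 - b2 - a2) ^ 2)) =
       - 336 * (8 * (a1 * a2)) * (8 * (a1 * a2)) - 266 * (8 * (a1 * a2)) * (8 * (a1 * b2 + b1 *
           a2)) - 100 * (8 * (a1 * a2)) * (8 * (a1 * c2 + c1 * a2)) - 110 * (8 * (a1 * a2)) * (8 *
           (b1 * b2)) - 61 * (8 * (a1 * a2)) * (8 * (b1 * c2 + c1 * b2)) + 30 * (8 * (a1 * a2)) *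
           (8 * (c1 * c2)) - 45 * (8 * (a1 * b2 + b1 * a2)) * (8 * (a1 * b2 + b1 * a2)) - 31 *
           (8 * (a1 * b2 + b1 * a2)) * (8 * (a1 * c2 + c1 * a2)) - 32 * (8 * (a1 * b2 + b1 * a2))
           * (8 * (b1 * b2)) - 14 * (8 * (a1 * b2 + b1 * a2)) * (8 * (b1 * c2 + c1 * b2)) + 22 *
           (8 * (a1 * b2 + b1 * a2)) * (8 * (c1 * c2)) - 23 * (8 * (a1 * c2 + c1 * a2)) * (8 *
           (a1 * c2 + c1 * a2)) - 24 * (8 * (a1 * c2 + c1 * a2)) * (8 * (b1 * b2)) - 12 * (8 *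
           (a1 * c2 + c1 * a2)) * (8 * (b1 * c2 + c1 * b2)) - 14 * (8 * (a1 * c2 + c1 * a2)) *
           (8 * (c1 * c2)) - 6 * (8 * (b1 * b2)) * (8 * (b1 * b2)) - 5 * (8 * (b1 * b2)) * (8 *
           (b1 * c2 + c1 * b2)) + 28 * (8 * (b1 * b2)) * (8 * (c1 * c2)) - 2 * (8 * (b1 * c2 +
           c1 * b2)) * (8 * (b1 * c2 + c1 * b2)) - 11 * (8 * (b1 * c2 + c1 * b2)) * (8 * (c1 *
           c2)) + 2 * (8 * (c1 * c2)) * (8 * (c1 * c2)) := by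
    ring
  rw [this, haa, hab, hac, hbb, hbc, hcc]
  linear_combination t ^ 2 * (- 584 * a - 344 * b - 8 * c) * hcub

lemma coeffForm_neighbours_four {a b c a1 b1 c1 a2 b2 c2 t : ℤ}
    (hcub : b ^ 2 * c + a * c ^ 2 + 2 * a ^ 2 * b + a * b ^ 2 + a * b * c = 0)
    (h : Neighbours a b c a1 b1 c1 a2 b2 c2 t) :
    64 * (coeffForm₁ a1 b1 c1 * coeffForm₃ a2 b2 c2 + coeffForm₂ a1 b1 c1 * coeffForm₂ a2 b2 c2 +
        coeffForm₃ a1 b1 c1 * coeffForm₁ a2 b2 c2) =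
      t ^ 2 * (192 * coeffForm₀ a b c ^ 2 + 128 * coeffForm₀ a b c * coeffForm₁ a b c + 48 *
          coeffForm₀ a b c * coeffForm₂ a b c + 16 * coeffForm₁ a b c ^ 2 + 16 *
          coeffForm₁ a b c * coeffForm₂ a b c + 16 * coeffForm₁ a b c * coeffForm₃ a b c) := by
  obtain ⟨haa, hab, hac, hbb, hbc, hcc⟩ := h
  simp only [coeffForm₀, coeffForm₁, coeffForm₂, coeffForm₃]
  have : 64 * ((- 10 * a1 ^ 2 - 8 * a1 * b1 - 2 * a1 * c1 - b1 ^ 2 + b1 * c1 - c1 ^ 2) * (- 8 *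
      a2 ^ 2 - 2 * a2 * b2 - 4 * a2 * c2 - b2 ^ 2 - 3 * b2 * c2 + c2 ^ 2) + (16 * a1 ^ 2 + 12 *
      a1 * b1 + 8 * a1 * c1 + 2 * b1 ^ 2 + 6 * b1 * c1) * (16 * a2 ^ 2 + 12 * a2 * b2 + 8 * a2 *
      c2 + 2 * b2 ^ 2 + 6 * b2 * c2) + (- 8 * a1 ^ 2 - 2 * a1 * b1 - 4 * a1 * c1 - b1 ^ 2 - 3 *
      b1 * c1 + c1 ^ 2) * (- 10 * a2 ^ 2 - 8 * a2 * b2 - 2 * a2 * c2 - b2 ^ 2 + b2 * c2 - c2 ^ 2)) =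
      416 * (8 * (a1 * a2)) * (8 * (a1 * a2)) + 276 * (8 * (a1 * a2)) * (8 * (a1 * b2 + b1 * a2))
          + 184 * (8 * (a1 * a2)) * (8 * (a1 * c2 + c1 * a2)) + 76 * (8 * (a1 * a2)) * (8 * (b1 *
          b2)) + 14 * (8 * (a1 * a2)) * (8 * (b1 * c2 + c1 * b2)) + 84 * (8 * (a1 * a2)) * (8 *
          (c1 * c2)) + 50 * (8 * (a1 * b2 + b1 * a2)) * (8 * (a1 * b2 + b1 * a2)) + 118 * (8 *
          (a1 * b2 + b1 * a2)) * (8 * (a1 * c2 + c1 * a2)) + 34 * (8 * (a1 * b2 + b1 * a2)) * (8 *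
          (b1 * b2)) + 22 * (8 * (a1 * b2 + b1 * a2)) * (8 * (b1 * c2 + c1 * b2)) + 56 * (8 *
          (a1 * b2 + b1 * a2)) * (8 * (c1 * c2)) - 2 * (8 * (a1 * c2 + c1 * a2)) * (8 * (a1 * c2 +
          c1 * a2)) + 72 * (8 * (a1 * c2 + c1 * a2)) * (8 * (b1 * b2)) - 6 * (8 * (a1 * c2 + c1 *
          a2)) * (8 * (b1 * c2 + c1 * b2)) + 2 * (8 * (a1 * c2 + c1 * a2)) * (8 * (c1 * c2)) + 6 *
          (8 * (b1 * b2)) * (8 * (b1 * b2)) + 14 * (8 * (b1 * b2)) * (8 * (b1 * c2 + c1 * b2)) +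
          30 * (8 * (b1 * b2)) * (8 * (c1 * c2)) + 4 * (8 * (b1 * c2 + c1 * b2)) * (8 * (c1 * c2))
          - 2 * (8 * (c1 * c2)) * (8 * (c1 * c2)) := by
    ring
  rw [this, haa, hab, hac, hbb, hbc, hcc]
  linear_combination t ^ 2 * (688 * a + 512 * b + 480 * c) * hcub

lemma coeffForm_neighbours_five {a b c a1 b1 c1 a2 b2 c2 t : ℤ}
    (hcub : b ^ 2 * c + a * c ^ 2 + 2 * a ^ 2 * b + a * b ^ 2 + a * b * c = 0)
    (h : Neighbours a b c a1 b1 c1 a2 b2 c2 t) :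
    64 * (coeffForm₂ a1 b1 c1 * coeffForm₃ a2 b2 c2 + coeffForm₃ a1 b1 c1 * coeffForm₂ a2 b2 c2) =
      t ^ 2 * (- 192 * coeffForm₀ a b c ^ 2 - 160 * coeffForm₀ a b c * coeffForm₁ a b c - 128 *
          coeffForm₀ a b c * coeffForm₂ a b c - 96 * coeffForm₀ a b c * coeffForm₃ a b c) := by
  obtain ⟨haa, hab, hac, hbb, hbc, hcc⟩ := h
  simp only [coeffForm₀, coeffForm₁, coeffForm₂, coeffForm₃]
  have : 64 * ((16 * a1 ^ 2 + 12 * a1 * b1 + 8 * a1 * c1 + 2 * b1 ^ 2 + 6 * b1 * c1) * (- 8 *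
      a2 ^ 2 - 2 * a2 * b2 - 4 * a2 * c2 - b2 ^ 2 - 3 * b2 * c2 + c2 ^ 2) + (- 8 * a1 ^ 2 - 2 *
      a1 * b1 - 4 * a1 * c1 - b1 ^ 2 - 3 * b1 * c1 + c1 ^ 2) * (16 * a2 ^ 2 + 12 * a2 * b2 + 8 *
      a2 * c2 + 2 * b2 ^ 2 + 6 * b2 * c2)) =
       - 256 * (8 * (a1 * a2)) * (8 * (a1 * a2)) - 128 * (8 * (a1 * a2)) * (8 * (a1 * b2 + b1 *
           a2)) - 128 * (8 * (a1 * a2)) * (8 * (a1 * c2 + c1 * a2)) + 16 * (8 * (a1 * a2)) * (8 *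
           (b1 * b2)) + 32 * (8 * (a1 * a2)) * (8 * (b1 * c2 + c1 * b2)) - 96 * (8 * (a1 * a2)) *
           (8 * (c1 * c2)) - 32 * (8 * (a1 * b2 + b1 * a2)) * (8 * (a1 * b2 + b1 * a2)) - 96 *
           (8 * (a1 * b2 + b1 * a2)) * (8 * (a1 * c2 + c1 * a2)) - 16 * (8 * (a1 * b2 + b1 * a2))
           * (8 * (b1 * b2)) - 16 * (8 * (a1 * b2 + b1 * a2)) * (8 * (b1 * c2 + c1 * b2)) - 60 *
           (8 * (a1 * b2 + b1 * a2)) * (8 * (c1 * c2)) + 16 * (8 * (a1 * c2 + c1 * a2)) * (8 *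
           (a1 * c2 + c1 * a2)) - 32 * (8 * (a1 * c2 + c1 * a2)) * (8 * (b1 * b2)) + 12 * (8 *
           (a1 * c2 + c1 * a2)) * (8 * (b1 * c2 + c1 * b2)) + 8 * (8 * (a1 * c2 + c1 * a2)) * (8 *
           (c1 * c2)) - 4 * (8 * (b1 * b2)) * (8 * (b1 * b2)) - 12 * (8 * (b1 * b2)) * (8 * (b1 *
           c2 + c1 * b2)) - 40 * (8 * (b1 * b2)) * (8 * (c1 * c2)) + 2 * (8 * (b1 * c2 + c1 * b2))
           * (8 * (b1 * c2 + c1 * b2)) + 6 * (8 * (b1 * c2 + c1 * b2)) * (8 * (c1 * c2)) := by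
    ring
  rw [this, haa, hab, hac, hbb, hbc, hcc]
  linear_combination t ^ 2 * (- 192 * a - 288 * b - 672 * c) * hcub

lemma coeffForm_neighbours_six {a b c a1 b1 c1 a2 b2 c2 t : ℤ}
    (hcub : b ^ 2 * c + a * c ^ 2 + 2 * a ^ 2 * b + a * b ^ 2 + a * b * c = 0)
    (h : Neighbours a b c a1 b1 c1 a2 b2 c2 t) :
    64 * (coeffForm₃ a1 b1 c1 * coeffForm₃ a2 b2 c2) =
      t ^ 2 * (64 * coeffForm₀ a b c ^ 2 + 64 * coeffForm₀ a b c * coeffForm₁ a b c + 64 *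
          coeffForm₀ a b c * coeffForm₂ a b c + 64 * coeffForm₀ a b c * coeffForm₃ a b c) := by
  obtain ⟨haa, hab, hac, hbb, hbc, hcc⟩ := h
  simp only [coeffForm₀, coeffForm₁, coeffForm₂, coeffForm₃]
  have : 64 * ((- 8 * a1 ^ 2 - 2 * a1 * b1 - 4 * a1 * c1 - b1 ^ 2 - 3 * b1 * c1 + c1 ^ 2) * (- 8 *
      a2 ^ 2 - 2 * a2 * b2 - 4 * a2 * c2 - b2 ^ 2 - 3 * b2 * c2 + c2 ^ 2)) =
      64 * (8 * (a1 * a2)) * (8 * (a1 * a2)) + 16 * (8 * (a1 * a2)) * (8 * (a1 * b2 + b1 * a2)) +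
          32 * (8 * (a1 * a2)) * (8 * (a1 * c2 + c1 * a2)) - 12 * (8 * (a1 * a2)) * (8 * (b1 *
          b2)) - 16 * (8 * (a1 * a2)) * (8 * (b1 * c2 + c1 * b2)) + 32 * (8 * (a1 * a2)) * (8 *
          (c1 * c2)) + 8 * (8 * (a1 * b2 + b1 * a2)) * (8 * (a1 * b2 + b1 * a2)) + 24 * (8 * (a1 *
          b2 + b1 * a2)) * (8 * (a1 * c2 + c1 * a2)) + 2 * (8 * (a1 * b2 + b1 * a2)) * (8 * (b1 *
          b2)) + 4 * (8 * (a1 * b2 + b1 * a2)) * (8 * (b1 * c2 + c1 * b2)) + 14 * (8 * (a1 * b2 +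
          b1 * a2)) * (8 * (c1 * c2)) - 8 * (8 * (a1 * c2 + c1 * a2)) * (8 * (a1 * c2 + c1 * a2))
          + 2 * (8 * (a1 * c2 + c1 * a2)) * (8 * (b1 * b2)) - 2 * (8 * (a1 * c2 + c1 * a2)) * (8 *
          (b1 * c2 + c1 * b2)) - 4 * (8 * (a1 * c2 + c1 * a2)) * (8 * (c1 * c2)) + (8 * (b1 * b2))
          * (8 * (b1 * b2)) + 3 * (8 * (b1 * b2)) * (8 * (b1 * c2 + c1 * b2)) + 11 * (8 * (b1 *
          b2)) * (8 * (c1 * c2)) - (8 * (b1 * c2 + c1 * b2)) * (8 * (b1 * c2 + c1 * b2)) - 3 *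
          (8 * (b1 * c2 + c1 * b2)) * (8 * (c1 * c2)) + (8 * (c1 * c2)) * (8 * (c1 * c2)) := by
    ring
  rw [this, haa, hab, hac, hbb, hbc, hcc]
  linear_combination t ^ 2 * (16 * a + 48 * b + 272 * c) * hcub

end curve

namespace curve

/-- The product of two values of a binary cubic form at the neighbours of `(A, E)`. -/
def cubicResultant (g0 g1 g2 g3 A E : ℤ) : ℤ :=
  A ^ 6 * g3 ^ 2 + 8 * A ^ 5 * E * g1 * g3 - 4 * A ^ 5 * E * g2 ^ 2 - 2 * A ^ 5 * E * g2 * g3 -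
      32 * A ^ 4 * E ^ 2 * g0 * g2 - 24 * A ^ 4 * E ^ 2 * g0 * g3 + 16 * A ^ 4 * E ^ 2 * g1 ^ 2 +
      8 * A ^ 4 * E ^ 2 * g1 * g2 - 4 * A ^ 4 * E ^ 2 * g1 * g3 + 4 * A ^ 4 * E ^ 2 * g2 ^ 2 + 4 *
      A ^ 4 * E ^ 2 * g2 * g3 - 64 * A ^ 3 * E ^ 3 * g0 ^ 2 - 32 * A ^ 3 * E ^ 3 * g0 * g1 + 48 *
      A ^ 3 * E ^ 3 * g0 * g2 + 64 * A ^ 3 * E ^ 3 * g0 * g3 - 32 * A ^ 3 * E ^ 3 * g1 ^ 2 - 24 *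
      A ^ 3 * E ^ 3 * g1 * g2 - 16 * A ^ 3 * E ^ 3 * g1 * g3 + 192 * A ^ 2 * E ^ 4 * g0 ^ 2 +
      128 * A ^ 2 * E ^ 4 * g0 * g1 + 48 * A ^ 2 * E ^ 4 * g0 * g2 + 16 * A ^ 2 * E ^ 4 * g1 ^ 2 +
      16 * A ^ 2 * E ^ 4 * g1 * g2 + 16 * A ^ 2 * E ^ 4 * g1 * g3 - 192 * A * E ^ 5 * g0 ^ 2 -
      160 * A * E ^ 5 * g0 * g1 - 128 * A * E ^ 5 * g0 * g2 - 96 * A * E ^ 5 * g0 * g3 + 64 *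
      E ^ 6 * g0 ^ 2 + 64 * E ^ 6 * g0 * g1 + 64 * E ^ 6 * g0 * g2 + 64 * E ^ 6 * g0 * g3

lemma cubic_neighbours_mul {g0 g1 g2 g3 A E A1 E1 A2 E2 f : ℤ}
    (hEE : 4 * (E1 * E2) = f ^ 2 * A ^ 2)
    (hAE : 2 * (A1 * E2 + A2 * E1) = f ^ 2 * (2 * E ^ 2 - A * E))
    (hAA : A1 * A2 = f ^ 2 * (E ^ 2 - A * E)) :
    64 * ((A1 ^ 3 * g0 + A1 ^ 2 * E1 * g1 + A1 * E1 ^ 2 * g2 + E1 ^ 3 * g3) *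
      (A2 ^ 3 * g0 + A2 ^ 2 * E2 * g1 + A2 * E2 ^ 2 * g2 + E2 ^ 3 * g3)) =
    f ^ 6 * cubicResultant g0 g1 g2 g3 A E := by
  have h : ∀ P Q R : ℤ, P = A1 * A2 → Q = 2 * (A1 * E2 + A2 * E1) → R = 4 * (E1 * E2) →
      64 * ((A1 ^ 3 * g0 + A1 ^ 2 * E1 * g1 + A1 * E1 ^ 2 * g2 + E1 ^ 3 * g3) *
      (A2 ^ 3 * g0 + A2 ^ 2 * E2 * g1 + A2 * E2 ^ 2 * g2 + E2 ^ 3 * g3)) =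
      64 * g0 ^ 2 * P ^ 3 + 32 * g0 * g1 * P ^ 2 * Q + 16 * g0 * g2 * P * (Q ^ 2 - 2 * P * R) +
      8 * g0 * g3 * (Q ^ 3 - 3 * P * Q * R) + 16 * g1 ^ 2 * P ^ 2 * R + 8 * g1 * g2 * P * Q * R +
      4 * g1 * g3 * R * (Q ^ 2 - 2 * P * R) + 4 * g2 ^ 2 * P * R ^ 2 + 2 * g2 * g3 * Q * R ^ 2 +
      g3 ^ 2 * R ^ 3 := by
    rintro P Q R rfl rfl rfl; ring
  rw [h _ _ _ hAA.symm hAE.symm hEE.symm, cubicResultant]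
  ring

/-- The cubic form in `(A, E)` of the addition formula for `coordZ`. -/
def cubicForm (a b c A E : ℤ) : ℤ := A ^ 3 * coeffForm₀ a b c + A ^ 2 * E * coeffForm₁ a b c +
  A * E ^ 2 * coeffForm₂ a b c + E ^ 3 * coeffForm₃ a b c

lemma cubicForm_neighbours_mul {a b c a1 b1 c1 a2 b2 c2 t : ℤ}
    (hcub : b ^ 2 * c + a * c ^ 2 + 2 * a ^ 2 * b + a * b ^ 2 + a * b * c = 0)
    (h : Neighbours a b c a1 b1 c1 a2 b2 c2 t) (A E : ℤ) :
    64 * (cubicForm a1 b1 c1 A E * cubicForm a2 b2 c2 A E) = t ^ 2 *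
      cubicResultant (coeffForm₀ a b c) (coeffForm₁ a b c) (coeffForm₂ a b c) (coeffForm₃ a b c)
        A E := by
  unfold cubicForm cubicResultant
  linear_combination A ^ 6 * coeffForm_neighbours_zero h +
    A ^ 5 * E * coeffForm_neighbours_one hcub h +
    A ^ 4 * E ^ 2 * coeffForm_neighbours_two hcub h +
    A ^ 3 * E ^ 3 * coeffForm_neighbours_three hcub h +
    A ^ 2 * E ^ 4 * coeffForm_neighbours_four hcub h +
    A * E ^ 5 * coeffForm_neighbours_five hcub h +
    E ^ 6 * coeffForm_neighbours_six hcub h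

/-- Numerator of the abscissa of the `n`-th multiple. -/
noncomputable def numX (n : ℤ) : ℤ := -(eps n * W (n + 1) * W (n - 1))

lemma denX_neighbours (n : ℤ) : 4 * (W (n + 1) ^ 2 * W (n - 1) ^ 2) =
    eps (n + 1) ^ 2 * numX n ^ 2 := by
  unfold numX
  linear_combination (-(W (n + 1) * W (n - 1)) ^ 2) * (eps n * eps (n + 1) + 2) *
    eps_mul_eps_add_one n

lemma numX_neighbours_add (n : ℤ) :
    2 * (numX (n + 1) * W (n - 1) ^ 2 + numX (n - 1) * W (n + 1) ^ 2) =
      eps (n + 1) ^ 2 * (2 * (W n ^ 2) ^ 2 - numX n * W n ^ 2) := by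
  unfold numX
  have he := eps_mul_eps_add_one n
  have r3 := W_add_two_apart n
  rw [eps_sub_one, show n + 1 + 1 = n + 2 by ring, show n + 1 - 1 = n by ring,
    show n - 1 + 1 = n by ring, show n - 1 - 1 = n - 2 by ring]
  linear_combination (-2 * eps (n + 1) * W n) * r3 -
    eps (n + 1) * W (n + 1) * W (n - 1) * W n ^ 2 * he

lemma numX_neighbours_mul (n : ℤ) : numX (n + 1) * numX (n - 1) =
    eps (n + 1) ^ 2 * ((W n ^ 2) ^ 2 - numX n * W n ^ 2) := by
  unfold numX
  have r2 := W_mul_two_apart n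
  rw [eps_sub_one, show n + 1 + 1 = n + 2 by ring, show n + 1 - 1 = n by ring,
    show n - 1 + 1 = n by ring, show n - 1 - 1 = n - 2 by ring]
  linear_combination (eps (n + 1) ^ 2 * W n ^ 2) * r2

/-- The constant of the addition formula for `coordZ`. -/
def cubicFactor (m n : ℤ) : ℤ := if m % 2 = 0 ∧ n % 2 = 1 then 8 else 1

lemma cubicFactor_pos (m n : ℤ) : 0 < cubicFactor m n := by
  unfold cubicFactor; split_ifs <;> norm_num

lemma cubicFactor_step (m n : ℤ) :
    64 * (cubicFactor m (n + 1) * cubicFactor m (n - 1)) =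
      eps (n + 1) ^ 6 * eps (m + 1) ^ 6 * (cubicFactor (m + 1) n * cubicFactor (m - 1) n) := by
  unfold cubicFactor eps
  rcases Int.emod_two_eq_zero_or_one n with h | h <;>
  rcases Int.emod_two_eq_zero_or_one m with h' | h' <;>
  simp [h, h', show (n + 1) % 2 = 1 - n % 2 by omega, show (n - 1) % 2 = 1 - n % 2 by omega,
    show (m + 1) % 2 = 1 - m % 2 by omega, show (m - 1) % 2 = 1 - m % 2 by omega]

/-- The cubic form of the addition formula for `coordZ`. -/
noncomputable def addCubic (m n : ℤ) : ℤ :=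
  cubicForm (coordA m) (coordB m) (coordC m) (numX n) (W n ^ 2)

lemma addCubic_step (m n : ℤ) : 64 * (addCubic m (n + 1) * addCubic m (n - 1)) =
    eps (n + 1) ^ 6 * eps (m + 1) ^ 6 * (addCubic (m + 1) n * addCubic (m - 1) n) := by
  have h1 := cubicForm_neighbours_mul (coord_cubic m) (coord_neighbours m) (numX n) (W n ^ 2)
  have h2 := cubic_neighbours_mul (g0 := coeffForm₀ (coordA m) (coordB m) (coordC m))
    (g1 := coeffForm₁ (coordA m) (coordB m) (coordC m))
    (g2 := coeffForm₂ (coordA m) (coordB m) (coordC m))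
    (g3 := coeffForm₃ (coordA m) (coordB m) (coordC m))
    (denX_neighbours n) (numX_neighbours_add n) (numX_neighbours_mul n)
  have he : (eps m * eps (m + 1)) ^ 6 = 64 := by rw [eps_mul_eps_add_one]; norm_num
  unfold addCubic
  unfold cubicForm at h1 ⊢
  rw [h2]
  refine mul_left_cancel₀ (show (64 : ℤ) ≠ 0 by norm_num) ?_
  generalize cubicResultant _ _ _ _ _ _ = r at *
  linear_combination (-eps (n + 1) ^ 6 * eps (m + 1) ^ 6) * h1 - eps (n + 1) ^ 6 * r * he

lemma addCubic_eq : ∀ (n : ℕ) (m : ℤ),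
    addCubic m n = cubicFactor m n * (coordZ (m + n) * coordZ (m - n))
  | 0, m => by
    simp [addCubic, cubicForm, numX, cubicFactor, eps, W_zero, W_one, W_neg, coeffForm₀, coordZ]
    ring
  | 1, m => by
    have h := coord_neighbours m
    unfold Neighbours at h
    obtain ⟨haa, hab, hac, hbb, hbc, hcc⟩ := h
    have : cubicFactor m 1 * eps m ^ 3 = 8 := by
      unfold cubicFactor eps
      rcases Int.emod_two_eq_zero_or_one m with h | h <;> norm_num [h]
    simp [addCubic, cubicForm, numX, W_one, W_zero, coeffForm₃, coordZ]
    refine mul_left_cancel₀ (show (8 : ℤ) ≠ 0 by norm_num) ?_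
    generalize coordA m = a at *
    generalize coordB m = b at *
    generalize coordC m = c at *
    linear_combination (-cubicFactor m 1) * (haa + hab - hac + hbb - hbc + hcc) -
      (- 8 * a ^ 2 - 2 * a * b - 4 * a * c - b ^ 2 - 3 * b * c + c ^ 2) * this
  | (n + 2), m => by
    have ih := addCubic_eq n
    have ih1 := addCubic_eq (n + 1)
    have st := addCubic_step m (n + 1)
    have sp := cubicFactor_step m (n + 1)
    push_cast at ih1 ⊢
    rw [add_sub_cancel_right, add_assoc (n : ℤ) 1 1, one_add_one_eq_two] at st sp
    rw [ih m, ih1, ih1] at st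
    have hne : 64 * (cubicFactor m n * (coordZ (m + n) * coordZ (m - n))) ≠ 0 :=
      mul_ne_zero (by norm_num) (mul_ne_zero (cubicFactor_pos _ _).ne'
        (mul_ne_zero (coordZ_ne_zero _) (coordZ_ne_zero _)))
    refine mul_left_cancel₀ hne ?_
    rw [show m + 1 + (n + 1 : ℤ) = m + (n + 2) by ring, show m + 1 - (n + 1 : ℤ) = m - n by ring,
      show m - 1 + (n + 1 : ℤ) = m + n by ring,
      show m - 1 - (n + 1 : ℤ) = m - (n + 2) by ring] at st
    generalize addCubic m (n + 2) = X at *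
    linear_combination st - (coordZ (m + n) * coordZ (m - n) * coordZ (m + (n + 2)) *
      coordZ (m - (n + 2))) * sp

end curve

namespace curve

lemma coordZ_mul_modEq {M : ℕ} (hM : M % 2 = 0) (S : ℤ) :
    coordZ (S + M) * coordZ (S - M) ≡ numX M ^ 3 * coordZ S ^ 2 [ZMOD W M ^ 2] := by
  have h := addCubic_eq M S
  have h1 : cubicFactor S M = 1 := by unfold cubicFactor; rw [if_neg]; omega
  rw [h1, one_mul] at h
  rw [← h, Int.modEq_iff_dvd]
  unfold addCubic cubicForm coeffForm₀ coordZ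
  set a := coordA S
  set b := coordB S
  set c := coordC S
  exact ⟨-(numX M ^ 2 * coeffForm₁ a b c + numX M * W M ^ 2 * coeffForm₂ a b c +
    (W M ^ 2) ^ 2 * coeffForm₃ a b c), by ring⟩

lemma sq_coordZ_mul_modEq {M : ℕ} {N : ℤ} (hM : M % 2 = 0) (hN : N ∣ W M ^ 2) (S : ℤ) :
    coordZ (S + M) ^ 2 * coordZ (S - M) ^ 2 ≡ numX M ^ 6 * (coordZ S ^ 2) ^ 2 [ZMOD N] := by
  have h := ((coordZ_mul_modEq hM S).of_dvd hN).pow 2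
  convert h using 1 <;> ring

lemma _root_.Int.ModEq.isCoprime {x y N : ℤ} (h : x ≡ y [ZMOD N]) (hx : IsCoprime x N) :
    IsCoprime y N := by
  obtain ⟨c, hc⟩ := Int.modEq_iff_dvd.1 h
  rw [show y = x + N * c by linarith]
  exact hx.add_mul_left_left c

lemma _root_.Int.ModEq.cancel_of_isCoprime {x y z N : ℤ} (hz : IsCoprime z N)
    (h : z * x ≡ z * y [ZMOD N]) : x ≡ y [ZMOD N] := by
  rw [Int.modEq_iff_dvd] at h ⊢
  rw [← mul_sub] at h
  exact hz.symm.dvd_of_dvd_mul_left h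

/-- The conditions under which `coordZ ^ 2` is a geometric progression with step `M` modulo `N`. -/
structure IsQuasiPeriod (N : ℤ) (M : ℕ) : Prop where
  even : M % 2 = 0
  dvd : N ∣ W M ^ 2
  num : numX M ^ 6 ≡ 1 [ZMOD N]

namespace IsQuasiPeriod

variable {N : ℤ} {M : ℕ}

lemma mul_modEq (h : IsQuasiPeriod N M) (S : ℤ) :
    coordZ (S + M) ^ 2 * coordZ (S - M) ^ 2 ≡ (coordZ S ^ 2) ^ 2 [ZMOD N] := by
  have := (sq_coordZ_mul_modEq h.even h.dvd S).trans (h.num.mul_right _)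
  rwa [one_mul] at this

lemma isCoprime (h : IsQuasiPeriod N M) {S : ℤ} (hS : IsCoprime (coordZ S ^ 2) N) (k : ℤ) :
    IsCoprime (coordZ (S + k * M) ^ 2) N := by
  have step : ∀ T : ℤ, IsCoprime (coordZ T ^ 2) N →
      IsCoprime (coordZ (T + M) ^ 2) N ∧ IsCoprime (coordZ (T - M) ^ 2) N := by
    intro T hT
    have := (h.mul_modEq T).symm.isCoprime hT.pow_left
    exact ⟨this.of_mul_left_left, this.of_mul_left_right⟩
  induction k using Int.induction_on with
  | zero => simpa using hS
  | succ k ih => convert (step _ ih).1 using 3; ring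
  | pred k ih => convert (step _ ih).2 using 3; ring

lemma progression (h : IsQuasiPeriod N M) {S v d : ℤ} (hv : IsCoprime v N) (hd : N ∣ d ^ 2)
    (h0 : coordZ S ^ 2 ≡ v [ZMOD N]) (h1 : coordZ (S + M) ^ 2 ≡ v * (1 + d) [ZMOD N]) (k : ℤ) :
    coordZ (S + k * M) ^ 2 ≡ v * (1 + k * d) [ZMOD N] := by
  have unit : ∀ j : ℤ, IsCoprime (1 + j * d) N := by
    intro j
    obtain ⟨c, hc⟩ := hd
    exact ⟨1 - j * d, j ^ 2 * c, by linear_combination -j ^ 2 * hc⟩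
  have rel : ∀ j : ℤ, (1 + (j + 1) * d) * (1 + (j - 1) * d) ≡ (1 + j * d) ^ 2 [ZMOD N] := by
    intro j
    rw [Int.modEq_iff_dvd]
    exact Eq.mp (congrArg (N ∣ ·) (by ring)) hd
  have key : ∀ j : ℤ, coordZ (S + j * M) ^ 2 ≡ v * (1 + j * d) [ZMOD N] ∧
      coordZ (S + (j + 1) * M) ^ 2 ≡ v * (1 + (j + 1) * d) [ZMOD N] := by
    intro j
    induction j using Int.induction_on with
    | zero => simpa using ⟨h0, h1⟩
    | succ j ih =>
      refine ⟨ih.2, ?_⟩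
      have := h.mul_modEq (S + (j + 1) * M)
      rw [show S + ((j : ℤ) + 1) * M + M = S + (j + 1 + 1) * M by ring,
        show S + ((j : ℤ) + 1) * M - M = S + j * M by ring] at this
      have h2 := ((ih.1.symm.mul_left _).trans this).trans (ih.2.pow 2)
      refine Int.ModEq.cancel_of_isCoprime (hv.mul_left (unit j)) ?_
      rw [mul_comm]
      refine h2.trans ?_
      have h3 := ((rel (j + 1)).mul_left (v ^ 2)).symm
      convert h3 using 1 <;> ring
    | pred j ih =>
      rw [sub_add_cancel]
      refine ⟨?_, ih.1⟩
      have := h.mul_modEq (S + (-(j : ℤ)) * M)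
      rw [show S + (-(j : ℤ)) * M + M = S + (-j + 1) * M by ring,
        show S + (-(j : ℤ)) * M - M = S + (-j - 1) * M by ring] at this
      have h2 := ((ih.2.symm.mul_right _).trans this).trans (ih.1.pow 2)
      refine Int.ModEq.cancel_of_isCoprime (hv.mul_left (unit (-j + 1))) ?_
      refine h2.trans ?_
      have h3 := ((rel (-j)).mul_left (v ^ 2)).symm
      convert h3 using 1 <;> ring
  exact (key k).1

lemma modEq_one_of_period (h : IsQuasiPeriod N M) {r k : ℤ}
    (hr : coordZ (r + M) ^ 2 ≡ coordZ r ^ 2 [ZMOD N])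
    (h1 : coordZ (r + k * M) ^ 2 = 1) : coordZ r ^ 2 ≡ 1 [ZMOD N] := by
  have hc := h.isCoprime (S := r + k * M) (by rw [h1]; exact isCoprime_one_left) (-k)
  rw [show r + k * M + -k * (M : ℤ) = r by ring] at hc
  have := h.progression hc (d := 0) (by simp) Int.ModEq.rfl (by simpa using hr) k
  rw [h1] at this
  simpa using this.symm

end IsQuasiPeriod
end curve

namespace curve

/-- The list consists of the values of `f` from index `j` on, modulo `N`. -/
def IsTable (N : ℤ) (f : ℤ → ℤ) : ℤ → List ℤ → Prop
  | _, [] => True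
  | j, x :: l => x ≡ f j [ZMOD N] ∧ IsTable N f (j + 1) l

lemma IsTable.getD_modEq {N : ℤ} {f : ℤ → ℤ} : ∀ {l : List ℤ} {j : ℤ}, IsTable N f j l →
    ∀ i : ℕ, i < l.length → l.getD i 0 ≡ f (j + i) [ZMOD N]
  | x :: l, j, h, 0, _ => by simpa using h.1
  | x :: l, j, h, i + 1, hi => by
    have := IsTable.getD_modEq h.2 i (by simpa using hi)
    rw [List.getD_cons_succ]
    convert this using 2
    push_cast; ring

/-- The doubling formulas, applied along a table of `W`. -/
def doubleTable (N : ℤ) : ℤ → ℤ → List ℤ → List ℤ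
  | e, f, a :: b :: c :: d :: g :: l =>
    (c * (g * (b * b) - a * (d * d))) % N :: (f * g * (c * c * c) - e * b * (d * d * d)) % N ::
      doubleTable N f e (b :: c :: d :: g :: l)
  | _, _, _ => []

lemma isTable_doubleTable {N : ℤ} : ∀ (l : List ℤ) (k : ℤ), IsTable N W (k - 2) l →
    IsTable N W (2 * k) (doubleTable N (eps k) (eps (k + 1)) l)
  | a :: b :: c :: d :: g :: l, k, h => by
    obtain ⟨ha, hb, hc, hd, hg, hl⟩ := h
    have ih := isTable_doubleTable (b :: c :: d :: g :: l) (k + 1)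
      (by rw [show k + 1 - 2 = k - 2 + 1 by ring]; exact ⟨hb, hc, hd, hg, hl⟩)
    rw [show k - 2 + 1 = k - 1 by ring] at hb
    rw [show k - 2 + 1 + 1 = k by ring] at hc
    rw [show k - 2 + 1 + 1 + 1 = k + 1 by ring] at hd
    rw [show k - 2 + 1 + 1 + 1 + 1 = k + 2 by ring] at hg
    rw [add_assoc k 1 1, one_add_one_eq_two, eps_add_two] at ih
    refine ⟨(Int.mod_modEq _ _).trans ?_, (Int.mod_modEq _ _).trans ?_, ?_⟩
    · rw [W_even]
      have := hc.mul ((hg.mul (hb.pow 2)).sub (ha.mul (hd.pow 2)))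
      simpa only [sq] using this
    · rw [W_odd]
      have := ((hg.mul_left (eps (k + 1))).mul (hc.pow 3)).sub
        ((hb.mul_left (eps k)).mul (hd.pow 3))
      convert this using 1; ring
    · convert ih using 1; ring
  | [], _, _ => trivial
  | [_], _, _ => trivial
  | [_, _], _, _ => trivial
  | [_, _, _], _, _ => trivial
  | [_, _, _, _], _, _ => trivial

/-- Values of `W` from index `-4` on, obtained by repeated doubling. -/
def tableW (N : ℤ) : ℕ → List ℤ
  | 0 => [1, 1, -1, -1, 0, 1, 1, -1, -1]
  | n + 1 => doubleTable N 1 2 (tableW N n)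

lemma W_four : W 4 = -1 := by
  have := W_add_two_apart 2
  norm_num [eps, W_three, W_two, W_one, W_zero] at this
  exact this

lemma isTable_tableW (N : ℤ) : ∀ n : ℕ, IsTable N W (-4) (tableW N n)
  | 0 => by
    simp [tableW, IsTable, W_neg, W_zero, W_one, W_two, W_three, W_four]
  | n + 1 => isTable_doubleTable (tableW N n) (-2) (isTable_tableW N n)

/-- The values of `coordZ` computed from a table of `W`. -/
def zTable (N : ℤ) : ℤ → ℤ → List ℤ → List ℤ
  | e, f, a :: b :: c :: d :: l =>
    (f * d * a * b - f * (b * b) * c - a * (c * c)) % N :: zTable N f e (b :: c :: d :: l)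
  | _, _, _ => []

lemma isTable_zTable {N : ℤ} : ∀ (l : List ℤ) (k : ℤ), IsTable N W (k - 1) l →
    IsTable N coordZ k (zTable N (eps k) (eps (k + 1)) l)
  | a :: b :: c :: d :: l, k, h => by
    obtain ⟨ha, hb, hc, hd, hl⟩ := h
    have ih := isTable_zTable (b :: c :: d :: l) (k + 1)
      (by rw [show k + 1 - 1 = k - 1 + 1 by ring]; exact ⟨hb, hc, hd, hl⟩)
    rw [show k - 1 + 1 = k by ring] at hb
    rw [show k - 1 + 1 + 1 = k + 1 by ring] at hc
    rw [show k - 1 + 1 + 1 + 1 = k + 2 by ring] at hd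
    rw [add_assoc k 1 1, one_add_one_eq_two, eps_add_two] at ih
    refine ⟨(Int.mod_modEq _ _).trans ?_, ih⟩
    unfold coordZ coordA coordB coordC
    have := ((((hd.mul_left (eps (k + 1))).mul ha).mul hb).sub
      (((hb.pow 2).mul_left (eps (k + 1))).mul hc)).sub (ha.mul (hc.pow 2))
    simpa only [sq] using this
  | [], _, _ => trivial
  | [_], _, _ => trivial
  | [_, _], _, _ => trivial
  | [_, _, _], _, _ => trivial

/-- Values of `coordZ` from index `-3` on. -/
def tableZ (N : ℤ) (n : ℕ) : List ℤ := zTable N 2 1 (tableW N n)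

lemma isTable_tableZ (N : ℤ) (n : ℕ) : IsTable N coordZ (-3) (tableZ N n) :=
  isTable_zTable (tableW N n) (-3) (isTable_tableW N n)

lemma tableW_modEq (N : ℤ) (n i : ℕ) (h : i + 4 < (tableW N n).length) :
    (tableW N n).getD (i + 4) 0 ≡ W i [ZMOD N] := by
  have := (isTable_tableW N n).getD_modEq (i + 4) h
  convert this using 2; push_cast; ring

lemma tableZ_modEq (N : ℤ) (n i : ℕ) (h : i + 3 < (tableZ N n).length) :
    (tableZ N n).getD (i + 3) 0 ≡ coordZ i [ZMOD N] := by
  have := (isTable_tableZ N n).getD_modEq (i + 3) h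
  convert this using 2; push_cast; ring

end curve

namespace curve

lemma sq_coordZ_emod (N : ℤ) (n i : ℕ) (h : i + 3 < (tableZ N n).length) :
    coordZ i ^ 2 % N = (tableZ N n).getD (i + 3) 0 ^ 2 % N :=
  ((tableZ_modEq N n i h).symm.pow 2)

lemma numX_of_even {M : ℕ} (hM : M % 2 = 0) : numX M = -(W (M + 1) * W (M - 1)) := by
  rw [numX, eps_even (by omega), one_mul]

lemma isQuasiPeriod_of_table (N : ℤ) (n M : ℕ) (hM : (M + 1) % 2 = 0)
    (hl : M + 2 + 4 < (tableW N n).length) (hd : N ∣ (tableW N n).getD (M + 1 + 4) 0 ^ 2)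
    (hn : (-((tableW N n).getD (M + 2 + 4) 0 * (tableW N n).getD (M + 4) 0)) ^ 6 % N = 1 % N) :
    IsQuasiPeriod N (M + 1) where
  even := hM
  dvd := by
    have := (tableW_modEq N n (M + 1) (by omega)).pow 2
    exact this.dvd_iff.1 hd
  num := by
    rw [numX_of_even hM]
    have h1 := (tableW_modEq N n (M + 2) hl).mul (tableW_modEq N n M (by omega))
    have := (h1.neg.pow 6).symm.trans hn
    push_cast at this ⊢
    rwa [add_sub_cancel_right, add_assoc (M : ℤ) 1 1, one_add_one_eq_two]

lemma isQuasiPeriod_27 : IsQuasiPeriod 27 126 :=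
  isQuasiPeriod_of_table 27 8 125 (by decide) (by decide +kernel) (by decide +kernel)
    (by decide +kernel)

lemma isQuasiPeriod_81 : IsQuasiPeriod 81 42 :=
  isQuasiPeriod_of_table 81 8 41 (by decide) (by decide +kernel) (by decide +kernel)
    (by decide +kernel)

lemma isQuasiPeriod_243 : IsQuasiPeriod 243 126 :=
  isQuasiPeriod_of_table 243 8 125 (by decide) (by decide +kernel) (by decide +kernel)
    (by decide +kernel)

lemma isQuasiPeriod_19 : IsQuasiPeriod 19 126 :=
  isQuasiPeriod_of_table 19 8 125 (by decide) (by decide +kernel) (by decide +kernel)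
    (by decide +kernel)

lemma isQuasiPeriod_49 : IsQuasiPeriod 49 210 :=
  isQuasiPeriod_of_table 49 9 209 (by decide) (by decide +kernel) (by decide +kernel)
    (by decide +kernel)

/-- A check, by computation, that `coordZ ^ 2` is `M`-periodic modulo `N` at `r`, with a value at
`r` other than `1`. -/
def isExcluded (N : ℤ) (n M r : ℕ) : Bool :=
  r + M + 3 < (tableZ N n).length ∧
    (tableZ N n).getD (r + M + 3) 0 ^ 2 % N = (tableZ N n).getD (r + 3) 0 ^ 2 % N ∧
    (tableZ N n).getD (r + 3) 0 ^ 2 % N ≠ 1 % N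

lemma sq_coordZ_ne_one_of_isExcluded {N : ℤ} {n M r : ℕ} (h : IsQuasiPeriod N M)
    (hr : isExcluded N n M r) {m : ℤ} (hm : m % M = r) : coordZ m ^ 2 ≠ 1 := by
  intro h1
  simp only [isExcluded, decide_eq_true_eq] at hr
  obtain ⟨hl, h2, h3⟩ := hr
  have hm' : m = r + m / M * M := by rw [← hm]; exact (Int.emod_add_ediv_mul m M).symm
  rw [hm'] at h1
  have := h.modEq_one_of_period (r := r) ?_ h1
  · rw [Int.ModEq, sq_coordZ_emod N n r (by omega)] at this
    exact h3 this
  · rw [Int.ModEq, sq_coordZ_emod N n r (by omega), ← h2, ← sq_coordZ_emod N n (r + M) hl]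
    push_cast; rfl

lemma mem_residues_27 : ∀ r < 126, isExcluded 27 8 126 r ∨
    r ∈ [0, 1, 2, 3, 22, 37, 44, 79, 86, 102, 103, 104, 105, 108, 121, 123, 124, 125] := by
  decide +kernel

lemma isExcluded_19 : ∀ r ∈ [22, 102, 104, 105, 108], isExcluded 19 8 126 r := by
  decide +kernel

lemma isExcluded_49 : ∀ i < 5, isExcluded 49 9 210 (19 + 42 * i) := by
  decide +kernel

lemma W_eq_tableW (n i : ℕ) (h : i + 4 < (tableW 0 n).length) :
    W i = (tableW 0 n).getD (i + 4) 0 :=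
  (Int.modEq_zero_iff.1 (tableW_modEq 0 n i h)).symm

lemma W_five : W 5 = -1 := W_eq_tableW 1 5 (by decide)

lemma W_six : W 6 = 2 := W_eq_tableW 2 6 (by decide)

/-- The indices of small absolute value at which `coordZ` is `1` or `-1`. -/
def smallIndices : List ℤ := [-5, -3, -2, -1, 0, 1, 2, 3]

lemma sq_coordZ_of_mem_smallIndices : ∀ s ∈ smallIndices, coordZ s ^ 2 = 1 := by
  simp [smallIndices, coordZ, coordA, coordB, coordC, eps, W_neg, W_zero, W_one, W_two, W_three,
    W_four, W_five, W_six]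

lemma three_dvd_of_sq_coordZ_eq_one {D t s k : ℤ} {M : ℕ} (h : IsQuasiPeriod (3 * D) M)
    (hD : 3 ∣ D) (hD0 : D ≠ 0) (ht : ¬ 3 ∣ t) (hs : coordZ s ^ 2 = 1)
    (h1 : coordZ (s + M) ^ 2 ≡ 1 + D * t [ZMOD 3 * D]) (hk : coordZ (s + k * M) ^ 2 = 1) :
    3 ∣ k := by
  have hd : 3 * D ∣ (D * t) ^ 2 := by
    obtain ⟨c, rfl⟩ := hD
    exact ⟨c * t ^ 2, by ring⟩
  have := h.progression isCoprime_one_left hd (by rw [hs]) (by simpa using h1) k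
  rw [hk, one_mul, Int.modEq_iff_dvd, show 1 + k * (D * t) - 1 = k * t * D by ring] at this
  exact (Int.prime_three.dvd_or_dvd (Int.dvd_of_mul_dvd_mul_right hD0 this)).resolve_right ht

lemma emod_126_of_emod_42 {m s t : ℤ} (hs : coordZ s ^ 2 = 1) (ht : ¬ 3 ∣ t)
    (h1 : coordZ (s + 42) ^ 2 ≡ 1 + 27 * t [ZMOD 81]) (h : coordZ m ^ 2 = 1)
    (hm : (m - s) % 42 = 0) : (m - s) % 126 = 0 := by
  obtain ⟨k, hk⟩ := Int.dvd_of_emod_eq_zero hm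
  have := three_dvd_of_sq_coordZ_eq_one (D := 27) (k := k) isQuasiPeriod_81 (by norm_num)
    (by norm_num) ht hs h1 (by rw [← h]; congr 2; push_cast; linarith)
  omega

lemma sq_coordZ_44 : coordZ 44 ^ 2 % 81 = 28 :=
  (sq_coordZ_emod 81 8 44 (by decide +kernel)).trans (by decide +kernel)

lemma sq_coordZ_37 : coordZ 37 ^ 2 % 81 = 28 :=
  (sq_coordZ_emod 81 8 37 (by decide +kernel)).trans (by decide +kernel)

lemma exists_smallIndex {m : ℤ} (h : coordZ m ^ 2 = 1) :
    ∃ s ∈ smallIndices, ∃ k : ℤ, m = s + k * 126 := by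
  have h27 := mem_residues_27 (m % 126).toNat (by omega)
  have e : m % (126 : ℕ) = ((m % 126).toNat : ℤ) := by omega
  have h27 := h27.resolve_left fun hr => sq_coordZ_ne_one_of_isExcluded isQuasiPeriod_27 hr e h
  have h19 : (m % 126).toNat ∉ [22, 102, 104, 105, 108] := fun hr =>
    sq_coordZ_ne_one_of_isExcluded isQuasiPeriod_19 (isExcluded_19 _ hr) e h
  have h49 : m % 42 ≠ 19 := fun hr => by
    refine sq_coordZ_ne_one_of_isExcluded isQuasiPeriod_49
      (isExcluded_49 ((m % 210).toNat / 42) (by omega)) ?_ h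
    push_cast
    omega
  have h2 := emod_126_of_emod_42 (m := m) (s := 2) (t := 1)
    (sq_coordZ_of_mem_smallIndices 2 (by decide)) (by decide)
    (by norm_num [Int.ModEq, sq_coordZ_44]) h
  have h5 := emod_126_of_emod_42 (m := m) (s := -5) (t := 1)
    (sq_coordZ_of_mem_smallIndices (-5) (by decide)) (by decide)
    (by norm_num [Int.ModEq, sq_coordZ_37]) h
  have key : ∀ r ∈ [0, 1, 2, 3, 22, 37, 44, 79, 86, 102, 103, 104, 105, 108, 121, 123, 124, 125],
      r ∈ [22, 102, 104, 105, 108] ∨ r = 103 ∨ r % 42 = 2 ∨ r % 42 = 37 ∨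
        ∃ s ∈ smallIndices, ((r : ℕ) - s : ℤ) % 126 = 0 := by decide
  rcases key _ h27 with hr | hr | hr | hr | ⟨s, hs, hr⟩
  · exact absurd hr h19
  · omega
  · exact ⟨2, by decide, (m - 2) / 126, by omega⟩
  · exact ⟨-5, by decide, (m - -5) / 126, by omega⟩
  · exact ⟨s, hs, (m - s) / 126, by omega⟩

end curve

namespace curve

/-- Divisibility conditions on an index `M` that are inherited by `3 * M` when `q` is replaced by
`3 * q`. -/
structure IsThreeStep (q : ℤ) (M : ℕ) : Prop where
  even : M % 2 = 0
  dvd : 27 * q ∣ W M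
  num : numX M ^ 6 ≡ 1 [ZMOD 243 * q]

lemma parityFactor_of_even (m : ℤ) {n : ℤ} (hn : n % 2 = 0) : parityFactor m n = 1 := by
  unfold parityFactor; rw [if_neg]; omega

lemma W_two_mul_add_one_modEq {M : ℤ} (hM : M % 2 = 0) :
    W (2 * M + 1) ≡ -(W (M - 1) * W (M + 1) ^ 3) [ZMOD W M ^ 2] := by
  rw [W_odd, eps_even hM, Int.modEq_iff_dvd]
  exact ⟨-(eps (M + 1) * W (M + 2) * W M), by ring⟩

lemma W_two_mul_sub_one_modEq {M : ℤ} (hM : M % 2 = 0) :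
    W (2 * M - 1) ≡ W (M + 1) * W (M - 1) ^ 3 [ZMOD W M ^ 2] := by
  have := W_odd (M - 1)
  rw [show 2 * (M - 1) + 1 = 2 * M - 1 by ring, sub_add_cancel, eps_even hM,
    show M - 1 + 2 = M + 1 by ring, show M - 1 - 1 = M - 2 by ring] at this
  rw [this, Int.modEq_iff_dvd]
  exact ⟨eps (M - 1) * W (M - 2) * W M, by ring⟩

lemma three_mul_W_dvd_W_three_mul {M : ℤ} (hM : M % 2 = 0) (h0 : M ≠ 0) (h3 : 3 ∣ W M) :
    3 * W M ∣ W (3 * M) := by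
  have h := W_addForm (2 * M) M
  rw [parityFactor_of_even _ hM, eps_even hM, eps_even (by omega), W_even M,
    show 2 * M + M = 3 * M by ring, show 2 * M - M = M by ring] at h
  have h2 := W_mul_two_apart M
  have h3' := W_add_two_apart M
  rw [eps_even hM] at h2
  have key : W (3 * M) = W M * (W (2 * M + 1) * W (2 * M - 1) - W (M + 1) * W (M - 1) *
      (W (M + 2) * W (M - 1) ^ 2 - W (M - 2) * W (M + 1) ^ 2) ^ 2) := by
    refine mul_right_cancel₀ (W_ne_zero h0) ?_
    linear_combination -h
  have hs2 : 3 ∣ W M ^ 2 := dvd_pow h3 (by norm_num)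
  have e1 := ((W_two_mul_add_one_modEq hM).of_dvd hs2).mul
    ((W_two_mul_sub_one_modEq hM).of_dvd hs2)
  have e2 : (W (M + 2) * W (M - 1) ^ 2 - W (M - 2) * W (M + 1) ^ 2) ^ 2 ≡
      -4 * (W (M + 1) * W (M - 1)) ^ 3 [ZMOD 3] := by
    refine Int.modEq_iff_dvd.2 (h3.trans ⟨4 * W M * (W (M + 1) * W (M - 1)) ^ 2 -
      W M * (eps (M + 1) * W M ^ 2 + W (M + 1) * W (M - 1)) ^ 2, ?_⟩)
    linear_combination 4 * (W (M + 1) * W (M - 1)) ^ 2 * h2 -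
      (W (M + 2) * W (M - 1) ^ 2 + W (M - 2) * W (M + 1) ^ 2 -
        eps (M + 1) * W M ^ 3 - W (M + 1) * W (M - 1) * W M) * h3'
  have := e1.sub (e2.mul_left (W (M + 1) * W (M - 1)))
  rw [key, mul_comm 3]
  refine mul_dvd_mul_left _ ?_
  refine (this.dvd_iff).2 ⟨(W (M + 1) * W (M - 1)) ^ 4, by ring⟩

lemma numX_three_mul_modEq {M : ℕ} (hM : M % 2 = 0) :
    numX (3 * M : ℕ) * numX M ≡ numX M ^ 10 [ZMOD W M ^ 2] := by
  have hM' : (M : ℤ) % 2 = 0 := by omega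
  rw [numX_of_even hM, numX_of_even (show 3 * M % 2 = 0 by omega)]
  have h1 := W_addForm (2 * M + 1) M
  have h2 := W_addForm (2 * M - 1) M
  rw [parityFactor_of_even _ hM', eps_even hM', one_mul, one_mul] at h1 h2
  rw [show 2 * (M : ℤ) + 1 + M = 3 * M + 1 by ring, show 2 * (M : ℤ) + 1 - M = M + 1 by ring] at h1
  rw [show 2 * (M : ℤ) - 1 + M = 3 * M - 1 by ring, show 2 * (M : ℤ) - 1 - M = M - 1 by ring] at h2
  have e1 : W (3 * M + 1) * W (M + 1) ≡
      -(W (M + 1) * W (M - 1) * (-(W (M - 1) * W (M + 1) ^ 3)) ^ 2) [ZMOD W M ^ 2] := by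
    refine Int.ModEq.trans ?_ (((W_two_mul_add_one_modEq hM').pow 2).mul_left _).neg
    rw [← h1, Int.modEq_iff_dvd]
    exact ⟨-(eps (2 * M + 1) * W (2 * M + 1 + 1) * W (2 * M + 1 - 1)), by ring⟩
  have e2 : W (3 * M - 1) * W (M - 1) ≡
      -(W (M + 1) * W (M - 1) * (W (M + 1) * W (M - 1) ^ 3) ^ 2) [ZMOD W M ^ 2] := by
    refine Int.ModEq.trans ?_ (((W_two_mul_sub_one_modEq hM').pow 2).mul_left _).neg
    rw [← h2, Int.modEq_iff_dvd]
    exact ⟨-(eps (2 * M - 1) * W (2 * M - 1 + 1) * W (2 * M - 1 - 1)), by ring⟩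
  have := e1.mul e2
  push_cast
  convert this using 1 <;> ring

namespace IsThreeStep

variable {q : ℤ} {M : ℕ}

lemma sq_dvd (h : IsThreeStep q M) : 729 * q ∣ W M ^ 2 := by
  obtain ⟨c, hc⟩ := h.dvd
  exact ⟨q * c ^ 2, by rw [hc]; ring⟩

lemma num_pow_three (h : IsThreeStep q M) : (numX M ^ 6) ^ 3 ≡ 1 [ZMOD 729 * q] := by
  obtain ⟨c, hc⟩ := Int.modEq_iff_dvd.1 h.num.symm
  rw [show numX M ^ 6 = 1 + 243 * q * c by linarith]
  exact (Int.modEq_iff_dvd.2 ⟨c + 243 * q * c ^ 2 + 3 * 81 * 81 * q ^ 2 * c ^ 3, by ring⟩).symm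

lemma isCoprime_num (h : IsThreeStep q M) : IsCoprime (numX M ^ 6) (729 * q) := by
  have : IsCoprime ((numX M ^ 6) ^ 3) (729 * q) :=
    h.num_pow_three.symm.isCoprime isCoprime_one_left
  exact this.of_isCoprime_of_dvd_left (dvd_pow_self _ (by norm_num))

lemma three_mul (h : IsThreeStep q M) (h0 : M ≠ 0) : IsThreeStep (3 * q) (3 * M) where
  even := by have := h.even; omega
  dvd := by
    have h3 : 3 ∣ W M := (Dvd.intro (9 * q) (by ring)).trans h.dvd
    have := three_mul_W_dvd_W_three_mul (by have := h.even; omega) (by exact_mod_cast h0) h3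
    push_cast
    exact (Eq.mp (congrArg (· ∣ 3 * W M) (by ring)) (mul_dvd_mul_left 3 h.dvd)).trans this
  num := by
    have h1 := ((numX_three_mul_modEq h.even).of_dvd h.sq_dvd).pow 6
    have h2 : numX M ^ 6 * numX (3 * M : ℕ) ^ 6 ≡ numX M ^ 6 * ((numX M ^ 6) ^ 3) ^ 3
        [ZMOD 729 * q] := by convert h1 using 1 <;> ring
    have h3 := (h2.cancel_of_isCoprime h.isCoprime_num).trans (h.num_pow_three.pow 3)
    rw [one_pow] at h3
    convert h3 using 1; ring

lemma isQuasiPeriod (h : IsThreeStep q M) {N : ℤ} (hN : N ∣ 243 * q) : IsQuasiPeriod N M where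
  even := h.even
  dvd := (hN.trans ⟨3, by ring⟩).trans h.sq_dvd
  num := h.num.of_dvd hN

lemma sq_coordZ_three_mul (h : IsThreeStep q M) {D s t : ℤ} (h3 : 3 ∣ D) (hD : D ∣ 81 * q)
    (hs : coordZ s ^ 2 = 1) (h1 : coordZ (s + M) ^ 2 = 1 + D * t) :
    coordZ (s + (3 * M : ℕ)) ^ 2 ≡ 1 + 3 * D * t [ZMOD 9 * D] := by
  have hN : 9 * D ∣ 729 * q := Eq.mp (congrArg (9 * D ∣ ·) (by ring)) (mul_dvd_mul_left 9 hD)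
  have e1 := sq_coordZ_mul_modEq h.even (hN.trans h.sq_dvd) (s + M)
  have e2 := sq_coordZ_mul_modEq h.even (hN.trans h.sq_dvd) (s + M + M)
  rw [add_sub_cancel_right] at e1 e2
  rw [hs, mul_one] at e1
  have e3 := e2.trans ((e1.pow 2).mul_left _)
  rw [h1] at e3
  have hc : IsCoprime (1 + D * t) (9 * D) := by
    obtain ⟨c, rfl⟩ := h3
    refine ⟨1 - 3 * c * t + 9 * c ^ 2 * t ^ 2, -c ^ 2 * t ^ 3, by ring⟩
  have e4 : (1 + D * t) * coordZ (s + M + M + M) ^ 2 ≡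
      (1 + D * t) * ((numX M ^ 6) ^ 3 * (1 + D * t) ^ 3) [ZMOD 9 * D] := by
    convert e3 using 1 <;> ring
  have e5 := (e4.cancel_of_isCoprime hc).trans ((h.num_pow_three.of_dvd hN).mul_right _)
  rw [show s + M + M + M = s + (3 * M : ℕ) by push_cast; ring] at e5
  refine e5.trans ?_
  obtain ⟨c, rfl⟩ := h3
  exact Int.modEq_iff_dvd.2 ⟨-(c * t ^ 2 + c ^ 2 * t ^ 3), by ring⟩

end IsThreeStep
end curve

namespace curve

lemma isThreeStep_one : IsThreeStep 1 126 where
  even := rfl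
  dvd := (tableW_modEq 27 8 126 (by decide +kernel)).dvd_iff.1 (by decide +kernel)
  num := isQuasiPeriod_243.num

/-- The residues of `coordZ ^ 2` modulo `243` one step after the small indices. -/
lemma emod_243_of_mem_smallIndices : ∀ s ∈ smallIndices,
    coordZ (s + 126) ^ 2 % 243 ∈ [28, 55, 82, 136, 190] := by
  have key : ∀ i ∈ [121, 123, 124, 125, 126, 127, 128, 129],
      i + 3 < (tableZ 243 8).length ∧
        (tableZ 243 8).getD (i + 3) 0 ^ 2 % 243 ∈ [28, 55, 82, 136, 190] := by
    decide +kernel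
  have hi : ∀ s ∈ smallIndices, 0 ≤ s + 126 ∧
      (s + 126).toNat ∈ [121, 123, 124, 125, 126, 127, 128, 129] := by decide
  intro s hs
  obtain ⟨h0, hm⟩ := hi s hs
  obtain ⟨hl, h⟩ := key _ hm
  rwa [← sq_coordZ_emod _ _ _ hl, Int.toNat_of_nonneg h0] at h

lemma exists_sq_coordZ_add_126 {s : ℤ} (hs : s ∈ smallIndices) : ∃ d t : ℤ,
    (d = 27 ∨ d = 81) ∧ ¬ 3 ∣ t ∧ coordZ (s + 126) ^ 2 = 1 + d * t := by
  have := emod_243_of_mem_smallIndices s hs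
  generalize coordZ (s + 126) ^ 2 = v at *
  simp only [List.mem_cons, List.not_mem_nil, or_false] at this
  by_cases h : v % 243 = 82
  · exact ⟨81, v / 81, Or.inr rfl, by omega, by omega⟩
  · exact ⟨27, v / 27, Or.inl rfl, by omega, by omega⟩

lemma three_adic_step {s d t : ℤ} (hs : coordZ s ^ 2 = 1) (hd : d = 27 ∨ d = 81) (ht : ¬ 3 ∣ t)
    (h : coordZ (s + 126) ^ 2 = 1 + d * t) (e : ℕ) :
    IsThreeStep (3 ^ e) (126 * 3 ^ e) ∧
      ∃ t : ℤ, ¬ 3 ∣ t ∧ coordZ (s + (126 * 3 ^ e : ℕ)) ^ 2 = 1 + d * 3 ^ e * t := by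
  induction e with
  | zero => exact ⟨isThreeStep_one, t, ht, by simpa using h⟩
  | succ e ih =>
    obtain ⟨h3, t, ht, h⟩ := ih
    have e1 : 126 * 3 ^ (e + 1) = 3 * (126 * 3 ^ e) := by ring
    have e2 : (3 : ℤ) ^ (e + 1) = 3 * 3 ^ e := by ring
    rw [e1, e2]
    refine ⟨h3.three_mul (by positivity), ?_⟩
    have hD : d * 3 ^ e ∣ 81 * 3 ^ e :=
      mul_dvd_mul_right (by rcases hd with rfl | rfl <;> norm_num) _
    have hD3 : 3 ∣ d * 3 ^ e := Dvd.dvd.mul_right (by rcases hd with rfl | rfl <;> norm_num) _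
    obtain ⟨c, hc⟩ := Int.modEq_iff_dvd.1 (h3.sq_coordZ_three_mul hD3 hD hs h)
    refine ⟨t - 3 * c, by omega, by linear_combination -hc⟩

lemma mem_smallIndices {m : ℤ} (hm : coordZ m ^ 2 = 1) : m ∈ smallIndices := by
  obtain ⟨s, hs, k, rfl⟩ := exists_smallIndex hm
  by_cases hk : k = 0
  · simpa [hk] using hs
  exfalso
  have h1 := sq_coordZ_of_mem_smallIndices s hs
  obtain ⟨d, t, hd, ht, h⟩ := exists_sq_coordZ_add_126 hs
  have hfin : FiniteMultiplicity 3 k := Int.finiteMultiplicity_iff.2 ⟨by decide, hk⟩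
  obtain ⟨j, he, hj⟩ := hfin.exists_eq_pow_mul_and_not_dvd
  generalize multiplicity 3 k = e at he
  subst he
  obtain ⟨h3, t, ht, h⟩ := three_adic_step h1 hd ht h e
  refine hj (three_dvd_of_sq_coordZ_eq_one (D := d * 3 ^ e)
    (h3.isQuasiPeriod ?_) ?_ ?_ ht h1 (by rw [h]) ?_)
  · rcases hd with rfl | rfl
    · exact ⟨3, by ring⟩
    · exact ⟨1, by ring⟩
  · exact Dvd.dvd.mul_right (by rcases hd with rfl | rfl <;> norm_num) _
  · rcases hd with rfl | rfl <;> positivity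
  · rw [← hm]
    congr 2
    push_cast
    ring

lemma quotient_lt_three {m y : ℤ} (hm : m ∈ smallIndices) (h0 : m ≠ 0) (h1 : m ≠ 1) (h2 : m ≠ -1)
    (h : coordA m + coordB m = y * coordZ m) : y < 3 := by
  simp only [smallIndices, List.mem_cons, List.not_mem_nil, or_false] at hm
  rcases hm with rfl | rfl | rfl | rfl | rfl | rfl | rfl | rfl <;> first | contradiction | skip
  all_goals
    norm_num [coordZ, coordA, coordB, coordC, eps, W_neg, W_zero, W_one, W_two, W_three,
      W_four, W_five, W_six] at h
    omega

theorem cubic_ne {x y : ℤ} (hy : 3 ≤ y) (hxy : y < x) : y * (y + 1) * (x + y) ≠ x ^ 3 - x := by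
  intro h
  obtain ⟨m, h0, h1, h2, hm, h⟩ := exists_multiple_of_integral (by omega) hxy h
  exact absurd (quotient_lt_three (mem_smallIndices hm) h0 h1 h2 h) (by omega)

end curve

theorem no_collision_n_sub_one_k_add_two (n k : ℕ)
    (hk2 : 2 ≤ k) (hkn : k ≤ n / 2) (hl2 : 2 ≤ k + 2) (hlm : k + 2 ≤ (n - 1) / 2) :
    Nat.choose n k ≠ Nat.choose (n - 1) (k + 2) := by
  intro h
  obtain ⟨j, rfl⟩ : ∃ j, n = k + 3 + j := ⟨n - (k + 3), by omega⟩
  rw [show k + 3 + j - 1 = k + 2 + j by omega] at h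
  have h1 := Nat.choose_mul_succ_eq (k + 2 + j) (k + 2)
  have h2 := Nat.choose_succ_right_eq (k + 3 + j) k
  have h3 := Nat.choose_succ_right_eq (k + 3 + j) (k + 1)
  have hpos : 0 < (k + 3 + j).choose k := Nat.choose_pos (by omega)
  rw [show k + 2 + j + 1 = k + 3 + j by ring, show k + 3 + j - (k + 2) = j + 1 by omega, ← h] at h1
  rw [show k + 3 + j - k = j + 3 by omega] at h2
  rw [show k + 3 + j - (k + 1) = j + 2 by omega, show k + 1 + 1 = k + 2 by ring] at h3
  refine curve.cubic_ne (y := k + 1) (x := j + 2) (by omega) (by omega) ?_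
  generalize (k + 3 + j).choose k = c at *
  generalize (k + 3 + j).choose (k + 1) = c1 at *
  generalize (k + 3 + j).choose (k + 2) = c2 at *
  have hc : (c : ℤ) ≠ 0 := by exact_mod_cast hpos.ne'
  zify at h1 h2 h3
  refine mul_left_cancel₀ hc ?_
  linear_combination (k + 1 : ℤ) * (k + 2) * h1 + (j + 1 : ℤ) * (k + 1) * h3 +
    (j + 1 : ℤ) * (j + 2) * h2
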